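/- Let n∈ℕ, p>1 and s∈(0,1) with sp/(p−1)>1, write p' = p/(p−1), set α_o := (sp'−1)·min{1,p−1} ∈ (0,1), and let α∈(0,α_o). Let Ω⊆ℝⁿ be a bounded open set, f∈L^{p'}_loc(Ω), and let B_{2R}(x_o) have closure contained in Ω. Let u:ℝⁿ→ℝ be a local weak solution of (−Δ_p)^s u = f in Ω that is continuously differentiable on Ω, and let v:ℝⁿ→ℝ be a local weak solution of (−Δ_p)^s v = 0 in B_R(x_o) that is continuously differentiable on B_R(x_o), with v∈L^p(B_R(x_o)), [v]_{W^{s,p}(B_R(x_o))}<∞ and v = u a.e. in ℝⁿ∖B_R(x_o). Then there exists a constant c = c(n,p,s,α) such that for any δ∈(0,1] one has ∫_{B_{R/2}(x_o)} |∇u−∇v|^p dx ≤ δ [ ∫_{B_{2R}(x_o)} |∇u|^p dx + R^{n−p} Tail(u−(u)_{B_R(x_o)}; B_R(x_o))^p ] + c δ^{−(1+α)/(α(p−1))} R^{p(sp'−1)} ∫_{B_R(x_o)} |f|^{p'} dx. -/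

import Mathlib

open MeasureTheory Metric Set
open scoped ENNReal

noncomputable section

/-- Double Gagliardo integral `∬_{D×D} |u(x)-u(y)|^p / |x-y|^{n+sp} dx dy` in `ℝ≥0∞`. -/
def gagliardoE (n : ℕ) (s p : ℝ) (D : Set (EuclideanSpace ℝ (Fin n)))
    (u : EuclideanSpace ℝ (Fin n) → ℝ) : ℝ≥0∞ :=
  ∫⁻ x in D, ∫⁻ y in D, ENNReal.ofReal (|u x - u y| ^ p / dist x y ^ ((n : ℝ) + s * p))

/-- Nonlocal tail `Tail(u; B_R(x₀))` in `ℝ≥0∞`. -/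
def tailE (n : ℕ) (s p : ℝ) (u : EuclideanSpace ℝ (Fin n) → ℝ)
    (x₀ : EuclideanSpace ℝ (Fin n)) (R : ℝ) : ℝ≥0∞ :=
  (ENNReal.ofReal (R ^ (s * p)) *
      ∫⁻ x in (ball x₀ R)ᶜ,
        ENNReal.ofReal (|u x| ^ (p - 1) / dist x x₀ ^ ((n : ℝ) + s * p))) ^ (1 / (p - 1))

/-- `f ∈ L^q_loc(D)`. -/
def MemLploc (n : ℕ) (q : ℝ) (D : Set (EuclideanSpace ℝ (Fin n)))
    (f : EuclideanSpace ℝ (Fin n) → ℝ) : Prop :=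
  Measurable f ∧
    ∀ K : Set (EuclideanSpace ℝ (Fin n)), K ⊆ D → IsCompact K →
      (∫⁻ x in K, ENNReal.ofReal (|f x| ^ q)) < ⊤

/-- `u` is a local weak solution of `(-Δ_p)^s u = f` in `D`. -/
def IsLocalWeakSolution (n : ℕ) (p s : ℝ) (D : Set (EuclideanSpace ℝ (Fin n)))
    (f u : EuclideanSpace ℝ (Fin n) → ℝ) : Prop :=
  Measurable u ∧
  (∀ K : Set (EuclideanSpace ℝ (Fin n)), K ⊆ D → IsCompact K →
      (∫⁻ x in K, ENNReal.ofReal (|u x| ^ p)) < ⊤ ∧ gagliardoE n s p K u < ⊤) ∧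
  (∫⁻ x, ENNReal.ofReal (|u x| ^ (p - 1) / (1 + ‖x‖) ^ ((n : ℝ) + s * p))) < ⊤ ∧
  ∀ φ : EuclideanSpace ℝ (Fin n) → ℝ, Measurable φ →
    (∃ K : Set (EuclideanSpace ℝ (Fin n)), IsCompact K ∧ K ⊆ D ∧
      ∀ᵐ x, x ∉ K → φ x = 0) →
    (∫⁻ x, ENNReal.ofReal (|φ x| ^ p)) < ⊤ →
    gagliardoE n s p Set.univ φ < ⊤ →
    (∫ x, ∫ y,
        |u x - u y| ^ (p - 2) * (u x - u y) * (φ x - φ y) / dist x y ^ ((n : ℝ) + s * p)) =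
      ∫ x in D, f x * φ x

/-- The signed `γ`-power `𝐚^γ = |a|^{γ-1} a`. -/
def sgnPow (γ a : ℝ) : ℝ := |a| ^ (γ - 1) * a




/-- The nonlinearity `J a = |a|^{p-2} a`. -/
def Jp (p a : ℝ) : ℝ := |a| ^ (p - 2) * a

/-- The exponent `θ = min 1 (p/2)`. -/
def thetaP (p : ℝ) : ℝ := min 1 (p / 2)

lemma Jp_neg (p a : ℝ) : Jp p (-a) = - Jp p a := by simp [Jp]

lemma abs_Jp {p : ℝ} (hp : 1 < p) (a : ℝ) : |Jp p a| = |a| ^ (p - 1) := by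
  unfold Jp
  rw [abs_mul, abs_of_nonneg (Real.rpow_nonneg (abs_nonneg a) _)]
  rcases eq_or_ne a 0 with h | h
  · subst h
    simp [Real.zero_rpow (by linarith : p - 1 ≠ 0)]
  · have : 0 < |a| := abs_pos.mpr h
    conv_lhs => rw [← Real.rpow_one |a|, ← Real.rpow_mul this.le, ← Real.rpow_add (by simpa using this)]
    congr 1; ring

lemma Jp_of_nonneg {p : ℝ} (hp : 1 < p) {a : ℝ} (ha : 0 ≤ a) : Jp p a = a ^ (p - 1) := by
  have h := abs_Jp hp a
  rw [abs_of_nonneg ha] at h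
  rw [← h, abs_of_nonneg]
  exact mul_nonneg (Real.rpow_nonneg (abs_nonneg a) _) ha

lemma Jp_mul_self {p : ℝ} (hp : 1 < p) (a : ℝ) : Jp p a * a = |a| ^ p := by
  unfold Jp
  rw [mul_assoc, ← abs_mul_abs_self]
  rcases eq_or_ne a 0 with h | h
  · subst h
    simp [Real.zero_rpow (by linarith : p ≠ 0)]
  · have : 0 < |a| := abs_pos.mpr h
    have h2 : |a| * |a| = |a| ^ (2 : ℝ) := by norm_num [sq]
    rw [h2, ← Real.rpow_add this]; congr 1; ring

lemma measurable_Jp (p : ℝ) : Measurable (Jp p) := by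
  unfold Jp
  fun_prop

lemma young_p {p a b μ : ℝ} (hp : 1 < p) (ha : 0 ≤ a) (hb : 0 ≤ b) (hμ : 0 < μ) :
    a ^ (p - 1) * b ≤ μ * a ^ p + μ ^ (1 - p) * b ^ p := by
  have hap : a ^ p = a ^ (p - 1) * a := by
    rcases eq_or_lt_of_le ha with h | h
    · subst h; simp [Real.zero_rpow (by linarith : p ≠ 0)]
    · rw [← Real.rpow_add_one h.ne']; congr 1; ring
  have hbp : b ^ p = b ^ (p - 1) * b := by
    rcases eq_or_lt_of_le hb with h | h
    · subst h; simp [Real.zero_rpow (by linarith : p ≠ 0)]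
    · rw [← Real.rpow_add_one h.ne']; congr 1; ring
  have h1 : 0 ≤ a ^ (p - 1) := Real.rpow_nonneg ha _
  have h2 : 0 ≤ b ^ (p - 1) := Real.rpow_nonneg hb _
  have h3 : 0 < μ ^ (1 - p) := Real.rpow_pos_of_pos hμ _
  rcases le_total b (μ * a) with h | h
  · have : a ^ (p - 1) * b ≤ μ * a ^ p := by
      rw [hap]; nlinarith
    have : 0 ≤ μ ^ (1 - p) * b ^ p := by positivity
    linarith
  · have h4 : a ≤ b / μ := by rw [le_div_iff₀ hμ]; linarith
    have h5 : a ^ (p - 1) ≤ (b / μ) ^ (p - 1) := Real.rpow_le_rpow ha h4 (by linarith)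
    have h6 : (b / μ) ^ (p - 1) = μ ^ (1 - p) * b ^ (p - 1) := by
      rw [Real.div_rpow hb hμ.le, div_eq_mul_inv, ← Real.rpow_neg hμ.le, mul_comm]
      congr 2; ring
    have : 0 ≤ μ * a ^ p := by positivity
    rw [hbp]
    calc a ^ (p - 1) * b ≤ (μ ^ (1 - p) * b ^ (p - 1)) * b := by
          rw [← h6]; exact mul_le_mul_of_nonneg_right h5 hb
      _ ≤ _ := by linarith

lemma young_conj {p a b μ : ℝ} (hp : 1 < p) (ha : 0 ≤ a) (hb : 0 ≤ b) (hμ : 0 < μ) :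
    a * b ≤ μ * a ^ (p / (p - 1)) + μ ^ (1 - p) * b ^ p := by
  have h := young_p (p := p) (a := a ^ (1 / (p - 1))) hp (Real.rpow_nonneg ha _) hb hμ
  rw [← Real.rpow_mul ha, ← Real.rpow_mul ha] at h
  have e1 : 1 / (p - 1) * (p - 1) = 1 := by field_simp [(by linarith : p - 1 ≠ 0)]
  have e2 : 1 / (p - 1) * p = p / (p - 1) := by ring
  rwa [e1, e2, Real.rpow_one] at h

lemma add_rpow_le {q a b : ℝ} (hq : 0 ≤ q) (ha : 0 ≤ a) (hb : 0 ≤ b) :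
    (a + b) ^ q ≤ 2 ^ q * (a ^ q + b ^ q) := by
  have h1 : 0 ≤ a ^ q := Real.rpow_nonneg ha _
  have h2 : 0 ≤ b ^ q := Real.rpow_nonneg hb _
  have h3 : (0:ℝ) ≤ 2 ^ q := by positivity
  rcases le_total a b with h | h
  · calc (a + b) ^ q ≤ (2 * b) ^ q := Real.rpow_le_rpow (by linarith) (by linarith) hq
      _ = 2 ^ q * b ^ q := Real.mul_rpow (by norm_num) hb
      _ ≤ _ := by nlinarith
  · calc (a + b) ^ q ≤ (2 * a) ^ q := Real.rpow_le_rpow (by linarith) (by linarith) hq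
      _ = 2 ^ q * a ^ q := Real.mul_rpow (by norm_num) ha
      _ ≤ _ := by nlinarith

lemma abs_add_rpow_le {q : ℝ} (hq : 0 ≤ q) (a b : ℝ) :
    |a + b| ^ q ≤ 2 ^ q * (|a| ^ q + |b| ^ q) :=
  (Real.rpow_le_rpow (abs_nonneg _) (abs_add_le a b) hq).trans
    (add_rpow_le hq (abs_nonneg _) (abs_nonneg _))

lemma abs_sub_rpow_le {q : ℝ} (hq : 0 ≤ q) (a b : ℝ) :
    |a - b| ^ q ≤ 2 ^ q * (|a| ^ q + |b| ^ q) := by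
  have := abs_add_rpow_le hq a (-b)
  rwa [abs_neg, ← sub_eq_add_neg] at this

/-- `a ≥ b ≥ 0`, superquadratic. -/
lemma mono_aux1 {p a b : ℝ} (hp : 2 ≤ p) (hb : 0 ≤ b) (hab : b ≤ a) :
    (a - b) ^ p ≤ (a ^ (p - 1) - b ^ (p - 1)) * (a - b) := by
  have h := Real.add_rpow_le_rpow_add (sub_nonneg.mpr hab) hb (by linarith : 1 ≤ p - 1)
  rw [sub_add_cancel] at h
  have h0 : 0 ≤ a - b := sub_nonneg.mpr hab
  have hap : (a - b) ^ p = (a - b) ^ (p - 1) * (a - b) := by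
    rcases eq_or_lt_of_le h0 with h | h
    · rw [← h]; simp [Real.zero_rpow (by linarith : p ≠ 0)]
    · rw [← Real.rpow_add_one h.ne']; congr 1; ring
  rw [hap]
  exact mul_le_mul_of_nonneg_right (by linarith) h0

/-- `a ≥ b ≥ 0`, subquadratic. -/
lemma mono_aux2 {p a b : ℝ} (hp : 1 < p) (hp2 : p < 2) (hb : 0 ≤ b) (ha : 0 < a) (hab : b ≤ a) :
    (p - 1) * (a ^ (p - 2) * (a - b) ^ 2) ≤ (a ^ (p - 1) - b ^ (p - 1)) * (a - b) := by
  have h := rpow_one_add_le_one_add_mul_self (s := b / a - 1) (p := p - 1)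
    (by have : 0 ≤ b / a := by positivity
        linarith) (by linarith) (by linarith)
  rw [add_sub_cancel, Real.div_rpow hb ha.le, div_le_iff₀ (by positivity)] at h
  have h1 : a ^ (p - 1) = a ^ (p - 2) * a := by
    rw [← Real.rpow_add_one ha.ne']; congr 1; ring
  have h2 : (1 + (p - 1) * (b / a - 1)) * a ^ (p - 1)
      = a ^ (p - 1) - (p - 1) * (a ^ (p - 2) * (a - b)) := by
    rw [h1]; field_simp; ring
  rw [h2] at h
  have h0 : 0 ≤ a - b := sub_nonneg.mpr hab
  nlinarith [mul_le_mul_of_nonneg_right h h0]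

/-- opposite signs -/
lemma mono_aux3 {p a b : ℝ} (hp : 1 < p) (ha : 0 ≤ a) (hb : 0 ≤ b) :
    2 ^ (1 - p) * (a + b) ^ p ≤ (a ^ (p - 1) + b ^ (p - 1)) * (a + b) := by
  have h := add_rpow_le (q := p - 1) (by linarith) ha hb
  have h0 : 0 ≤ a + b := by linarith
  have hap : (a + b) ^ p = (a + b) ^ (p - 1) * (a + b) := by
    rcases eq_or_lt_of_le h0 with h | h
    · rw [← h]; simp [Real.zero_rpow (by linarith : p ≠ 0)]
    · rw [← Real.rpow_add_one h.ne']; congr 1; ring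
  rw [hap, ← mul_assoc]
  apply mul_le_mul_of_nonneg_right _ h0
  have : (2:ℝ) ^ (1 - p) = (2 ^ (p - 1))⁻¹ := by
    rw [← Real.rpow_neg (by norm_num)]; congr 1; ring
  rw [this, inv_mul_le_iff₀ (by positivity)]
  exact h

/-- Reduction to `|b| ≤ a`. -/
lemma mono_wlog {P : ℝ → ℝ → Prop} (hswap : ∀ a b, P a b → P b a)
    (hneg : ∀ a b, P a b → P (-a) (-b))
    (h1 : ∀ a b, 0 ≤ b → b ≤ a → P a b) (h2 : ∀ a b, 0 ≤ a → 0 ≤ b → P a (-b)) (a b : ℝ) :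
    P a b := by
  rcases le_total 0 a with ha | ha <;> rcases le_total 0 b with hb | hb
  · rcases le_total a b with h | h
    · exact hswap _ _ (h1 _ _ ha h)
    · exact h1 _ _ hb h
  · have := h2 a (-b) ha (by linarith); rwa [neg_neg] at this
  · have := hswap _ _ (h2 b (-a) hb (by linarith)); rwa [neg_neg] at this
  · rcases le_total a b with h | h
    · have := hneg _ _ (h1 (-a) (-b) (by linarith) (by linarith)); rwa [neg_neg, neg_neg] at this
    · have := hneg _ _ (hswap _ _ (h1 (-b) (-a) (by linarith) (by linarith)))
      rwa [neg_neg, neg_neg] at this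

lemma mono_ge2 {p : ℝ} (hp : 2 ≤ p) (a b : ℝ) :
    2 ^ (1 - p) * |a - b| ^ p ≤ (Jp p a - Jp p b) * (a - b) := by
  have hp1 : 1 < p := by linarith
  refine mono_wlog (P := fun a b => 2 ^ (1 - p) * |a - b| ^ p ≤ (Jp p a - Jp p b) * (a - b))
    ?_ ?_ ?_ ?_ a b
  · intro a b h
    rw [abs_sub_comm]; linarith
  · intro a b h
    rw [Jp_neg, Jp_neg, neg_sub_neg, abs_sub_comm]; linarith
  · intro a b hb hab
    rw [Jp_of_nonneg hp1 hb, Jp_of_nonneg hp1 (hb.trans hab), abs_of_nonneg (sub_nonneg.mpr hab)]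
    have h2 : (2:ℝ) ^ (1 - p) ≤ 1 := Real.rpow_le_one_of_one_le_of_nonpos (by norm_num) (by linarith)
    have h3 : 0 ≤ (a - b) ^ p := Real.rpow_nonneg (sub_nonneg.mpr hab) _
    nlinarith [mono_aux1 hp hb hab]
  · intro a b ha hb
    rw [Jp_neg, Jp_of_nonneg hp1 hb, Jp_of_nonneg hp1 ha, sub_neg_eq_add, sub_neg_eq_add,
      abs_of_nonneg (by linarith)]
    exact mono_aux3 hp1 ha hb

lemma mono_lt2 {p : ℝ} (hp : 1 < p) (hp2 : p < 2) (a b : ℝ) :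
    ((p - 1) * 2 ^ (1 - p)) * ((|a| + |b|) ^ (p - 2) * (a - b) ^ 2)
      ≤ (Jp p a - Jp p b) * (a - b) := by
  have hk : (2:ℝ) ^ (1 - p) ≤ 1 := Real.rpow_le_one_of_one_le_of_nonpos (by norm_num) (by linarith)
  have hk0 : (0:ℝ) < 2 ^ (1 - p) := by positivity
  refine mono_wlog (P := fun a b => ((p - 1) * 2 ^ (1 - p)) * ((|a| + |b|) ^ (p - 2) * (a - b) ^ 2)
      ≤ (Jp p a - Jp p b) * (a - b)) ?_ ?_ ?_ ?_ a b
  · intro a b h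
    rw [add_comm]; nlinarith
  · intro a b h
    rw [Jp_neg, Jp_neg, abs_neg, abs_neg]
    have : (-a - -b) ^ 2 = (a - b) ^ 2 := by ring
    rw [this]
    linarith
  · intro a b hb hab
    rw [Jp_of_nonneg hp hb, Jp_of_nonneg hp (hb.trans hab), abs_of_nonneg hb,
      abs_of_nonneg (hb.trans hab)]
    rcases eq_or_lt_of_le (hb.trans hab) with h | h
    · have : b = 0 := by linarith
      subst this; simp [← h]
    have h1 := mono_aux2 hp hp2 hb h hab
    have h2 : (a + b) ^ (p - 2) ≤ a ^ (p - 2) :=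
      Real.rpow_le_rpow_of_nonpos h (by linarith) (by linarith)
    have h3 : (a + b) ^ (p - 2) * (a - b) ^ 2 ≤ a ^ (p - 2) * (a - b) ^ 2 :=
      mul_le_mul_of_nonneg_right h2 (sq_nonneg _)
    have h4 : 0 ≤ a ^ (p - 2) * (a - b) ^ 2 := by positivity
    refine le_trans ?_ h1
    rw [mul_assoc]
    apply mul_le_mul_of_nonneg_left _ (by linarith)
    have h5 : 0 ≤ (a + b) ^ (p - 2) * (a - b) ^ 2 := by positivity
    nlinarith
  · intro a b ha hb
    rw [Jp_neg, Jp_of_nonneg hp hb, Jp_of_nonneg hp ha, sub_neg_eq_add, sub_neg_eq_add, abs_neg,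
      abs_of_nonneg ha, abs_of_nonneg hb]
    have h0 : 0 ≤ a + b := by linarith
    refine le_trans ?_ (mono_aux3 hp ha hb)
    have h1 : (a + b) ^ (p - 2) * (a + b) ^ 2 = (a + b) ^ p := by
      rcases eq_or_lt_of_le h0 with h | h
      · rw [← h]; simp [Real.zero_rpow (by linarith : p ≠ 0)]
      · rw [← Real.rpow_natCast, ← Real.rpow_add h]; congr 1; push_cast; ring
    rw [h1]
    apply mul_le_mul_of_nonneg_right _ (Real.rpow_nonneg h0 _)
    nlinarith

lemma Q_nonneg {p : ℝ} (hp : 1 < p) (a b : ℝ) : 0 ≤ (Jp p a - Jp p b) * (a - b) := by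
  rcases le_or_gt 2 p with h | h
  · refine le_trans ?_ (mono_ge2 h a b); positivity
  · refine le_trans ?_ (mono_lt2 hp h a b)
    have : 0 ≤ p - 1 := by linarith
    positivity

lemma thetaP_pos {p : ℝ} (hp : 1 < p) : 0 < thetaP p := lt_min one_pos (by linarith)
lemma thetaP_le (p : ℝ) : thetaP p ≤ 1 := min_le_left _ _

/-- Weighted monotonicity inequality. -/
lemma mono_main {p : ℝ} (hp : 1 < p) : ∃ C : ℝ, 0 < C ∧ ∀ lam : ℝ, 0 < lam → ∀ a b : ℝ,
    |a - b| ^ p ≤ C * (lam ^ (-(1 - thetaP p)) * ((Jp p a - Jp p b) * (a - b))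
      + lam ^ (thetaP p) * (|a| ^ p + |b| ^ p)) := by
  rcases le_or_gt 2 p with h | h
  · have ht : thetaP p = 1 := min_eq_left (by linarith)
    refine ⟨2 ^ (p - 1), by positivity, fun lam hl a b => ?_⟩
    rw [ht]
    have h1 := mono_ge2 h a b
    have h2 : (2:ℝ) ^ (p - 1) * 2 ^ (1 - p) = 1 := by
      rw [← Real.rpow_add (by norm_num)]; norm_num
    have h3 : 0 ≤ lam ^ (1:ℝ) * (|a| ^ p + |b| ^ p) := by positivity
    have h4 : (0:ℝ) ≤ 2 ^ (p - 1) := by positivity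
    simp only [sub_self, neg_zero, Real.rpow_zero, one_mul]
    calc |a - b| ^ p = 2 ^ (p - 1) * (2 ^ (1 - p) * |a - b| ^ p) := by
          rw [← mul_assoc, h2, one_mul]
      _ ≤ _ := mul_le_mul_of_nonneg_left (by linarith) h4
  · have ht : thetaP p = p / 2 := min_eq_right (by linarith)
    have hc : 0 < (p - 1) * 2 ^ (1 - p) := mul_pos (by linarith) (by positivity)
    refine ⟨2 ^ p + ((p - 1) * 2 ^ (1 - p))⁻¹, by positivity, fun lam hl a b => ?_⟩
    rw [ht]
    set c := (p - 1) * 2 ^ (1 - p)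
    have hQ := mono_lt2 hp h a b
    have hQ0 := Q_nonneg hp a b
    set Q := (Jp p a - Jp p b) * (a - b)
    have hS := add_rpow_le (q := p) (by linarith) (abs_nonneg a) (abs_nonneg b)
    set S := |a| + |b| with hSdef
    set Y := |a| ^ p + |b| ^ p
    have hY : 0 ≤ Y := by positivity
    have hS0 : 0 ≤ S := by positivity
    have hdS : |a - b| ≤ S := abs_sub a b
    have hl1 : 0 < lam ^ (-(1 - p / 2)) := by positivity
    have hl2 : 0 < lam ^ (p / 2) := by positivity
    rcases le_total |a - b| (lam ^ (1 / 2 : ℝ) * S) with hd | hd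
    · have e1 : |a - b| ^ p ≤ lam ^ (p / 2) * S ^ p := by
        refine (Real.rpow_le_rpow (abs_nonneg _) hd (by linarith)).trans ?_
        rw [Real.mul_rpow (by positivity) hS0, ← Real.rpow_mul hl.le]
        apply le_of_eq; congr 2; ring
      have e2 : lam ^ (p / 2) * S ^ p ≤ lam ^ (p / 2) * (2 ^ p * Y) :=
        mul_le_mul_of_nonneg_left hS hl2.le
      have e3 : 0 ≤ c⁻¹ * (lam ^ (p / 2) * Y) := by positivity
      have e4 : 0 ≤ (2 ^ p + c⁻¹) * (lam ^ (-(1 - p / 2)) * Q) := by positivity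
      nlinarith
    · rcases eq_or_lt_of_le (abs_nonneg (a - b)) with hz | hz
      · rw [← hz, Real.zero_rpow (by linarith)]; positivity
      have hSp : 0 < S := lt_of_lt_of_le hz hdS
      -- S ≤ lam^{-1/2} d
      have e0 : S ≤ lam ^ (-(1 / 2) : ℝ) * |a - b| := by
        have := mul_le_mul_of_nonneg_left hd (Real.rpow_nonneg hl.le (-(1 / 2)))
        rwa [← mul_assoc, ← Real.rpow_add hl, neg_add_cancel, Real.rpow_zero, one_mul] at this
      have e1 : (lam ^ (-(1 / 2) : ℝ) * |a - b|) ^ (p - 2) ≤ S ^ (p - 2) :=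
        Real.rpow_le_rpow_of_nonpos hSp e0 (by linarith)
      have e2 : (lam ^ (-(1 / 2) : ℝ) * |a - b|) ^ (p - 2) = lam ^ (1 - p / 2) * |a - b| ^ (p - 2) := by
        rw [Real.mul_rpow (by positivity) hz.le, ← Real.rpow_mul hl.le]
        congr 2; ring
      have e3 : |a - b| ^ (p - 2) * (a - b) ^ 2 = |a - b| ^ p := by
        rw [← sq_abs, ← Real.rpow_natCast, ← Real.rpow_add hz]; congr 1; push_cast; ring
      have e4 : c * (lam ^ (1 - p / 2) * |a - b| ^ p) ≤ Q := by
        refine le_trans ?_ hQ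
        apply mul_le_mul_of_nonneg_left _ hc.le
        rw [← e3, ← mul_assoc, ← e2]
        exact mul_le_mul_of_nonneg_right e1 (sq_nonneg _)
      have e5 : lam ^ (-(1 - p / 2)) * lam ^ (1 - p / 2) = 1 := by
        rw [← Real.rpow_add hl]; simp
      have e6 : |a - b| ^ p ≤ c⁻¹ * (lam ^ (-(1 - p / 2)) * Q) := by
        rw [le_inv_mul_iff₀ hc]
        calc c * |a - b| ^ p = lam ^ (-(1 - p / 2)) * (c * (lam ^ (1 - p / 2) * |a - b| ^ p)) := by
              linear_combination (-(c * |a - b| ^ p)) * e5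
          _ ≤ _ := mul_le_mul_of_nonneg_left e4 hl1.le
      have e7 : 0 ≤ 2 ^ p * (lam ^ (-(1 - p / 2)) * Q) := by positivity
      have e8 : 0 ≤ (2 ^ p + c⁻¹) * (lam ^ (p / 2) * Y) := by positivity
      nlinarith




/-- Euclidean space. -/
abbrev Eu (n : ℕ) := EuclideanSpace ℝ (Fin n)

lemma lint_smul {n : ℕ} (g : Eu n → ℝ≥0∞) {d : ℝ} (hd : 0 < d) :
    ∫⁻ z, g (d • z) = ENNReal.ofReal (d ^ (-(n:ℝ))) * ∫⁻ z, g z := by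
  have h := Measure.map_addHaar_smul (volume : Measure (Eu n)) hd.ne'
  have e : MeasurableEmbedding (fun z : Eu n => d • z) :=
    (Homeomorph.smulOfNeZero d hd.ne').measurableEmbedding
  rw [← e.lintegral_map, h, lintegral_smul_measure, smul_eq_mul]
  congr 2
  rw [finrank_euclideanSpace_fin, abs_of_pos (by positivity), Real.rpow_neg hd.le, Real.rpow_natCast]

lemma kernel_one {n : ℕ} (hn : 0 < n) {q P : ℝ} (hq : 0 < q) (hP : q < P) :
    ∫⁻ z : Eu n, ENNReal.ofReal (min 1 ‖z‖ ^ P * ‖z‖ ^ (-((n:ℝ) + q))) < ⊤ := by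
  have : Nonempty (Fin n) := ⟨⟨0, hn⟩⟩
  have : Nontrivial (Eu n) := inferInstance
  have hI : Integrable (fun z : Eu n => (fun y : ℝ => min 1 y ^ P * y ^ (-((n:ℝ) + q))) ‖z‖) := by
    rw [integrable_fun_norm_addHaar (volume : Measure (Eu n))
      (f := (fun y : ℝ => min 1 y ^ P * y ^ (-((n:ℝ) + q))))]
    rw [finrank_euclideanSpace_fin]
    have hsplit : Ioi (0:ℝ) = Ioo 0 1 ∪ Ici 1 := by
      ext y; simp only [mem_Ioi, mem_union, mem_Ioo, mem_Ici]
      constructor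
      · intro h; rcases lt_or_ge y 1 with h1 | h1
        · exact Or.inl ⟨h, h1⟩
        · exact Or.inr h1
      · rintro (h | h)
        · exact h.1
        · linarith
    have hpow : ∀ y : ℝ, 0 < y → y ^ (n - 1) = y ^ ((n:ℝ) - 1) := by
      intro y hy
      rw [← Real.rpow_natCast, Nat.cast_sub hn]; norm_num
    rw [hsplit]
    apply IntegrableOn.union
    · have : IntegrableOn (fun y : ℝ => y ^ (P - q - 1)) (Ioo 0 1) := by
        rw [intervalIntegral.integrableOn_Ioo_rpow_iff one_pos]; linarith
      refine this.congr_fun (fun y hy => ?_) measurableSet_Ioo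
      simp only [smul_eq_mul]
      rw [min_eq_right hy.2.le, hpow y hy.1, ← Real.rpow_add hy.1, ← Real.rpow_add hy.1]
      congr 1; ring
    · have : IntegrableOn (fun y : ℝ => y ^ (- q - 1)) (Ici 1) := by
        rw [integrableOn_Ici_iff_integrableOn_Ioi, integrableOn_Ioi_rpow_iff one_pos]; linarith
      refine this.congr_fun (fun y hy => ?_) measurableSet_Ici
      have hy0 : 0 < y := lt_of_lt_of_le one_pos hy
      simp only [smul_eq_mul]
      rw [min_eq_left hy, hpow y hy0, Real.one_rpow, one_mul, ← Real.rpow_add hy0]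
      congr 1; ring
  have := hI.lintegral_lt_top
  exact this

/-- The basic kernel bound. -/
lemma kernel_int {n : ℕ} (hn : 0 < n) {q P : ℝ} (hq : 0 < q) (hP : q < P) :
    ∃ C : ℝ, 0 < C ∧ ∀ d : ℝ, 0 < d →
      ∫⁻ z : Eu n, ENNReal.ofReal (min 1 (‖z‖ / d) ^ P * ‖z‖ ^ (-((n:ℝ) + q)))
        ≤ ENNReal.ofReal (C * d ^ (-q)) := by
  set I := ∫⁻ z : Eu n, ENNReal.ofReal (min 1 ‖z‖ ^ P * ‖z‖ ^ (-((n:ℝ) + q))) with hI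
  have hfin := kernel_one hn hq hP
  refine ⟨I.toReal + 1, by positivity, fun d hd => ?_⟩
  have h1 := lint_smul (fun z : Eu n => ENNReal.ofReal (min 1 (‖z‖ / d) ^ P * ‖z‖ ^ (-((n:ℝ) + q)))) hd
  have h2 : ∀ z : Eu n, ENNReal.ofReal (min 1 (‖d • z‖ / d) ^ P * ‖d • z‖ ^ (-((n:ℝ) + q)))
      = ENNReal.ofReal (d ^ (-((n:ℝ) + q))) * ENNReal.ofReal (min 1 ‖z‖ ^ P * ‖z‖ ^ (-((n:ℝ) + q))) := by
    intro z
    rw [← ENNReal.ofReal_mul (by positivity), norm_smul, Real.norm_of_nonneg hd.le,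
      mul_div_cancel_left₀ _ hd.ne', Real.mul_rpow hd.le (norm_nonneg _)]
    congr 1; ring
  simp only [h2] at h1
  rw [lintegral_const_mul _ (by fun_prop), ← hI] at h1
  have h3 : ∫⁻ z : Eu n, ENNReal.ofReal (min 1 (‖z‖ / d) ^ P * ‖z‖ ^ (-((n:ℝ) + q)))
      = ENNReal.ofReal (d ^ (-q)) * I := by
    have h4 : ENNReal.ofReal (d ^ (n:ℝ)) * ENNReal.ofReal (d ^ (-(n:ℝ))) = 1 := by
      rw [← ENNReal.ofReal_mul (by positivity), ← Real.rpow_add hd]; simp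
    have h5 : ENNReal.ofReal (d ^ (n:ℝ)) * ENNReal.ofReal (d ^ (-((n:ℝ) + q))) = ENNReal.ofReal (d ^ (-q)) := by
      rw [← ENNReal.ofReal_mul (by positivity), ← Real.rpow_add hd]; congr 2; ring
    rw [← h5, mul_assoc, h1, ← mul_assoc, h4, one_mul]
  rw [h3, mul_comm (I.toReal + 1), ENNReal.ofReal_mul (by positivity)]
  gcongr
  rw [ENNReal.le_ofReal_iff_toReal_le hfin.ne (by positivity)]
  linarith

lemma vol_ball {n : ℕ} {d : ℝ} (hd : 0 < d) (x : Eu n) :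
    volume (ball x d) = ENNReal.ofReal (d ^ (n:ℝ)) * volume (ball (0 : Eu n) 1) := by
  rw [Measure.addHaar_ball_of_pos _ _ hd, finrank_euclideanSpace_fin, Real.rpow_natCast]

/-- translation -/
lemma lint_shift {n : ℕ} (g : Eu n → ℝ≥0∞) (a : Eu n) : ∫⁻ x, g (x + a) = ∫⁻ x, g x :=
  lintegral_add_right_eq_self g a

/-- shifting an integral over a ball to a bigger ball -/
lemma setlint_shift_le {n : ℕ} (g : Eu n → ℝ≥0∞) {r r' : ℝ} (a : Eu n) (h : r + ‖a‖ ≤ r') :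
    ∫⁻ x in ball (0 : Eu n) r, g (x + a) ≤ ∫⁻ x in ball (0 : Eu n) r', g x := by
  rw [← lintegral_indicator measurableSet_ball, ← lintegral_indicator measurableSet_ball]
  conv_rhs => rw [← lint_shift _ a]
  apply lintegral_mono
  intro x
  by_cases hx : x ∈ ball (0 : Eu n) r
  · have : x + a ∈ ball (0 : Eu n) r' := by
      rw [mem_ball_zero_iff] at *
      exact lt_of_le_of_lt (norm_add_le x a) (by linarith)
    simp [indicator_of_mem hx, indicator_of_mem this]
  · simp [indicator_of_notMem hx]

/-- The set `B_r` integral of `|g|^p`. -/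
def Nr (n : ℕ) (p r : ℝ) (g : Eu n → ℝ) : ℝ≥0∞ :=
  ∫⁻ x in ball (0 : Eu n) r, ENNReal.ofReal (|g x| ^ p)

/-- Near Gagliardo integral in the coordinates `(x,z)`. -/
def D2 (n : ℕ) (p q r ρ : ℝ) (g : Eu n → ℝ) : ℝ≥0∞ :=
  ∫⁻ z in ball (0 : Eu n) ρ, ∫⁻ x in ball (0 : Eu n) r,
    ENNReal.ofReal (|g (x + z) - g x| ^ p * ‖z‖ ^ (-((n:ℝ) + q)))

/-- First difference. -/
def tau {n : ℕ} (h : Eu n) (g : Eu n → ℝ) : Eu n → ℝ := fun x => g (x + h) - g x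

lemma measurable_tau {n : ℕ} (h : Eu n) {g : Eu n → ℝ} (hg : Measurable g) :
    Measurable (tau h g) := by
  unfold tau; fun_prop

lemma D2_mono {n : ℕ} {p q r r' ρ ρ' : ℝ} (g : Eu n → ℝ) (hr : r ≤ r') (hρ : ρ ≤ ρ') :
    D2 n p q r ρ g ≤ D2 n p q r' ρ' g := by
  unfold D2
  refine (lintegral_mono_set (ball_subset_ball hρ)).trans ?_
  exact lintegral_mono fun z => lintegral_mono_set (ball_subset_ball hr)

lemma Nr_mono {n : ℕ} {p r r' : ℝ} (g : Eu n → ℝ) (hr : r ≤ r') :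
    Nr n p r g ≤ Nr n p r' g := lintegral_mono_set (ball_subset_ball hr)

lemma D2_le_gag {n : ℕ} {p s r ρ R : ℝ} {g : Eu n → ℝ} (hg : Measurable g) (h : r + ρ ≤ R)
    (hrR : r ≤ R) :
    D2 n p (s * p) r ρ g ≤ gagliardoE n s p (ball 0 R) g := by
  unfold D2 gagliardoE
  rw [lintegral_lintegral_swap (by fun_prop)]
  refine (lintegral_mono_set (ball_subset_ball hrR)).trans' ?_
  refine setLIntegral_mono' measurableSet_ball fun x hx => ?_
  rw [← lintegral_indicator measurableSet_ball, ← lintegral_indicator measurableSet_ball]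
  conv_rhs => rw [← lintegral_add_left_eq_self _ x]
  apply lintegral_mono
  intro z
  by_cases hz : z ∈ ball (0 : Eu n) ρ
  · have : x + z ∈ ball (0 : Eu n) R := by
      rw [mem_ball_zero_iff] at *
      exact lt_of_le_of_lt (norm_add_le x z) (by linarith)
    simp only [indicator_of_mem hz, indicator_of_mem this]
    rw [abs_sub_comm, dist_self_add_right, Real.rpow_neg (norm_nonneg _), div_eq_mul_inv]
  · simp [indicator_of_notMem hz]

/-- Nikolskii inequality. -/
lemma nikolskii {n : ℕ} {p q : ℝ} (hp : 0 < p) (hq : 0 < q) : ∃ C : ℝ, 0 < C ∧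
    ∀ (r : ℝ) (g : Eu n → ℝ), Measurable g → ∀ h : Eu n, h ≠ 0 →
      Nr n p r (tau h g) ≤ ENNReal.ofReal (C * ‖h‖ ^ q) * D2 n p q (r + ‖h‖) (2 * ‖h‖) g := by
  set V := (volume (ball (0 : Eu n) 1)).toReal with hV
  have hVfin : volume (ball (0 : Eu n) 1) ≠ ⊤ := measure_ball_lt_top.ne
  have hVpos : 0 < V := ENNReal.toReal_pos (measure_ball_pos _ _ one_pos).ne' hVfin
  refine ⟨2 * 2 ^ p * 2 ^ ((n:ℝ) + q) / V, by positivity, fun r g hg h hh => ?_⟩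
  have hh0 : 0 < ‖h‖ := norm_pos_iff.mpr hh
  set D := D2 n p q (r + ‖h‖) (2 * ‖h‖) g
  -- bound without the weight
  have key : ∫⁻ z in ball (0 : Eu n) (2 * ‖h‖), ∫⁻ x in ball (0 : Eu n) (r + ‖h‖),
      ENNReal.ofReal (|g (x + z) - g x| ^ p) ≤ ENNReal.ofReal ((2 * ‖h‖) ^ ((n:ℝ) + q)) * D := by
    unfold D D2
    rw [← lintegral_const_mul' _ _ ENNReal.ofReal_ne_top]
    refine setLIntegral_mono' measurableSet_ball fun z hz => ?_
    rw [← lintegral_const_mul' _ _ ENNReal.ofReal_ne_top]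
    apply lintegral_mono; intro x
    beta_reduce
    rw [← ENNReal.ofReal_mul (by positivity)]
    apply ENNReal.ofReal_le_ofReal
    rcases eq_or_ne z 0 with h0 | h0
    · subst h0
      simp [Real.zero_rpow hp.ne']
    · have hz0 : 0 < ‖z‖ := norm_pos_iff.mpr h0
      rw [mem_ball_zero_iff] at hz
      have : 1 ≤ (2 * ‖h‖) ^ ((n:ℝ) + q) * ‖z‖ ^ (-((n:ℝ) + q)) := by
        rw [Real.rpow_neg hz0.le, ← div_eq_mul_inv, one_le_div (by positivity)]
        exact Real.rpow_le_rpow hz0.le hz.le (by positivity)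
      have h2 : 0 ≤ |g (x + z) - g x| ^ p := by positivity
      calc |g (x + z) - g x| ^ p = 1 * |g (x + z) - g x| ^ p := (one_mul _).symm
        _ ≤ _ := mul_le_mul_of_nonneg_right this h2
        _ = _ := by ring
  have hN : volume (ball (0 : Eu n) ‖h‖) * Nr n p r (tau h g) =
      ∫⁻ z in ball (0 : Eu n) ‖h‖, ∫⁻ x in ball (0 : Eu n) r, ENNReal.ofReal (|g (x + h) - g x| ^ p) := by
    rw [setLIntegral_const, mul_comm]; rfl
  have hmain : volume (ball (0 : Eu n) ‖h‖) * Nr n p r (tau h g) ≤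
      ENNReal.ofReal (2 ^ p) * (ENNReal.ofReal ((2 * ‖h‖) ^ ((n:ℝ) + q)) * D
        + ENNReal.ofReal ((2 * ‖h‖) ^ ((n:ℝ) + q)) * D) := by
    rw [hN]
    calc _ ≤ ∫⁻ z in ball (0 : Eu n) ‖h‖, ∫⁻ x in ball (0 : Eu n) r, ENNReal.ofReal (2 ^ p) *
          (ENNReal.ofReal (|g (x + h) - g (x + z)| ^ p) + ENNReal.ofReal (|g (x + z) - g x| ^ p)) := by
          apply lintegral_mono; intro z; apply lintegral_mono; intro x
          beta_reduce
          rw [← ENNReal.ofReal_add (by positivity) (by positivity), ← ENNReal.ofReal_mul (by positivity)]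
          apply ENNReal.ofReal_le_ofReal
          have := abs_add_rpow_le hp.le (g (x + h) - g (x + z)) (g (x + z) - g x)
          rwa [sub_add_sub_cancel] at this
      _ = ENNReal.ofReal (2 ^ p) * ((∫⁻ z in ball (0 : Eu n) ‖h‖, ∫⁻ x in ball (0 : Eu n) r,
            ENNReal.ofReal (|g (x + h) - g (x + z)| ^ p)) + ∫⁻ z in ball (0 : Eu n) ‖h‖,
            ∫⁻ x in ball (0 : Eu n) r, ENNReal.ofReal (|g (x + z) - g x| ^ p)) := by
          simp_rw [lintegral_const_mul' _ _ ENNReal.ofReal_ne_top]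
          congr 1
          rw [← lintegral_add_left]
          · congr 1; ext z
            rw [lintegral_add_left]
            fun_prop
          · apply Measurable.lintegral_prod_right' (f := fun q : Eu n × Eu n =>
              ENNReal.ofReal (|g (q.2 + h) - g (q.2 + q.1)| ^ p))
            fun_prop
      _ ≤ _ := by
          gcongr
          · refine le_trans ?_ key
            calc _ ≤ ∫⁻ z in ball (0 : Eu n) ‖h‖, ∫⁻ x in ball (0 : Eu n) (r + ‖h‖),
                  ENNReal.ofReal (|g (x + (h - z)) - g x| ^ p) := by
                  refine setLIntegral_mono' measurableSet_ball fun z hz => ?_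
                  rw [mem_ball_zero_iff] at hz
                  refine le_trans (le_of_eq ?_) (setlint_shift_le (fun x => ENNReal.ofReal (|g (x + (h - z)) - g x| ^ p)) z
                    (by linarith : r + ‖z‖ ≤ r + ‖h‖))
                  congr 1; ext x; congr 5; abel
              _ ≤ _ := by
                  rw [← lintegral_indicator measurableSet_ball, ← lintegral_indicator measurableSet_ball]
                  conv_rhs => rw [← lintegral_sub_left_eq_self _ h]
                  apply lintegral_mono
                  intro z
                  by_cases hz : z ∈ ball (0 : Eu n) ‖h‖
                  · have : h - z ∈ ball (0 : Eu n) (2 * ‖h‖) := by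
                      rw [mem_ball_zero_iff] at *
                      exact lt_of_le_of_lt (norm_sub_le h z) (by linarith)
                    simp only [indicator_of_mem hz, indicator_of_mem this]
                    exact le_rfl
                  · simp [indicator_of_notMem hz]
          · refine le_trans ?_ key
            refine (lintegral_mono_set (ball_subset_ball (by linarith : ‖h‖ ≤ 2 * ‖h‖))).trans ?_
            exact lintegral_mono fun z => lintegral_mono_set (ball_subset_ball (by linarith : r ≤ r + ‖h‖))
  rw [vol_ball hh0, ← ENNReal.ofReal_toReal hVfin, ← hV, ← ENNReal.ofReal_mul (by positivity)] at hmain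
  have hpos : 0 < ‖h‖ ^ (n:ℝ) * V := by positivity
  have h3 : Nr n p r (tau h g) = ENNReal.ofReal ((‖h‖ ^ (n:ℝ) * V)⁻¹) *
      (ENNReal.ofReal (‖h‖ ^ (n:ℝ) * V) * Nr n p r (tau h g)) := by
    rw [← mul_assoc, ← ENNReal.ofReal_mul (by positivity), inv_mul_cancel₀ hpos.ne']; simp
  rw [h3]
  refine (mul_le_mul_right hmain _).trans (le_of_eq ?_)
  have h2x : ∀ x : ℝ≥0∞, x + x = ENNReal.ofReal 2 * x := by
    intro x; rw [← two_mul]; simp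
  rw [h2x, ← mul_assoc, ← mul_assoc, ← mul_assoc]
  congr 1
  rw [← ENNReal.ofReal_mul (by positivity),
    ← ENNReal.ofReal_mul (by positivity), ← ENNReal.ofReal_mul (by positivity)]
  congr 1
  rw [Real.mul_rpow (by norm_num) hh0.le, Real.rpow_add hh0]
  field_simp




/-- kernel -/
def kz (n : ℕ) (s p : ℝ) (z : Eu n) : ℝ := ‖z‖ ^ (-((n:ℝ) + s * p))

lemma kz_nonneg {n : ℕ} {s p : ℝ} (z : Eu n) : 0 ≤ kz n s p z := by unfold kz; positivity

@[fun_prop]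
lemma measurable_kz {n : ℕ} {s p : ℝ} : Measurable (kz n s p) := by unfold kz; fun_prop

lemma kz_neg {n : ℕ} {s p : ℝ} (z : Eu n) : kz n s p (-z) = kz n s p z := by simp [kz]

/-- Jensen's inequality. -/
lemma jensen_lint {X : Type*} [MeasurableSpace X] (μ : Measure X) {q : ℝ} (hq : 1 < q)
    {f : X → ℝ≥0∞} (hf : AEMeasurable f μ) :
    (∫⁻ x, f x ∂μ) ^ q ≤ μ univ ^ (q - 1) * ∫⁻ x, f x ^ q ∂μ := by
  have hc : q.HolderConjugate (q / (q - 1)) := Real.HolderConjugate.conjExponent hq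
  have h := ENNReal.lintegral_mul_le_Lp_mul_Lq μ hc hf (g := fun _ => 1) aemeasurable_const
  simp only [Pi.mul_apply, mul_one, ENNReal.one_rpow, lintegral_one] at h
  have hq0 : 0 < q := by linarith
  have hq1 : 0 < q - 1 := by linarith
  calc (∫⁻ x, f x ∂μ) ^ q ≤ ((∫⁻ x, f x ^ q ∂μ) ^ (1 / q) * μ univ ^ (1 / (q / (q - 1)))) ^ q := by
        gcongr
    _ = _ := by
        rw [ENNReal.mul_rpow_of_nonneg _ _ hq0.le, ← ENNReal.rpow_mul, ← ENNReal.rpow_mul,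
          one_div_mul_cancel hq0.ne', ENNReal.rpow_one, mul_comm]
        congr 2
        field_simp

lemma young_E {p : ℝ} (hp : 1 < p) (M : ℝ≥0∞) {b μ : ℝ} (hb : 0 ≤ b) (hμ : 0 < μ) :
    M * ENNReal.ofReal b ≤ ENNReal.ofReal μ * M ^ (p / (p - 1))
      + ENNReal.ofReal (μ ^ (1 - p)) * ENNReal.ofReal (b ^ p) := by
  have hp1 : 0 < p - 1 := by linarith
  rcases eq_or_ne M ⊤ with h | h
  · subst h
    rw [ENNReal.top_rpow_of_pos (by positivity), ENNReal.mul_top (by simpa using hμ)]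
    simp
  · rw [← ENNReal.ofReal_toReal h, ENNReal.ofReal_rpow_of_nonneg (by positivity) (by positivity),
      ← ENNReal.ofReal_mul (by positivity), ← ENNReal.ofReal_mul (by positivity),
      ← ENNReal.ofReal_mul (by positivity), ← ENNReal.ofReal_add (by positivity) (by positivity)]
    exact ENNReal.ofReal_le_ofReal (young_conj hp ENNReal.toReal_nonneg hb hμ)

lemma kfar {n : ℕ} (hn : 0 < n) {s p : ℝ} (hsp : 0 < s * p) {ρ : ℝ} (hρ : 0 < ρ) :
    ∃ C : ℝ, 0 < C ∧ ∫⁻ z in (ball (0 : Eu n) ρ)ᶜ, ENNReal.ofReal (kz n s p z) ≤ ENNReal.ofReal C := by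
  obtain ⟨C, hC, h⟩ := kernel_int (n := n) hn hsp (by linarith : s * p < s * p + 1)
  refine ⟨C * ρ ^ (-(s * p)), by positivity, le_trans ?_ (h ρ hρ)⟩
  refine le_trans ?_ (setLIntegral_le_lintegral (ball (0 : Eu n) ρ)ᶜ _)
  refine setLIntegral_mono' measurableSet_ball.compl fun z hz => ?_
  have : ρ ≤ ‖z‖ := by simpa using hz
  rw [min_eq_left ((one_le_div hρ).2 this), Real.one_rpow, one_mul]; rfl

lemma knear {n : ℕ} (hn : 0 < n) {s p : ℝ} (hsp : 0 < s * p) (hs : s * p < p) {ρ : ℝ} (hρ1 : ρ ≤ 1) :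
    ∃ C : ℝ, 0 < C ∧ ∫⁻ z in (ball (0 : Eu n) ρ), ENNReal.ofReal (‖z‖ ^ p * kz n s p z) ≤ ENNReal.ofReal C := by
  obtain ⟨C, hC, h⟩ := kernel_int (n := n) hn hsp hs
  refine ⟨C * 1 ^ (-(s * p)), by positivity, le_trans ?_ (h 1 one_pos)⟩
  refine le_trans ?_ (setLIntegral_le_lintegral (ball (0 : Eu n) ρ) _)
  refine setLIntegral_mono' measurableSet_ball fun z hz => ?_
  have : ‖z‖ < ρ := by simpa using hz
  rw [div_one, min_eq_right (by linarith)]; rfl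

/-- Tail integral. -/
def TL (n : ℕ) (s p : ℝ) (U : Eu n → ℝ) : ℝ≥0∞ :=
  ∫⁻ x in (ball (0 : Eu n) 1)ᶜ, ENNReal.ofReal (|U x| ^ (p - 1) * kz n s p x)

lemma hold_p1 {n : ℕ} {p : ℝ} (hp : 1 < p) : ∃ C : ℝ, 0 < C ∧ ∀ U : Eu n → ℝ, Measurable U →
    (∫⁻ x in ball (0 : Eu n) 1, ENNReal.ofReal (|U x| ^ (p - 1))) ^ (p / (p - 1))
      ≤ ENNReal.ofReal C * Nr n p 1 U := by
  have hp1 : 0 < p - 1 := by linarith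
  have hq : 1 < p / (p - 1) := by rw [lt_div_iff₀ hp1]; linarith
  set V : ℝ≥0∞ := volume (ball (0 : Eu n) 1) ^ (p / (p - 1) - 1)
  have hV : V ≠ ⊤ := ENNReal.rpow_ne_top_of_nonneg (by linarith) measure_ball_lt_top.ne
  refine ⟨V.toReal + 1, by positivity, fun U hU => ?_⟩
  refine (jensen_lint _ hq (by fun_prop)).trans ?_
  rw [Measure.restrict_apply_univ]
  gcongr
  · rw [ENNReal.le_ofReal_iff_toReal_le hV (by positivity)]; linarith
  · unfold Nr
    refine lintegral_mono fun x => le_of_eq ?_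
    rw [ENNReal.ofReal_rpow_of_nonneg (by positivity) (by positivity), ← Real.rpow_mul (abs_nonneg _)]
    congr 2; field_simp

lemma far_inner {n : ℕ} {s p : ℝ} (hsp : 0 < s * p) {ρ : ℝ} (hρ : 0 < ρ) :
    ∃ C : ℝ, 0 < C ∧ ∀ (U : Eu n → ℝ) (x : Eu n), Measurable U → x ∈ ball (0 : Eu n) 1 →
     ∫⁻ z in (ball (0 : Eu n) ρ)ᶜ, ENNReal.ofReal (|U (x + z)| ^ (p - 1) * kz n s p z) ≤
      ENNReal.ofReal C * ((∫⁻ x in ball (0 : Eu n) 1, ENNReal.ofReal (|U x| ^ (p - 1))) + TL n s p U) := by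
  have hm : (0:ℝ) < (n:ℝ) + s * p := by positivity
  refine ⟨ρ ^ (-((n:ℝ) + s * p)) + (1 + 1 / ρ) ^ ((n:ℝ) + s * p), by positivity, fun U x hU hx => ?_⟩
  set C := ρ ^ (-((n:ℝ) + s * p)) + (1 + 1 / ρ) ^ ((n:ℝ) + s * p)
  unfold TL
  rw [← lintegral_indicator measurableSet_ball, ← lintegral_indicator measurableSet_ball.compl,
    ← lintegral_indicator measurableSet_ball.compl, ← lintegral_add_left
      (Measurable.indicator (by fun_prop) measurableSet_ball),
    ← lintegral_const_mul' _ _ ENNReal.ofReal_ne_top]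
  conv_rhs => rw [← lintegral_add_left_eq_self _ x]
  apply lintegral_mono
  intro z
  beta_reduce
  by_cases hz : z ∈ (ball (0 : Eu n) ρ)ᶜ
  swap
  · simp [indicator_of_notMem hz]
  rw [indicator_of_mem hz]
  have hz' : ρ ≤ ‖z‖ := by simpa using hz
  have hz0 : 0 < ‖z‖ := by linarith
  rw [mem_ball_zero_iff] at hx
  by_cases hy : x + z ∈ ball (0 : Eu n) 1
  · rw [indicator_of_mem hy, indicator_of_notMem (by simpa using hy), add_zero,
      ← ENNReal.ofReal_mul (by positivity)]
    apply ENNReal.ofReal_le_ofReal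
    rw [mul_comm]
    apply mul_le_mul_of_nonneg_right _ (by positivity)
    have : kz n s p z ≤ ρ ^ (-((n:ℝ) + s * p)) :=
      Real.rpow_le_rpow_of_nonpos hρ hz' (by linarith)
    have h2 : 0 ≤ (1 + 1 / ρ) ^ ((n:ℝ) + s * p) := by positivity
    linarith
  · rw [indicator_of_notMem hy, indicator_of_mem (by simpa using hy), zero_add,
      ← ENNReal.ofReal_mul (by positivity)]
    apply ENNReal.ofReal_le_ofReal
    rw [← mul_assoc, mul_comm C, mul_assoc]
    apply mul_le_mul_of_nonneg_left _ (by positivity)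
    have hy1 : 1 ≤ ‖x + z‖ := by simpa using hy
    have hle : ‖x + z‖ ≤ (1 + 1 / ρ) * ‖z‖ := by
      have h1 : 1 ≤ 1 / ρ * ‖z‖ := by rw [one_div, ← div_eq_inv_mul]; exact (one_le_div hρ).2 hz'
      have := norm_add_le x z
      nlinarith
    have h3 : kz n s p z ≤ (1 + 1 / ρ) ^ ((n:ℝ) + s * p) * kz n s p (x + z) := by
      unfold kz
      have h4 : (‖x + z‖ / (1 + 1 / ρ)) ≤ ‖z‖ := by
        rw [div_le_iff₀ (by positivity)]; linarith
      refine (Real.rpow_le_rpow_of_nonpos (by positivity) h4 (by linarith)).trans (le_of_eq ?_)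
      rw [Real.div_rpow (by positivity) (by positivity), Real.rpow_neg (by positivity : 0 ≤ 1 + 1 / ρ),
        div_inv_eq_mul, mul_comm]
    refine h3.trans (mul_le_mul_of_nonneg_right ?_ (kz_nonneg _))
    have : 0 ≤ ρ ^ (-((n:ℝ) + s * p)) := by positivity
    linarith

lemma far_bound {n : ℕ} (hn : 0 < n) {s p : ℝ} (hp : 1 < p) (hsp : 0 < s * p) {ρ : ℝ} (hρ : 0 < ρ) :
    ∃ C : ℝ, 0 < C ∧ ∀ (U φ : Eu n → ℝ), Measurable U → Measurable φ →
      (∀ x, x ∉ ball (0 : Eu n) 1 → φ x = 0) → ∀ μ : ℝ, 0 < μ →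
      ∫⁻ x, ∫⁻ z in (ball (0 : Eu n) ρ)ᶜ, ENNReal.ofReal (|U (x + z) - U x| ^ (p - 1) * |φ x| * kz n s p z)
       ≤ ENNReal.ofReal C * (ENNReal.ofReal μ * (Nr n p 1 U + TL n s p U ^ (p / (p - 1)))
          + ENNReal.ofReal (μ ^ (1 - p)) * Nr n p 1 φ) := by
  have hp1 : 0 < p - 1 := by linarith
  have hq : 0 < p / (p - 1) := by positivity
  obtain ⟨C1, hC1, h1⟩ := kfar hn hsp hρ
  obtain ⟨C2, hC2, h2⟩ := far_inner (n := n) hsp hρ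
  obtain ⟨C3, hC3, h3⟩ := hold_p1 (n := n) hp
  set V := (volume (ball (0 : Eu n) 1)) with hV
  have hVt : V ≠ ⊤ := measure_ball_lt_top.ne
  set C4 : ℝ := 2 ^ (p / (p - 1)) * (C3 + 1) with hC4
  refine ⟨2 ^ (p - 1) * (C2 * (V.toReal * C4 + 1) + C1), by positivity, fun U φ hU hφ h0 μ hμ => ?_⟩
  set A := Nr n p 1 U + TL n s p U ^ (p / (p - 1)) with hA
  set N := Nr n p 1 φ with hN
  set M := (∫⁻ x in ball (0 : Eu n) 1, ENNReal.ofReal (|U x| ^ (p - 1))) + TL n s p U with hM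
  have hMA : M ^ (p / (p - 1)) ≤ ENNReal.ofReal C4 * A := by
    rw [hM]
    have : ∀ a b : ℝ≥0∞, (a + b) ^ (p / (p - 1)) ≤ ENNReal.ofReal (2 ^ (p / (p - 1))) * (a ^ (p / (p - 1)) + b ^ (p / (p - 1))) := by
      intro a b
      have hm : a + b ≤ 2 * max a b := by
        rw [two_mul]; gcongr; exacts [le_max_left _ _, le_max_right _ _]
      calc (a + b) ^ (p / (p - 1)) ≤ (2 * max a b) ^ (p / (p - 1)) := by gcongr
        _ = ENNReal.ofReal (2 ^ (p / (p - 1))) * (max a b) ^ (p / (p - 1)) := by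
            rw [ENNReal.mul_rpow_of_nonneg _ _ hq.le, ← ENNReal.ofReal_rpow_of_pos (by norm_num)]
            simp
        _ ≤ _ := by
            gcongr
            rcases max_cases a b with ⟨h, _⟩ | ⟨h, _⟩ <;> rw [h]
            · exact le_self_add
            · exact le_add_self
    refine (this _ _).trans ?_
    rw [hC4, ENNReal.ofReal_mul (by positivity), mul_assoc]
    gcongr
    rw [hA, mul_add]
    gcongr
    · refine (h3 U hU).trans ?_
      gcongr
      linarith
    · refine le_mul_of_one_le_left zero_le ?_
      rw [ENNReal.one_le_ofReal]; linarith
  -- pointwise inner bound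
  have hin : ∀ x ∈ ball (0 : Eu n) 1, ∫⁻ z in (ball (0 : Eu n) ρ)ᶜ,
      ENNReal.ofReal (|U (x + z) - U x| ^ (p - 1) * |φ x| * kz n s p z) ≤
      ENNReal.ofReal (2 ^ (p - 1)) * ((ENNReal.ofReal C2 * (ENNReal.ofReal μ * M ^ (p / (p - 1))
        + ENNReal.ofReal (μ ^ (1 - p)) * ENNReal.ofReal (|φ x| ^ p))) +
        ENNReal.ofReal C1 * (ENNReal.ofReal μ * ENNReal.ofReal (|U x| ^ p)
        + ENNReal.ofReal (μ ^ (1 - p)) * ENNReal.ofReal (|φ x| ^ p))) := by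
    intro x hx
    calc _ ≤ ∫⁻ z in (ball (0 : Eu n) ρ)ᶜ, ENNReal.ofReal (2 ^ (p - 1)) * 
          (ENNReal.ofReal (|U (x + z)| ^ (p - 1) * kz n s p z) * ENNReal.ofReal (|φ x|)
           + ENNReal.ofReal (kz n s p z) * ENNReal.ofReal (|U x| ^ (p - 1) * |φ x|)) := by
          apply lintegral_mono; intro z; beta_reduce
          have hk := kz_nonneg (n := n) (s := s) (p := p) z
          rw [← ENNReal.ofReal_mul (by positivity), ← ENNReal.ofReal_mul (by positivity),
            ← ENNReal.ofReal_add (by positivity) (by positivity), ← ENNReal.ofReal_mul (by positivity)]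
          apply ENNReal.ofReal_le_ofReal
          have := abs_sub_rpow_le hp1.le (U (x + z)) (U x)
          calc _ ≤ 2 ^ (p - 1) * (|U (x + z)| ^ (p - 1) + |U x| ^ (p - 1)) * |φ x| * kz n s p z := by
                gcongr
            _ = _ := by ring
      _ = ENNReal.ofReal (2 ^ (p - 1)) * ((∫⁻ z in (ball (0 : Eu n) ρ)ᶜ, 
          ENNReal.ofReal (|U (x + z)| ^ (p - 1) * kz n s p z)) * ENNReal.ofReal (|φ x|)
           + (∫⁻ z in (ball (0 : Eu n) ρ)ᶜ, ENNReal.ofReal (kz n s p z)) * ENNReal.ofReal (|U x| ^ (p - 1) * |φ x|)) := by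
          rw [lintegral_const_mul' _ _ ENNReal.ofReal_ne_top, lintegral_add_left (by fun_prop),
            lintegral_mul_const' _ _ ENNReal.ofReal_ne_top, lintegral_mul_const' _ _ ENNReal.ofReal_ne_top]
      _ ≤ _ := by
          refine mul_le_mul' le_rfl (add_le_add ?_ ?_)
          · calc _ ≤ (ENNReal.ofReal C2 * M) * ENNReal.ofReal |φ x| := by
                  gcongr; exact h2 U x hU hx
              _ = ENNReal.ofReal C2 * (M * ENNReal.ofReal |φ x|) := by ring
              _ ≤ _ := mul_le_mul' le_rfl (young_E hp M (abs_nonneg _) hμ)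
          · refine mul_le_mul' h1 ?_
            rw [← ENNReal.ofReal_mul (by positivity), ← ENNReal.ofReal_mul (by positivity),
              ← ENNReal.ofReal_add (by positivity) (by positivity)]
            exact ENNReal.ofReal_le_ofReal (young_p hp (abs_nonneg _) (abs_nonneg _) hμ)
  calc _ = ∫⁻ x in ball (0 : Eu n) 1, ∫⁻ z in (ball (0 : Eu n) ρ)ᶜ,
      ENNReal.ofReal (|U (x + z) - U x| ^ (p - 1) * |φ x| * kz n s p z) := by
        rw [← lintegral_indicator measurableSet_ball]
        congr 1; ext x
        by_cases hx : x ∈ ball (0 : Eu n) 1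
        · rw [indicator_of_mem hx]
        · rw [indicator_of_notMem hx]; simp [h0 x hx]
    _ ≤ _ := setLIntegral_mono' measurableSet_ball hin
    _ = ENNReal.ofReal (2 ^ (p - 1)) * ((ENNReal.ofReal C2 * (ENNReal.ofReal μ * M ^ (p / (p - 1)) * V
        + ENNReal.ofReal (μ ^ (1 - p)) * N)) +
        ENNReal.ofReal C1 * (ENNReal.ofReal μ * Nr n p 1 U
        + ENNReal.ofReal (μ ^ (1 - p)) * N)) := by
        rw [lintegral_const_mul' _ _ ENNReal.ofReal_ne_top, lintegral_add_left (by fun_prop),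
          lintegral_const_mul' _ _ ENNReal.ofReal_ne_top, lintegral_const_mul' _ _ ENNReal.ofReal_ne_top,
          lintegral_add_left (by fun_prop), lintegral_add_left (by fun_prop),
          lintegral_const_mul' _ _ ENNReal.ofReal_ne_top, lintegral_const_mul' _ _ ENNReal.ofReal_ne_top,
          setLIntegral_const, lintegral_const_mul' _ _ ENNReal.ofReal_ne_top, ← mul_assoc (ENNReal.ofReal μ)]
        rfl
    _ ≤ ENNReal.ofReal (2 ^ (p - 1)) * ((ENNReal.ofReal C2 * (ENNReal.ofReal μ * (ENNReal.ofReal C4 * A) * V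
        + ENNReal.ofReal (μ ^ (1 - p)) * N)) +
        ENNReal.ofReal C1 * (ENNReal.ofReal μ * A
        + ENNReal.ofReal (μ ^ (1 - p)) * N)) := by
        gcongr
        exact le_self_add
    _ ≤ _ := by
        rw [ENNReal.ofReal_mul (by positivity : (0:ℝ) ≤ 2 ^ (p - 1)), mul_assoc (ENNReal.ofReal (2 ^ (p - 1)))]
        refine mul_le_mul' le_rfl ?_
        set m := ENNReal.ofReal μ
        set m' := ENNReal.ofReal (μ ^ (1 - p))
        rw [ENNReal.ofReal_add (by positivity) (by positivity), ENNReal.ofReal_mul hC2.le,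
          ENNReal.ofReal_add (by positivity) (by positivity),
          ENNReal.ofReal_mul (ENNReal.toReal_nonneg : 0 ≤ V.toReal),
          ENNReal.ofReal_toReal hVt, ENNReal.ofReal_one]
        rw [add_mul]
        refine add_le_add ?_ le_rfl
        rw [mul_assoc (ENNReal.ofReal C2)]
        refine mul_le_mul' le_rfl ?_
        calc m * (ENNReal.ofReal C4 * A) * V + m' * N = V * ENNReal.ofReal C4 * (m * A) + 1 * (m' * N) := by ring
          _ ≤ (V * ENNReal.ofReal C4 + 1) * (m * A) + (V * ENNReal.ofReal C4 + 1) * (m' * N) := by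
            gcongr
            · exact le_self_add
            · exact le_add_self
          _ = _ := by ring




/-- Normalized local solution in the unit ball. -/
structure Sol (n : ℕ) (p s : ℝ) (f U : Eu n → ℝ) : Prop where
  mU : Measurable U
  mf : Measurable f
  lp : Nr n p 1 U < ⊤
  gag : gagliardoE n s p (ball 0 1) U < ⊤
  tl : TL n s p U < ⊤
  F : Nr n (p / (p - 1)) 1 f < ⊤
  lip : ∀ r : ℝ, r < 1 → ∃ L : ℝ, 0 ≤ L ∧ ∀ x ∈ ball (0 : Eu n) r, ∀ y ∈ ball (0 : Eu n) r,
    |U x - U y| ≤ L * ‖x - y‖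
  eq : ∀ φ : Eu n → ℝ, Measurable φ → ∀ r : ℝ, r < 1 → (∀ x, x ∉ ball (0 : Eu n) r → φ x = 0) →
    (∃ L : ℝ, ∀ x y, |φ x - φ y| ≤ L * ‖x - y‖) →
    (∫ x, ∫ y, |U x - U y| ^ (p - 2) * (U x - U y) * (φ x - φ y) / dist x y ^ ((n : ℝ) + s * p)) =
      ∫ x in ball (0 : Eu n) 1, f x * φ x

/-- Weak form integrand in coordinates `(x,z)`. -/
def Jker (n : ℕ) (p s : ℝ) (U φ : Eu n → ℝ) (q : Eu n × Eu n) : ℝ :=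
  Jp p (U (q.1 + q.2) - U q.1) * (φ (q.1 + q.2) - φ q.1) * kz n s p q.2

lemma measurable_Jker {n : ℕ} {p s : ℝ} {U φ : Eu n → ℝ} (hU : Measurable U) (hφ : Measurable φ) :
    Measurable (Jker n p s U φ) := by
  unfold Jker
  have := measurable_Jp p
  fun_prop

lemma near_int {n : ℕ} (hn : 0 < n) {p s : ℝ} (hsp : 0 < s * p) (hs : s * p < p) {ρ : ℝ} (hρ1 : ρ ≤ 1)
    {G : Eu n × Eu n → ℝ} (hG : Measurable G) {K : ℝ}
    (hb : ∀ x z, x ∈ ball (0 : Eu n) 1 → z ∈ ball (0 : Eu n) ρ → |G (x, z)| ≤ K * (‖z‖ ^ p * kz n s p z))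
    (h0 : ∀ x z, ¬ (x ∈ ball (0 : Eu n) 1 ∧ z ∈ ball (0 : Eu n) ρ) → G (x, z) = 0) :
    Integrable G (volume.prod volume) := by
  obtain ⟨C, hC, hk⟩ := knear hn hsp hs hρ1
  have h1 : Integrable (indicator (ball (0 : Eu n) 1) fun _ => (1:ℝ)) volume :=
    (integrable_indicator_iff measurableSet_ball).2 (integrableOn_const measure_ball_lt_top.ne)
  have h2 : Integrable (indicator (ball (0 : Eu n) ρ) fun z => ‖z‖ ^ p * kz n s p z) volume := by
    rw [integrable_indicator_iff measurableSet_ball]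
    refine ⟨by fun_prop, ?_⟩
    rw [hasFiniteIntegral_iff_ofReal]
    · exact hk.trans_lt ENNReal.ofReal_lt_top
    · exact Filter.Eventually.of_forall fun z => mul_nonneg (by positivity) (kz_nonneg z)
  have h3 := (h1.mul_prod h2).const_mul K
  refine h3.mono' hG.aestronglyMeasurable (Filter.Eventually.of_forall fun q => ?_)
  obtain ⟨x, z⟩ := q
  by_cases h : x ∈ ball (0 : Eu n) 1 ∧ z ∈ ball (0 : Eu n) ρ
  · simp only [indicator_of_mem h.1, indicator_of_mem h.2, one_mul]
    exact hb x z h.1 h.2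
  · rw [h0 x z h, norm_zero]
    rw [not_and_or] at h
    rcases h with h | h <;> simp [indicator_of_notMem h]

set_option maxHeartbeats 1000000 in
lemma far_int {n : ℕ} {s p : ℝ} (hp : 1 < p) {ρ : ℝ}
    (U φ : Eu n → ℝ) (hU : Measurable U) (hφ : Measurable φ) :
    ∫⁻ z in (ball (0 : Eu n) ρ)ᶜ, ∫⁻ x, ENNReal.ofReal |Jker n p s U φ (x, z)| ≤
      2 * ∫⁻ x, ∫⁻ z in (ball (0 : Eu n) ρ)ᶜ, ENNReal.ofReal (|U (x + z) - U x| ^ (p - 1) * |φ x| * kz n s p z) := by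
  obtain ⟨G, hGd⟩ : ∃ G : Eu n → Eu n → ℝ≥0∞, G = fun z x => ENNReal.ofReal (|U (x + z) - U x| ^ (p - 1) * |φ x| * kz n s p z) := ⟨_, rfl⟩
  have hG : Measurable (Function.uncurry G) := by
    rw [hGd]; simp only [Function.uncurry_def]; fun_prop
  have e1 : ∫⁻ x, ∫⁻ z in (ball (0 : Eu n) ρ)ᶜ, G z x = ∫⁻ z in (ball (0 : Eu n) ρ)ᶜ, ∫⁻ x, G z x :=
    lintegral_lintegral_swap (f := fun x z => G z x) (hG.comp measurable_swap).aemeasurable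
  have e0 : ∫⁻ x, ∫⁻ z in (ball (0 : Eu n) ρ)ᶜ, ENNReal.ofReal (|U (x + z) - U x| ^ (p - 1) * |φ x| * kz n s p z)
      = ∫⁻ x, ∫⁻ z in (ball (0 : Eu n) ρ)ᶜ, G z x := by rw [hGd]
  rw [e0, e1]
  have e2 : ∫⁻ z in (ball (0 : Eu n) ρ)ᶜ, ∫⁻ x, G (-z) (x + z) = ∫⁻ z in (ball (0 : Eu n) ρ)ᶜ, ∫⁻ x, G z x := by
    rw [← lintegral_indicator measurableSet_ball.compl, ← lintegral_indicator measurableSet_ball.compl]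
    conv_rhs => rw [← lintegral_neg_eq_self]
    congr 1; ext z
    have : (-z ∈ (ball (0 : Eu n) ρ)ᶜ) ↔ z ∈ (ball (0 : Eu n) ρ)ᶜ := by simp
    by_cases hz : z ∈ (ball (0 : Eu n) ρ)ᶜ
    · rw [indicator_of_mem hz, indicator_of_mem (this.2 hz)]
      exact lint_shift (fun x => G (-z) x) z
    · rw [indicator_of_notMem hz, indicator_of_notMem (fun h => hz (this.1 h))]
  rw [two_mul]
  conv_rhs => enter [1]; rw [← e2]
  have hG2 : Measurable (fun z => ∫⁻ x, G z x) := hG.lintegral_prod_right'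
  rw [← lintegral_add_right _ hG2]
  apply lintegral_mono; intro z
  beta_reduce
  have hG3 : Measurable (fun x => G z x) := hG.comp (by fun_prop : Measurable fun x => (z, x))
  rw [← lintegral_add_right _ hG3]
  apply lintegral_mono; intro x
  simp only [hGd]
  have hk := kz_nonneg (n := n) (s := s) (p := p) z
  rw [kz_neg, ← ENNReal.ofReal_add (by positivity) (by positivity)]
  apply ENNReal.ofReal_le_ofReal
  unfold Jker
  rw [abs_mul, abs_mul, abs_Jp hp, abs_of_nonneg hk, add_neg_cancel_right, abs_sub_comm (U x), ← add_mul, ← mul_add]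
  gcongr
  exact abs_sub _ _

lemma jker_far {n : ℕ} (hn : 0 < n) {s p : ℝ} (hp : 1 < p) (hsp : 0 < s * p) {ρ : ℝ} (hρ : 0 < ρ) :
    ∃ C : ℝ, 0 < C ∧ ∀ (U φ : Eu n → ℝ), Measurable U → Measurable φ →
      (∀ x, x ∉ ball (0 : Eu n) 1 → φ x = 0) → ∀ μ : ℝ, 0 < μ →
      ∫⁻ q in univ ×ˢ (ball (0 : Eu n) ρ)ᶜ, ENNReal.ofReal |Jker n p s U φ q| ∂(volume.prod volume)
       ≤ ENNReal.ofReal C * (ENNReal.ofReal μ * (Nr n p 1 U + TL n s p U ^ (p / (p - 1)))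
          + ENNReal.ofReal (μ ^ (1 - p)) * Nr n p 1 φ) := by
  obtain ⟨C, hC, h⟩ := far_bound hn hp hsp hρ
  refine ⟨2 * C, by positivity, fun U φ hU hφ h0 μ hμ => ?_⟩
  have hm := measurable_Jker (p := p) (s := s) hU hφ
  rw [← Measure.prod_restrict, Measure.restrict_univ,
    lintegral_prod_symm _ (by fun_prop : Measurable fun q => ENNReal.ofReal |Jker n p s U φ q|).aemeasurable]
  refine (far_int hp U φ hU hφ).trans ?_
  rw [ENNReal.ofReal_mul (by norm_num), mul_assoc]
  refine mul_le_mul' (by simp) (h U φ hU hφ h0 μ hμ)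

lemma Sol.weak {n : ℕ} (hn : 0 < n) {s p : ℝ} (hp : 1 < p) (hs : 0 < s) (hs1 : s < 1) {f U : Eu n → ℝ}
    (h : Sol n p s f U) {φ : Eu n → ℝ} (hφ : Measurable φ) {r : ℝ} (hr : r < 1)
    (h0 : ∀ x, x ∉ ball (0 : Eu n) r → φ x = 0) {L : ℝ} (hL : ∀ x y, |φ x - φ y| ≤ L * ‖x - y‖) :
    Integrable (Jker n p s U φ) (volume.prod volume) ∧
    ∫ q, Jker n p s U φ q ∂(volume.prod volume) = ∫ x in ball (0 : Eu n) 1, f x * φ x := by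
  have hsp : 0 < s * p := by positivity
  have hspp : s * p < p := by nlinarith
  have hm := measurable_Jker (p := p) (s := s) h.mU hφ
  have hp1 : 0 < p - 1 := by linarith
  have hB : ∀ x, x ∉ ball (0 : Eu n) 1 → φ x = 0 := fun x hx => h0 x fun h => hx (ball_subset_ball hr.le h)
  have hJint : Integrable (Jker n p s U φ) (volume.prod volume) := by
    obtain ⟨ρ, hρ0, hρ⟩ : ∃ ρ, 0 < ρ ∧ ρ < 1 ∧ r + 2 * ρ < 1 :=
      ⟨min ((1 - r) / 4) (1 / 2), lt_min (by linarith) (by norm_num), by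
        constructor
        · exact (min_le_right _ _).trans_lt (by norm_num)
        · have := min_le_left ((1 - r) / 4) (1 / 2 : ℝ); linarith⟩
    have hS : MeasurableSet ((univ : Set (Eu n)) ×ˢ (ball (0 : Eu n) ρ)ᶜ) :=
      MeasurableSet.univ.prod measurableSet_ball.compl
    have hfar : IntegrableOn (Jker n p s U φ) (univ ×ˢ (ball (0 : Eu n) ρ)ᶜ) (volume.prod volume) := by
      refine ⟨hm.aestronglyMeasurable, ?_⟩
      rw [hasFiniteIntegral_iff_norm]
      obtain ⟨C, hC, hb⟩ := jker_far hn hp hsp hρ0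
      refine (hb U φ h.mU hφ hB 1 one_pos).trans_lt ?_
      refine ENNReal.mul_lt_top ENNReal.ofReal_lt_top (ENNReal.add_lt_top.2 ⟨ENNReal.mul_lt_top ENNReal.ofReal_lt_top
        (ENNReal.add_lt_top.2 ⟨h.lp, ENNReal.rpow_lt_top_of_nonneg (by positivity) h.tl.ne⟩),
        ENNReal.mul_lt_top ENNReal.ofReal_lt_top ?_⟩)
      -- φ bounded
      have hbd : ∃ M, ∀ x, |φ x| ^ p ≤ M := by
        by_cases hr0 : ∃ x0 : Eu n, x0 ∉ ball (0 : Eu n) r ∧ x0 ∈ ball (0 : Eu n) 2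
        · obtain ⟨x0, hx0, hx02⟩ := hr0
          refine ⟨(|L| * 3) ^ p, fun x => ?_⟩
          refine Real.rpow_le_rpow (abs_nonneg _) ?_ (by linarith)
          by_cases hx : x ∈ ball (0 : Eu n) 1
          · have h1 := hL x x0
            rw [h0 x0 hx0, sub_zero] at h1
            rw [mem_ball_zero_iff] at hx hx02
            have h2 := norm_sub_le x x0
            calc |φ x| ≤ L * ‖x - x0‖ := h1
              _ ≤ |L| * ‖x - x0‖ := mul_le_mul_of_nonneg_right (le_abs_self _) (norm_nonneg _)
              _ ≤ |L| * 3 := mul_le_mul_of_nonneg_left (by linarith) (abs_nonneg _)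
          · rw [hB x hx, abs_zero]; positivity
        · exfalso
          push Not at hr0
          have hne : Nonempty (Fin n) := ⟨⟨0, hn⟩⟩
          obtain ⟨y, hy⟩ := exists_norm_eq (Eu n) (by norm_num : (0:ℝ) ≤ 1)
          refine hr0 y ?_ ?_ <;> rw [mem_ball_zero_iff, hy]
          · linarith
          · norm_num
      obtain ⟨M, hM⟩ := hbd
      unfold Nr
      calc _ ≤ ∫⁻ x in ball (0 : Eu n) 1, ENNReal.ofReal M := by
            apply lintegral_mono; intro x; exact ENNReal.ofReal_le_ofReal (hM x)
        _ < ⊤ := by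
            rw [setLIntegral_const]; exact ENNReal.mul_lt_top ENNReal.ofReal_lt_top measure_ball_lt_top
    have hnear : IntegrableOn (Jker n p s U φ) (univ ×ˢ (ball (0 : Eu n) ρ)) (volume.prod volume) := by
      have hS' : MeasurableSet ((univ : Set (Eu n)) ×ˢ (ball (0 : Eu n) ρ)) :=
        MeasurableSet.univ.prod measurableSet_ball
      rw [← integrable_indicator_iff hS']
      obtain ⟨LU, hLU0, hLU⟩ := h.lip (r + 2 * ρ) hρ.2
      have hz : ∀ x z : Eu n, z ∈ ball (0 : Eu n) ρ → x ∉ ball (0 : Eu n) (r + ρ) → Jker n p s U φ (x, z) = 0 := by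
        intro x z hz hx
        rw [mem_ball_zero_iff] at hz hx
        have hx' : x ∉ ball (0 : Eu n) r := by rw [mem_ball_zero_iff]; linarith
        have hxz : x + z ∉ ball (0 : Eu n) r := by
          rw [mem_ball_zero_iff]
          have := norm_sub_le (x + z) z
          rw [add_sub_cancel_right] at this; linarith
        simp [Jker, h0 x hx', h0 _ hxz]
      refine near_int hn hsp hspp hρ.1.le (hm.indicator hS') (K := LU ^ (p - 1) * |L|) ?_ ?_
      · intro x z _ hz'
        rw [indicator_of_mem (by simpa using hz')]
        have hkz := kz_nonneg (n := n) (s := s) (p := p) z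
        by_cases hx : x ∈ ball (0 : Eu n) (r + ρ)
        · unfold Jker
          rw [mem_ball_zero_iff] at hz' hx
          have hxz : ‖x + z‖ < r + 2 * ρ := (norm_add_le x z).trans_lt (by linarith)
          have h1 := hLU (x + z) (by simpa using hxz) x (by rw [mem_ball_zero_iff]; linarith)
          have h2 := hL (x + z) x
          rw [add_sub_cancel_left] at h1 h2
          rw [abs_mul, abs_mul, abs_Jp hp, abs_of_nonneg hkz]
          rcases eq_or_ne z 0 with h00 | h00
          · subst h00
            simp only [add_zero, sub_self, abs_zero, mul_zero, zero_mul]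
            positivity
          have hz0 : 0 < ‖z‖ := norm_pos_iff.2 h00
          calc _ ≤ (LU * ‖z‖) ^ (p - 1) * (|L| * ‖z‖) * kz n s p z := by
                gcongr
                exact h2.trans (mul_le_mul_of_nonneg_right (le_abs_self _) (norm_nonneg _))
            _ = _ := by
                rw [Real.mul_rpow hLU0 hz0.le]
                have : ‖z‖ ^ p = ‖z‖ ^ (p - 1) * ‖z‖ := by
                  rw [← Real.rpow_add_one hz0.ne']; congr 1; ring
                rw [this]; ring
        · rw [hz x z hz' hx, abs_zero]; positivity
      · intro x z hxz
        by_cases hz' : z ∈ ball (0 : Eu n) ρ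
        · rw [indicator_of_mem (by simpa using hz')]
          refine hz x z hz' fun hx => hxz ⟨?_, hz'⟩
          exact ball_subset_ball (by linarith) hx
        · rw [indicator_of_notMem (by simpa using hz')]
    have := hnear.union hfar
    rwa [← Set.prod_union, union_compl_self, univ_prod_univ, integrableOn_univ] at this
  refine ⟨hJint, ?_⟩
  rw [integral_prod _ hJint, ← h.eq φ hφ r hr h0 ⟨L, hL⟩]
  congr 1; ext x
  conv_rhs => rw [← integral_add_left_eq_self _ x]
  congr 1; ext z
  unfold Jker Jp kz
  simp only
  rw [dist_self_add_right, Real.rpow_neg (norm_nonneg _), div_eq_mul_inv, abs_sub_comm]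
  ring




/-- Cutoff data. -/
structure Cut (n : ℕ) (R0 L : ℝ) (η : Eu n → ℝ) : Prop where
  m : Measurable η
  nn : ∀ x, 0 ≤ η x
  le : ∀ x, η x ≤ 1
  z : ∀ x, x ∉ ball (0 : Eu n) R0 → η x = 0
  L0 : 0 ≤ L
  lip : ∀ x y, |η x - η y| ≤ L * ‖x - y‖

lemma cutoff_exists {n : ℕ} {r ρ : ℝ} (hr : 0 < r) (hρ : 0 < ρ) : ∃ (η : Eu n → ℝ) (L : ℝ),
    Cut n (r + ρ) L η ∧ (∀ x ∈ ball (0 : Eu n) r, η x = 1) ∧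
    ∀ x z h : Eu n, |(η (x + z) - η x) - (η (x - h + z) - η (x - h))| ≤ L * ‖h‖ * ‖z‖ := by
  let b : ContDiffBump (0 : Eu n) := ⟨r, r + ρ, hr, by linarith⟩
  have hb : ContDiff ℝ 2 b := b.contDiff
  have hc : HasCompactSupport b := b.hasCompactSupport
  obtain ⟨L1, hL1⟩ := hb.lipschitzWith_of_hasCompactSupport hc (by norm_num)
  have hb' : ContDiff ℝ 1 (fderiv ℝ b) := hb.fderiv_right (by norm_num)
  obtain ⟨L2, hL2⟩ := hb'.lipschitzWith_of_hasCompactSupport (hc.fderiv (𝕜 := ℝ)) (by norm_num)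
  have hdiff : Differentiable ℝ b := hb.differentiable (by norm_num)
  refine ⟨b, L1 + L2, ⟨b.continuous.measurable, fun x => b.nonneg, fun x => b.le_one, ?_, by positivity, ?_⟩, ?_, ?_⟩
  · intro x hx
    have h := b.support_eq
    by_contra h1
    have : x ∈ Function.support b := h1
    rw [h] at this
    exact hx this
  · intro x y
    have := hL1.dist_le_mul x y
    rw [Real.dist_eq, dist_eq_norm] at this
    refine this.trans (mul_le_mul_of_nonneg_right ?_ (norm_nonneg _))
    have : (0:ℝ) ≤ L2 := L2.2
    linarith
  · intro x hx
    exact b.one_of_mem_closedBall (ball_subset_closedBall hx)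
  · intro x z h
    have key : ∀ y : Eu n, DifferentiableAt ℝ (fun y => b (y + z) - b y) y := fun y => by
      fun_prop
    have hfd : ∀ y : Eu n, ‖fderiv ℝ (fun y => b (y + z) - b y) y‖ ≤ L2 * ‖z‖ := by
      intro y
      rw [fderiv_fun_sub (by fun_prop) (by fun_prop), fderiv_comp_add_right]
      have := hL2.dist_le_mul (y + z) y
      rwa [dist_eq_norm, dist_self_add_left] at this
    have := convex_univ.norm_image_sub_le_of_norm_fderiv_le (f := fun y => b (y + z) - b y)
      (fun y _ => key y) (fun y _ => hfd y) (mem_univ (x - h)) (mem_univ x)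
    rw [sub_sub_cancel, Real.norm_eq_abs] at this
    refine this.trans ?_
    have : (0:ℝ) ≤ L1 := L1.2
    have h2 : 0 ≤ ‖h‖ * ‖z‖ := by positivity
    nlinarith

lemma lip_mul {n : ℕ} {R0 L Lg : ℝ} {η g : Eu n → ℝ} (hη : Cut n R0 L η) (hLg : 0 ≤ Lg)
    (hg : ∀ x ∈ ball (0 : Eu n) R0, ∀ y ∈ ball (0 : Eu n) R0, |g x - g y| ≤ Lg * ‖x - y‖) :
    ∃ L' : ℝ, 0 ≤ L' ∧ ∀ x y, |η x * g x - η y * g y| ≤ L' * ‖x - y‖ := by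
  rcases le_or_gt R0 0 with hR | hR
  · refine ⟨0, le_rfl, fun x y => ?_⟩
    rw [hη.z x (by simp [ball_eq_empty.2 hR]), hη.z y (by simp [ball_eq_empty.2 hR])]
    simp
  set M := |g 0| + Lg * R0 with hM
  have hM0 : 0 ≤ M := by positivity
  have hgM : ∀ x ∈ ball (0 : Eu n) R0, |g x| ≤ M := by
    intro x hx
    have h1 := hg x hx 0 (mem_ball_self hR)
    rw [sub_zero] at h1
    rw [mem_ball_zero_iff] at hx
    have h2 : |g x| ≤ |g 0| + |g x - g 0| := by
      have := abs_add_le (g 0) (g x - g 0); rwa [add_sub_cancel] at this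
    have h3 := mul_le_mul_of_nonneg_left hx.le hLg
    linarith
  have hL := hη.L0
  refine ⟨L * M + Lg, by positivity, ?_⟩
  have one : ∀ x y, x ∈ ball (0 : Eu n) R0 → y ∉ ball (0 : Eu n) R0 → |η x * g x - η y * g y| ≤ (L * M + Lg) * ‖x - y‖ := by
    intro x y hx hy
    have h0 := hη.z y hy
    have h1 := hη.lip x y
    rw [h0, sub_zero] at h1
    rw [h0, zero_mul, sub_zero, abs_mul]
    have := mul_le_mul h1 (hgM x hx) (abs_nonneg _) (by positivity)
    have h2 : 0 ≤ Lg * ‖x - y‖ := by positivity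
    nlinarith
  intro x y
  by_cases hx : x ∈ ball (0 : Eu n) R0 <;> by_cases hy : y ∈ ball (0 : Eu n) R0
  · have e : η x * g x - η y * g y = (η x - η y) * g x + η y * (g x - g y) := by ring
    rw [e]
    refine (abs_add_le _ _).trans ?_
    rw [abs_mul, abs_mul, abs_of_nonneg (hη.nn y)]
    have h1 := mul_le_mul (hη.lip x y) (hgM x hx) (abs_nonneg _) (by positivity)
    have h2 := mul_le_mul (hη.le y) (hg x hx y hy) (abs_nonneg _) zero_le_one
    nlinarith
  · exact one x y hx hy
  · rw [abs_sub_comm, norm_sub_rev]; exact one y x hy hx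
  · rw [hη.z x hx, hη.z y hy]; simp only [zero_mul, sub_self, abs_zero]; positivity

/-- the averaged cutoff times the difference -/
def chiF {n : ℕ} (η g : Eu n → ℝ) (x z : Eu n) : ℝ := (η x + η (x + z)) / 2 * (g (x + z) - g x)
/-- the error term -/
def eeF {n : ℕ} (η g : Eu n → ℝ) (x z : Eu n) : ℝ := (g x + g (x + z)) / 2 * (η (x + z) - η x)
/-- the test function -/
def phiF {n : ℕ} (η g : Eu n → ℝ) (h x : Eu n) : ℝ := η (x - h) * g (x - h) - η x * g x

set_option maxHeartbeats 1000000 in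
lemma KE_ident {n : ℕ} (hn : 0 < n) {s p : ℝ} (hp : 1 < p) (hs : 0 < s) (hs1 : s < 1) {f U : Eu n → ℝ}
    (hS : Sol n p s f U) {r ρ L : ℝ} (hr : 0 < r) (hρ : 0 < ρ) (hrρ : r + 8 * ρ ≤ 1) {η : Eu n → ℝ}
    (hη : Cut n (r + 2 * ρ) L η) {h : Eu n} (hh : ‖h‖ ≤ ρ) :
    IntegrableOn (fun q : Eu n × Eu n => (Jp p (U (q.1 + h + q.2) - U (q.1 + h)) - Jp p (U (q.1 + q.2) - U q.1)) *
      chiF η (tau h U) q.1 q.2 * kz n s p q.2) (univ ×ˢ ball (0 : Eu n) ρ) (volume.prod volume) ∧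
    ∫ q in univ ×ˢ ball (0 : Eu n) ρ, (Jp p (U (q.1 + h + q.2) - U (q.1 + h)) - Jp p (U (q.1 + q.2) - U q.1)) *
      chiF η (tau h U) q.1 q.2 * kz n s p q.2 ∂(volume.prod volume) =
    (∫ x in ball (0 : Eu n) 1, f x * phiF η (tau h U) h x)
    - (∫ q in univ ×ˢ (ball (0 : Eu n) ρ)ᶜ, Jker n p s U (phiF η (tau h U) h) q ∂(volume.prod volume))
    - ∫ q in univ ×ˢ ball (0 : Eu n) ρ, Jp p (U (q.1 + q.2) - U q.1) *
      (eeF η (tau h U) (q.1 - h) q.2 - eeF η (tau h U) q.1 q.2) * kz n s p q.2 ∂(volume.prod volume) := by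
  have hsp : 0 < s * p := by positivity
  have hspp : s * p < p := by nlinarith
  obtain ⟨LU, hLU0, hLU⟩ := hS.lip (r + 7 * ρ) (by linarith)
  have hUm := hS.mU
  have hJm := measurable_Jp p
  have hηm := hη.m
  set g := tau h U with hg
  have hgm : Measurable g := measurable_tau h hUm
  set S : Set (Eu n × Eu n) := univ ×ˢ ball (0 : Eu n) ρ with hSd
  have hSm : MeasurableSet S := MeasurableSet.univ.prod measurableSet_ball
  -- φ lipschitz
  have hgl : ∀ x ∈ ball (0 : Eu n) (r + 2 * ρ), ∀ y ∈ ball (0 : Eu n) (r + 2 * ρ), |g x - g y| ≤ (2 * LU) * ‖x - y‖ := by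
    intro x hx y hy
    rw [mem_ball_zero_iff] at hx hy
    have h1 := hLU (x + h) (by rw [mem_ball_zero_iff]; exact (norm_add_le _ _).trans_lt (by linarith))
      (y + h) (by rw [mem_ball_zero_iff]; exact (norm_add_le _ _).trans_lt (by linarith))
    have h2 := hLU x (by rw [mem_ball_zero_iff]; linarith) y (by rw [mem_ball_zero_iff]; linarith)
    rw [add_sub_add_right_eq_sub] at h1
    have e : g x - g y = (U (x + h) - U (y + h)) - (U x - U y) := by simp only [hg, tau]; ring
    rw [e]
    refine (abs_sub _ _).trans ?_
    linarith
  obtain ⟨Lψ, hLψ0, hLψ⟩ := lip_mul hη (by positivity) hgl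
  have hφl : ∀ x y, |phiF η g h x - phiF η g h y| ≤ (2 * Lψ) * ‖x - y‖ := by
    intro x y
    have h1 := hLψ (x - h) (y - h)
    have h2 := hLψ x y
    rw [sub_sub_sub_cancel_right] at h1
    have e : phiF η g h x - phiF η g h y = (η (x - h) * g (x - h) - η (y - h) * g (y - h)) - (η x * g x - η y * g y) := by
      simp only [phiF]; ring
    rw [e]
    refine (abs_sub _ _).trans ?_
    linarith
  have hφ0 : ∀ x, x ∉ ball (0 : Eu n) (r + 3 * ρ) → phiF η g h x = 0 := by
    intro x hx
    rw [mem_ball_zero_iff, not_lt] at hx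
    have h1 := norm_sub_norm_le x h
    rw [phiF, hη.z x (by rw [mem_ball_zero_iff]; linarith), hη.z (x - h) (by rw [mem_ball_zero_iff]; linarith)]
    ring
  have hφm : Measurable (phiF η g h) := by unfold phiF; fun_prop
  obtain ⟨hJi, hJe⟩ := hS.weak hn hp hs hs1 hφm (by linarith : r + 3 * ρ < 1) hφ0 hφl
  -- chi support and bound
  have hχ0 : ∀ x z, z ∈ ball (0 : Eu n) ρ → x ∉ ball (0 : Eu n) (r + 3 * ρ) → chiF η g x z = 0 := by
    intro x z hz hx
    rw [mem_ball_zero_iff] at hz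
    rw [mem_ball_zero_iff, not_lt] at hx
    have h1 := norm_sub_norm_le x (-z)
    rw [norm_neg, sub_neg_eq_add] at h1
    rw [chiF, hη.z x (by rw [mem_ball_zero_iff]; linarith), hη.z (x + z) (by rw [mem_ball_zero_iff]; linarith)]
    ring
  have hδU : ∀ x z, x ∈ ball (0 : Eu n) (r + 4 * ρ) → z ∈ ball (0 : Eu n) ρ → |U (x + z) - U x| ≤ LU * ‖z‖ := by
    intro x z hx hz
    rw [mem_ball_zero_iff] at hz hx
    have := hLU (x + z) (by rw [mem_ball_zero_iff]; exact (norm_add_le _ _).trans_lt (by linarith)) x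
      (by rw [mem_ball_zero_iff]; linarith)
    rwa [add_sub_cancel_left] at this
  have hχb : ∀ x z, x ∈ ball (0 : Eu n) (r + 3 * ρ) → z ∈ ball (0 : Eu n) ρ → |chiF η g x z| ≤ 2 * LU * ‖z‖ := by
    intro x z hx hz
    have h1 := hδU x z (ball_subset_ball (by linarith) hx) hz
    have h2 := hδU (x + h) z (by rw [mem_ball_zero_iff] at *; exact (norm_add_le _ _).trans_lt (by linarith)) hz
    have e : g (x + z) - g x = (U (x + h + z) - U (x + h)) - (U (x + z) - U x) := by
      simp only [hg, tau]; rw [add_right_comm]; ring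
    have h3 : |(η x + η (x + z)) / 2| ≤ 1 := by
      rw [abs_of_nonneg (by have := hη.nn x; have := hη.nn (x + z); linarith)]
      have := hη.le x; have := hη.le (x + z); linarith
    rw [chiF, abs_mul, e]
    calc _ ≤ 1 * |(U (x + h + z) - U (x + h)) - (U (x + z) - U x)| := mul_le_mul_of_nonneg_right h3 (abs_nonneg _)
      _ ≤ _ := by rw [one_mul]; refine (abs_sub _ _).trans ?_; linarith
  have hχm : Measurable (fun q : Eu n × Eu n => chiF η g q.1 q.2) := by unfold chiF; fun_prop
  -- general integrability
  have hgen : ∀ A : Eu n × Eu n → ℝ, Measurable A →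
      (∀ x z, x ∈ ball (0 : Eu n) (r + 3 * ρ) → z ∈ ball (0 : Eu n) ρ → |A (x, z)| ≤ LU * ‖z‖) →
      IntegrableOn (fun q : Eu n × Eu n => Jp p (A q) * chiF η g q.1 q.2 * kz n s p q.2) S (volume.prod volume) := by
    intro A hA hAb
    have hm : Measurable (fun q : Eu n × Eu n => Jp p (A q) * chiF η g q.1 q.2 * kz n s p q.2) := by fun_prop
    rw [← integrable_indicator_iff hSm]
    refine near_int hn hsp hspp (by linarith : ρ ≤ 1) (hm.indicator hSm) (K := LU ^ (p - 1) * (2 * LU)) ?_ ?_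
    · intro x z _ hz
      rw [indicator_of_mem (by simpa [hSd] using hz)]
      have hk := kz_nonneg (n := n) (s := s) (p := p) z
      by_cases hx : x ∈ ball (0 : Eu n) (r + 3 * ρ)
      · rw [abs_mul, abs_mul, abs_Jp hp, abs_of_nonneg hk]
        have h1 := hAb x z hx hz
        have h2 := hχb x z hx hz
        rcases eq_or_ne z 0 with h00 | h00
        · subst h00
          simp only [chiF, add_zero, sub_self, mul_zero, abs_zero, zero_mul]
          positivity
        have hz0 : 0 < ‖z‖ := norm_pos_iff.2 h00
        calc _ ≤ (LU * ‖z‖) ^ (p - 1) * (2 * LU * ‖z‖) * kz n s p z := by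
                have hp1 : 0 ≤ p - 1 := by linarith
                gcongr
            _ = _ := by
                rw [Real.mul_rpow hLU0 hz0.le]
                have : ‖z‖ ^ p = ‖z‖ ^ (p - 1) * ‖z‖ := by
                  rw [← Real.rpow_add_one hz0.ne']; congr 1; ring
                rw [this]; ring
      · simp only [hχ0 x z hz hx, mul_zero, zero_mul, abs_zero]; positivity
    · intro x z hxz
      by_cases hz : z ∈ ball (0 : Eu n) ρ
      · rw [indicator_of_mem (by simpa [hSd] using hz)]
        have : x ∉ ball (0 : Eu n) (r + 3 * ρ) := fun hx => hxz ⟨ball_subset_ball (by linarith) hx, hz⟩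
        simp only [hχ0 x z hz this, mul_zero, zero_mul]
      · rw [indicator_of_notMem (by simpa [hSd] using hz)]
  have I1 := hgen (fun q => U (q.1 + h + q.2) - U (q.1 + h)) (by fun_prop) (fun x z hx hz =>
    hδU (x + h) z (by rw [mem_ball_zero_iff] at *; exact (norm_add_le _ _).trans_lt (by linarith)) hz)
  have I2 := hgen (fun q => U (q.1 + q.2) - U q.1) (by fun_prop) (fun x z hx hz =>
    hδU x z (ball_subset_ball (by linarith) hx) hz)
  -- shift
  set G : Eu n × Eu n → ℝ := S.indicator (fun q => Jp p (U (q.1 + h + q.2) - U (q.1 + h)) * chiF η g q.1 q.2 * kz n s p q.2) with hG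
  set G' : Eu n × Eu n → ℝ := fun q => Jp p (U (q.1 + q.2) - U q.1) * chiF η g (q.1 - h) q.2 * kz n s p q.2 with hG'
  have hshift : ∀ q, S.indicator G' q = G (q - (h, 0)) := by
    intro q
    have : q ∈ S ↔ q - (h, 0) ∈ S := by simp [hSd]
    by_cases hq : q ∈ S
    · rw [hG, indicator_of_mem hq, indicator_of_mem (this.1 hq)]
      simp [hG']
    · rw [hG, indicator_of_notMem hq, indicator_of_notMem (fun h => hq (this.2 h))]
  have hGi : Integrable G (volume.prod volume) := (integrable_indicator_iff hSm).2 I1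
  have I1' : IntegrableOn G' S (volume.prod volume) := by
    rw [← integrable_indicator_iff hSm]
    have : S.indicator G' = fun q => G (q - (h, 0)) := funext hshift
    rw [this]
    exact hGi.comp_sub_right (h, 0)
  have hIe : ∫ q in S, G' q ∂(volume.prod volume) =
      ∫ q in S, Jp p (U (q.1 + h + q.2) - U (q.1 + h)) * chiF η g q.1 q.2 * kz n s p q.2 ∂(volume.prod volume) := by
    rw [← integral_indicator hSm, ← integral_indicator hSm]
    have : S.indicator G' = fun q => G (q - (h, 0)) := funext hshift
    rw [this]
    exact integral_sub_right_eq_self G (h, 0)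
  have hpt : ∀ q : Eu n × Eu n, Jp p (U (q.1 + q.2) - U q.1) *
      (eeF η g (q.1 - h) q.2 - eeF η g q.1 q.2) * kz n s p q.2 =
      Jker n p s U (phiF η g h) q - (G' q - Jp p (U (q.1 + q.2) - U q.1) * chiF η g q.1 q.2 * kz n s p q.2) := by
    intro q
    simp only [hG', Jker, phiF, chiF, eeF]
    rw [add_sub_right_comm]
    ring
  refine ⟨?_, ?_⟩
  · refine (I1.sub I2).congr (Filter.Eventually.of_forall fun q => ?_)
    simp only [Pi.sub_apply]; ring
  · have e1 : ∫ q in S, (Jp p (U (q.1 + h + q.2) - U (q.1 + h)) - Jp p (U (q.1 + q.2) - U q.1)) *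
      chiF η g q.1 q.2 * kz n s p q.2 ∂(volume.prod volume) = (∫ q in S, G' q ∂(volume.prod volume)) -
        ∫ q in S, Jp p (U (q.1 + q.2) - U q.1) * chiF η g q.1 q.2 * kz n s p q.2 ∂(volume.prod volume) := by
      rw [hIe, ← integral_sub I1 I2]
      congr 1; ext q; ring
    have e2 : (∫ q in S, Jker n p s U (phiF η g h) q ∂(volume.prod volume)) +
        ∫ q in univ ×ˢ (ball (0 : Eu n) ρ)ᶜ, Jker n p s U (phiF η g h) q ∂(volume.prod volume) =
        ∫ x in ball (0 : Eu n) 1, f x * phiF η g h x := by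
      rw [← hJe, ← integral_add_compl hSm hJi]
      congr 2
      simp [hSd, compl_prod_eq_union]
    rw [e1, ← e2]
    simp_rw [hpt]
    have I12 : IntegrableOn (fun q : Eu n × Eu n => G' q - Jp p (U (q.1 + q.2) - U q.1) * chiF η g q.1 q.2 * kz n s p q.2)
        S (volume.prod volume) := I1'.sub I2
    rw [integral_sub hJi.integrableOn I12, integral_sub I1' I2]
    ring




/-- total data -/
def Lam (n : ℕ) (p s : ℝ) (f U : Eu n → ℝ) : ℝ≥0∞ :=
  Nr n p 1 U + gagliardoE n s p (ball 0 1) U + TL n s p U ^ (p / (p - 1)) + Nr n (p / (p - 1)) 1 f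

lemma lint_ind {n : ℕ} {p R : ℝ} (hp : 0 < p) (g : Eu n → ℝ) :
    ∫⁻ x, ENNReal.ofReal ((ball (0 : Eu n) R).indicator (fun x => |g x|) x ^ p) = Nr n p R g := by
  unfold Nr
  rw [← lintegral_indicator measurableSet_ball]
  congr 1; ext x
  by_cases hx : x ∈ ball (0 : Eu n) R
  · simp [indicator_of_mem hx]
  · simp [indicator_of_notMem hx, Real.zero_rpow hp.ne']

lemma phi_bound {n : ℕ} {p : ℝ} (hp : 1 < p) {L : ℝ} (hL0 : 0 ≤ L) :
    ∃ C : ℝ, 0 < C ∧ ∀ (r ρ : ℝ) (U η : Eu n → ℝ) (h : Eu n), 0 < r → 0 < ρ → Cut n (r + 2 * ρ) L η → 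
      Measurable U → ‖h‖ ≤ ρ → 
      Nr n p 1 (phiF η (tau h U) h) ≤ ENNReal.ofReal C * (Nr n p (r + 4 * ρ) (tau h (tau h U)) +
        ENNReal.ofReal (‖h‖ ^ p) * Nr n p (r + 4 * ρ) (tau h U)) := by
  have hp0 : 0 < p := by linarith
  refine ⟨2 ^ p * (1 + L ^ p), by positivity, fun r ρ U η h hr hρ hη hU hh => ?_⟩
  set g := tau h U with hg
  have hgm : Measurable g := measurable_tau h hU
  have hg2 : Measurable (tau h g) := measurable_tau h hgm
  set t1 := (ball (0 : Eu n) (r + 4 * ρ)).indicator (fun x => |tau h g x|) with ht1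
  set t2 := (ball (0 : Eu n) (r + 4 * ρ)).indicator (fun x => |g x|) with ht2
  have hm1 : Measurable t1 := Measurable.indicator (by fun_prop) measurableSet_ball
  have hm2 : Measurable t2 := Measurable.indicator (by fun_prop) measurableSet_ball
  have n1 : ∀ x, 0 ≤ t1 x := fun x => indicator_nonneg (fun _ _ => abs_nonneg _) x
  have n2 : ∀ x, 0 ≤ t2 x := fun x => indicator_nonneg (fun _ _ => abs_nonneg _) x
  have key : ∀ x, |phiF η g h x| ≤ t1 (x - h) + L * ‖h‖ * t2 x := by
    intro x
    by_cases hx : x ∈ ball (0 : Eu n) (r + 3 * ρ)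
    · have h2 : t2 x = |g x| := indicator_of_mem (ball_subset_ball (by linarith) hx) _
      have h1 : t1 (x - h) = |tau h g (x - h)| := by
        refine indicator_of_mem ?_ _
        rw [mem_ball_zero_iff] at *
        exact (norm_sub_le _ _).trans_lt (by linarith)
      rw [h1, h2]
      have e : phiF η g h x = -(η (x - h) * tau h g (x - h)) + (η (x - h) - η x) * g x := by
        simp only [phiF, tau, sub_add_cancel]; ring
      rw [e]
      refine (abs_add_le _ _).trans ?_
      rw [abs_neg, abs_mul, abs_mul, abs_of_nonneg (hη.nn _)]
      have h3 := hη.lip (x - h) x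
      rw [sub_sub_cancel_left, norm_neg] at h3
      have h4 := mul_le_mul_of_nonneg_right (hη.le (x - h)) (abs_nonneg (tau h g (x - h)))
      have h5 := mul_le_mul_of_nonneg_right h3 (abs_nonneg (g x))
      linarith
    · rw [mem_ball_zero_iff, not_lt] at hx
      have h1 := norm_sub_norm_le x h
      rw [phiF, hη.z x (by rw [mem_ball_zero_iff]; linarith), hη.z (x - h) (by rw [mem_ball_zero_iff]; linarith)]
      simp only [zero_mul, sub_self, abs_zero]
      have := n1 (x - h); have := n2 x; positivity
  calc Nr n p 1 (phiF η g h) ≤ ∫⁻ x, ENNReal.ofReal (|phiF η g h x| ^ p) := setLIntegral_le_lintegral _ _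
    _ ≤ ∫⁻ x, ENNReal.ofReal (2 ^ p) * (ENNReal.ofReal (t1 (x - h) ^ p) + 
        ENNReal.ofReal (L ^ p * ‖h‖ ^ p) * ENNReal.ofReal (t2 x ^ p)) := by
        apply lintegral_mono; intro x; beta_reduce
        have a1 := n1 (x - h); have a2 := n2 x
        rw [← ENNReal.ofReal_mul (by positivity), ← ENNReal.ofReal_add (by positivity) (by positivity),
          ← ENNReal.ofReal_mul (by positivity)]
        apply ENNReal.ofReal_le_ofReal
        calc |phiF η g h x| ^ p ≤ (t1 (x - h) + L * ‖h‖ * t2 x) ^ p :=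
              Real.rpow_le_rpow (abs_nonneg _) (key x) hp0.le
          _ ≤ _ := add_rpow_le hp0.le a1 (by positivity)
          _ = _ := by rw [Real.mul_rpow (by positivity) a2, Real.mul_rpow hL0 (norm_nonneg _)]
    _ = ENNReal.ofReal (2 ^ p) * (Nr n p (r + 4 * ρ) (tau h g) + 
        ENNReal.ofReal (L ^ p * ‖h‖ ^ p) * Nr n p (r + 4 * ρ) g) := by
        rw [lintegral_const_mul' _ _ ENNReal.ofReal_ne_top, lintegral_add_left (by fun_prop),
          lintegral_const_mul' _ _ ENNReal.ofReal_ne_top, lint_ind hp0,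
          lintegral_sub_right_eq_self (fun x => ENNReal.ofReal (t1 x ^ p)) h, lint_ind hp0]
    _ ≤ _ := by
        rw [ENNReal.ofReal_mul (by positivity : (0:ℝ) ≤ 2 ^ p), ENNReal.ofReal_mul (by positivity : (0:ℝ) ≤ L ^ p), mul_assoc (ENNReal.ofReal (2 ^ p))]
        refine mul_le_mul' le_rfl ?_
        rw [mul_add, mul_assoc (ENNReal.ofReal (L ^ p))]
        refine add_le_add ?_ ?_
        · refine le_mul_of_one_le_left zero_le ?_
          rw [ENNReal.one_le_ofReal]; have : 0 ≤ L ^ p := by positivity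
          linarith
        · refine mul_le_mul' (ENNReal.ofReal_le_ofReal (by linarith)) le_rfl

lemma ee_bound {n : ℕ} {L r ρ : ℝ} {U η : Eu n → ℝ} {h : Eu n} (hr : 0 < r) (hρ : 0 < ρ)
    (hη : Cut n (r + 2 * ρ) L η)
    (hη2 : ∀ x z h : Eu n, |(η (x + z) - η x) - (η (x - h + z) - η (x - h))| ≤ L * ‖h‖ * ‖z‖)
    (hh : ‖h‖ ≤ ρ) (x z : Eu n) (hz : z ∈ ball (0 : Eu n) ρ) :
    (x ∉ ball (0 : Eu n) (r + 4 * ρ) → eeF η (tau h U) (x - h) z - eeF η (tau h U) x z = 0) ∧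
    |eeF η (tau h U) (x - h) z - eeF η (tau h U) x z| ≤ L * ‖z‖ *
      ((ball (0 : Eu n) (r + 4 * ρ)).indicator (fun x => |tau h (tau h U) x|) (x - h) +
       (ball (0 : Eu n) (r + 4 * ρ)).indicator (fun x => |tau h (tau h U) x|) (x + (z - h)) +
       ‖h‖ * ((ball (0 : Eu n) (r + 4 * ρ)).indicator (fun x => |tau h U x|) x +
        (ball (0 : Eu n) (r + 4 * ρ)).indicator (fun x => |tau h U x|) (x + z))) := by
  have hL := hη.L0
  set g := tau h U with hg
  have n1 : ∀ (w : Eu n → ℝ) x, 0 ≤ (ball (0 : Eu n) (r + 4 * ρ)).indicator (fun x => |w x|) x :=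
    fun w x => indicator_nonneg (fun _ _ => abs_nonneg _) x
  rw [mem_ball_zero_iff] at hz
  have a1 := norm_sub_norm_le x h
  have a2 := norm_sub_norm_le x (-z)
  rw [norm_neg, sub_neg_eq_add] at a2
  have a3 := norm_sub_norm_le (x - h) (-z)
  rw [norm_neg, sub_neg_eq_add] at a3
  have a4 := norm_sub_norm_le (x + z) h
  have e4 : x + z - h = x - h + z := by abel
  have e5 : x + (z - h) = x - h + z := by abel
  rw [e4] at a4
  have a5 := norm_add_le x z
  have a6 := norm_sub_le x h
  have a7 := norm_add_le (x - h) z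
  by_cases hbig : r + 2 * ρ ≤ ‖x‖ ∧ r + 2 * ρ ≤ ‖x - h‖ ∧ r + 2 * ρ ≤ ‖x + z‖ ∧ r + 2 * ρ ≤ ‖x - h + z‖
  · obtain ⟨b1, b2, b3, b4⟩ := hbig
    have hz0 : eeF η g (x - h) z - eeF η g x z = 0 := by
      rw [eeF, eeF, hη.z x (by simpa using b1), hη.z (x - h) (by simpa using b2),
        hη.z (x + z) (by simpa using b3), hη.z (x - h + z) (by simpa using b4)]
      ring
    refine ⟨fun _ => hz0, ?_⟩
    rw [hz0, abs_zero]
    have := n1 (tau h g) (x - h); have := n1 (tau h g) (x + (z - h))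
    have := n1 g x; have := n1 g (x + z)
    positivity
  · have hx : ‖x‖ < r + 4 * ρ := by
      by_contra hc
      rw [not_lt] at hc
      exact hbig ⟨by linarith, by linarith, by linarith, by linarith⟩
    have hxh : ‖x - h‖ < r + 4 * ρ := by
      by_contra hc
      rw [not_lt] at hc
      exact hbig ⟨by linarith, by linarith, by linarith, by linarith⟩
    have a8 := norm_sub_norm_le (x + z) z
    rw [add_sub_cancel_right] at a8
    have a9 := norm_sub_norm_le (x - h + z) z
    rw [add_sub_cancel_right] at a9
    have a10 : ‖x - h + z‖ - ‖h‖ ≤ ‖x + z‖ := by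
      have := norm_sub_norm_le (x - h + z) (-h)
      rwa [norm_neg, sub_neg_eq_add, show x - h + z + h = x + z by abel] at this
    have hxz : ‖x + z‖ < r + 4 * ρ := by
      by_contra hc
      rw [not_lt] at hc
      exact hbig ⟨by linarith, by linarith, by linarith, by linarith⟩
    have hxhz : ‖x - h + z‖ < r + 4 * ρ := by
      by_contra hc
      rw [not_lt] at hc
      exact hbig ⟨by linarith, by linarith, by linarith, by linarith⟩
    refine ⟨fun hc => absurd (by simpa using hx) hc, ?_⟩
    rw [e5, indicator_of_mem (by simpa using hxh), indicator_of_mem (by simpa using hxhz),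
      indicator_of_mem (by simpa using hx), indicator_of_mem (by simpa using hxz)]
    have f1 : tau h g (x - h) = g x - g (x - h) := by simp [tau]
    have f2 : tau h g (x - h + z) = g (x + z) - g (x - h + z) := by
      simp only [tau]; rw [show x - h + z + h = x + z by abel]
    rw [f1, f2]
    have e : eeF η g (x - h) z - eeF η g x z =
        -(((g x - g (x - h)) + (g (x + z) - g (x - h + z))) / 2 * (η (x - h + z) - η (x - h)))
        - (g x + g (x + z)) / 2 * ((η (x + z) - η x) - (η (x - h + z) - η (x - h))) := by
      simp only [eeF]; ring
    rw [e]
    refine (abs_sub _ _).trans ?_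
    rw [abs_neg, abs_mul, abs_mul, abs_div, abs_div, abs_two]
    have l1 := hη.lip (x - h + z) (x - h)
    rw [add_sub_cancel_left] at l1
    have l2 := hη2 x z h
    have m1 := abs_add_le (g x - g (x - h)) (g (x + z) - g (x - h + z))
    have m2 := abs_add_le (g x) (g (x + z))
    have q1 : |g x - g (x - h) + (g (x + z) - g (x - h + z))| / 2 ≤ |g x - g (x - h)| + |g (x + z) - g (x - h + z)| := by
      have := abs_nonneg (g x - g (x - h)); have := abs_nonneg (g (x + z) - g (x - h + z)); linarith
    have q2 : |g x + g (x + z)| / 2 ≤ |g x| + |g (x + z)| := by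
      have := abs_nonneg (g x); have := abs_nonneg (g (x + z)); linarith
    have r1 := mul_le_mul q1 l1 (abs_nonneg _) (by positivity)
    have r2 := mul_le_mul q2 l2 (abs_nonneg _) (by positivity)
    refine (add_le_add r1 r2).trans (le_of_eq ?_)
    ring

lemma ee_int {n : ℕ} (hn : 0 < n) {s p : ℝ} (hp : 1 < p) (hs : 0 < s) (hs1 : s < 1) {L r ρ : ℝ}
    (hr : 0 < r) (hρ : 0 < ρ) (hρ1 : ρ ≤ 1) (hL0 : 0 ≤ L) :
    ∃ C : ℝ, 0 < C ∧ ∀ (U η : Eu n → ℝ) (h : Eu n), Cut n (r + 2 * ρ) L η → 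
    (∀ x z h : Eu n, |(η (x + z) - η x) - (η (x - h + z) - η (x - h))| ≤ L * ‖h‖ * ‖z‖) →
    Measurable U → ‖h‖ ≤ ρ → 
    ∫⁻ z in ball (0 : Eu n) ρ, ∫⁻ x, ENNReal.ofReal (|eeF η (tau h U) (x - h) z - eeF η (tau h U) x z| ^ p * kz n s p z)
      ≤ ENNReal.ofReal C * (Nr n p (r + 4 * ρ) (tau h (tau h U)) +
        ENNReal.ofReal (‖h‖ ^ p) * Nr n p (r + 4 * ρ) (tau h U)) := by
  have hp0 : 0 < p := by linarith
  have hsp : 0 < s * p := by positivity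
  have hspp : s * p < p := by nlinarith
  obtain ⟨C1, hC1, hk⟩ := knear (n := n) hn hsp hspp hρ1
  refine ⟨4 ^ p * (L ^ p + 1) * 2 * C1, by positivity, fun U η h hη hη2 hU hh => ?_⟩
  set g := tau h U with hg
  have hgm : Measurable g := measurable_tau h hU
  have hg2 : Measurable (tau h g) := measurable_tau h hgm
  set t1 := (ball (0 : Eu n) (r + 4 * ρ)).indicator (fun x => |tau h g x|) with ht1
  set t2 := (ball (0 : Eu n) (r + 4 * ρ)).indicator (fun x => |g x|) with ht2
  have hm1 : Measurable t1 := Measurable.indicator (by fun_prop) measurableSet_ball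
  have hm2 : Measurable t2 := Measurable.indicator (by fun_prop) measurableSet_ball
  have n1 : ∀ x, 0 ≤ t1 x := fun x => indicator_nonneg (fun _ _ => abs_nonneg _) x
  have n2 : ∀ x, 0 ≤ t2 x := fun x => indicator_nonneg (fun _ _ => abs_nonneg _) x
  set N := (Nr n p (r + 4 * ρ) (tau h g) + ENNReal.ofReal (‖h‖ ^ p) * Nr n p (r + 4 * ρ) g) with hN
  calc _ ≤ ∫⁻ z in ball (0 : Eu n) ρ, ∫⁻ x, ENNReal.ofReal (4 ^ p * L ^ p * (‖z‖ ^ p * kz n s p z)) *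
        ((ENNReal.ofReal (t1 (x - h) ^ p) + ENNReal.ofReal (t1 (x + (z - h)) ^ p)) + ENNReal.ofReal (‖h‖ ^ p) *
          (ENNReal.ofReal (t2 x ^ p) + ENNReal.ofReal (t2 (x + z) ^ p))) := by
        refine setLIntegral_mono' measurableSet_ball fun z hz => ?_
        apply lintegral_mono; intro x; beta_reduce
        have k0 := kz_nonneg (n := n) (s := s) (p := p) z
        have a1 := n1 (x - h); have a2 := n2 x; have a3 := n1 (x + (z - h)); have a4 := n2 (x + z)
        rw [← ENNReal.ofReal_add (by positivity) (by positivity), ← ENNReal.ofReal_add (by positivity) (by positivity),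
          ← ENNReal.ofReal_mul (by positivity), ← ENNReal.ofReal_add (by positivity) (by positivity), 
          ← ENNReal.ofReal_mul (by positivity)]
        apply ENNReal.ofReal_le_ofReal
        have hb := (ee_bound (U := U) hr hρ hη hη2 hh x z hz).2
        have hb' := Real.rpow_le_rpow (abs_nonneg _) hb hp0.le
        rw [Real.mul_rpow (by positivity) (by positivity), Real.mul_rpow hL0 (norm_nonneg _)] at hb'
        have c1 : (t1 (x - h) + t1 (x + (z - h)) + ‖h‖ * (t2 x + t2 (x + z))) ^ p ≤
            4 ^ p * ((t1 (x - h) ^ p + t1 (x + (z - h)) ^ p) + ‖h‖ ^ p * (t2 x ^ p + t2 (x + z) ^ p)) := by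
          have d1 := add_rpow_le hp0.le (add_nonneg a1 a3) (mul_nonneg (norm_nonneg h) (add_nonneg a2 a4))
          have d2 := add_rpow_le hp0.le a1 a3
          have d3 := add_rpow_le hp0.le a2 a4
          rw [Real.mul_rpow (norm_nonneg _) (by positivity)] at d1
          have d4 : (4:ℝ) ^ p = 2 ^ p * 2 ^ p := by
            rw [← Real.mul_rpow (by norm_num) (by norm_num)]; norm_num
          calc _ ≤ _ := d1
            _ ≤ 2 ^ p * (2 ^ p * (t1 (x - h) ^ p + t1 (x + (z - h)) ^ p) + ‖h‖ ^ p * (2 ^ p * (t2 x ^ p + t2 (x + z) ^ p))) := by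
                gcongr
            _ = _ := by rw [d4]; ring
        calc _ ≤ (L ^ p * ‖z‖ ^ p * (4 ^ p * ((t1 (x - h) ^ p + t1 (x + (z - h)) ^ p) + ‖h‖ ^ p * (t2 x ^ p + t2 (x + z) ^ p))))
              * kz n s p z := by
              refine mul_le_mul_of_nonneg_right (hb'.trans ?_) k0
              exact mul_le_mul_of_nonneg_left c1 (by positivity)
          _ = _ := by ring
    _ = ∫⁻ z in ball (0 : Eu n) ρ, ENNReal.ofReal (4 ^ p * L ^ p * 2) * N * ENNReal.ofReal (‖z‖ ^ p * kz n s p z) := by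
        congr 1; ext z
        have k0 := kz_nonneg (n := n) (s := s) (p := p) z
        rw [lintegral_const_mul' _ _ ENNReal.ofReal_ne_top, lintegral_add_left (by fun_prop), lintegral_add_left (by fun_prop),
          lintegral_const_mul' _ _ ENNReal.ofReal_ne_top, lintegral_add_left (by fun_prop), lint_ind hp0,
          lintegral_sub_right_eq_self (fun x => ENNReal.ofReal (t1 x ^ p)) h,
          lintegral_add_right_eq_self (fun x => ENNReal.ofReal (t1 x ^ p)) (z - h),
          lintegral_add_right_eq_self (fun x => ENNReal.ofReal (t2 x ^ p)) z, lint_ind hp0, lint_ind hp0, ← two_mul, ← two_mul,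
          hN, ENNReal.ofReal_mul (by positivity), ENNReal.ofReal_mul (by positivity : (0:ℝ) ≤ 4 ^ p * L ^ p)]
        simp only [ENNReal.ofReal_ofNat]
        ring
    _ = ENNReal.ofReal (4 ^ p * L ^ p * 2) * N * ∫⁻ z in ball (0 : Eu n) ρ, ENNReal.ofReal (‖z‖ ^ p * kz n s p z) := by
        rw [lintegral_const_mul _ (by fun_prop)]
    _ ≤ ENNReal.ofReal (4 ^ p * (L ^ p + 1) * 2) * N * ENNReal.ofReal C1 := by
        refine mul_le_mul' (mul_le_mul' (ENNReal.ofReal_le_ofReal ?_) le_rfl) hk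
        gcongr; linarith
    _ = _ := by
        rw [mul_right_comm, ← ENNReal.ofReal_mul (by positivity)]

lemma KE {n : ℕ} (hn : 0 < n) {s p : ℝ} (hp : 1 < p) (hs : 0 < s) (hs1 : s < 1) {r ρ : ℝ}
    (hr : 0 < r) (hρ : 0 < ρ) (hrρ : r + 8 * ρ ≤ 1) :
    ∃ C : ℝ, 0 < C ∧ ∀ (f U : Eu n → ℝ), Sol n p s f U → ∀ h : Eu n, ‖h‖ ≤ ρ → ∀ μ : ℝ, 0 < μ →
    ∫⁻ z in ball (0 : Eu n) ρ, ∫⁻ x in ball (0 : Eu n) r,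
      ENNReal.ofReal ((Jp p (U (x + h + z) - U (x + h)) - Jp p (U (x + z) - U x)) *
        (tau h U (x + z) - tau h U x) * kz n s p z) ≤
    ENNReal.ofReal C * (ENNReal.ofReal μ * Lam n p s f U + ENNReal.ofReal (μ ^ (1 - p)) *
      (Nr n p (r + 4 * ρ) (tau h (tau h U)) + ENNReal.ofReal (‖h‖ ^ p) * Nr n p (r + 4 * ρ) (tau h U))) := by
  have hp0 : 0 < p := by linarith
  have hp1 : 0 < p - 1 := by linarith
  have hsp : 0 < s * p := by positivity
  obtain ⟨η, L, hη, hη1, hη2⟩ := cutoff_exists (n := n) (by linarith : 0 < r + ρ) hρ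
  rw [show r + ρ + ρ = r + 2 * ρ by ring] at hη
  obtain ⟨C1, hC1, hA1⟩ := phi_bound (n := n) hp hη.L0
  obtain ⟨C2, hC2, hA2⟩ := ee_int hn hp hs hs1 hr hρ (by linarith) hη.L0
  obtain ⟨C3, hC3, hA3⟩ := jker_far hn hp hsp hρ
  refine ⟨(1 + C1) + C3 * (1 + C1) + (1 + C2), by positivity, fun f U hS h hh μ hμ => ?_⟩
  obtain ⟨hI, hE⟩ := KE_ident hn hp hs hs1 hS hr hρ hrρ hη hh
  have hUm := hS.mU
  have hJm := measurable_Jp p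
  have hηm := hη.m
  set g := tau h U with hg
  have hgm : Measurable g := measurable_tau h hUm
  set N := (Nr n p (r + 4 * ρ) (tau h g) + ENNReal.ofReal (‖h‖ ^ p) * Nr n p (r + 4 * ρ) g) with hN
  set Λ := Lam n p s f U with hΛ
  set m := ENNReal.ofReal μ
  set m' := ENNReal.ofReal (μ ^ (1 - p))
  have hφm : Measurable (phiF η g h) := by unfold phiF; fun_prop
  have hNφ := hA1 r ρ U η h hr hρ hη hUm hh
  have hφ0 : ∀ x, x ∉ ball (0 : Eu n) 1 → phiF η g h x = 0 := by
    intro x hx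
    rw [mem_ball_zero_iff, not_lt] at hx
    have h1 := norm_sub_norm_le x h
    rw [phiF, hη.z x (by rw [mem_ball_zero_iff]; linarith), hη.z (x - h) (by rw [mem_ball_zero_iff]; linarith)]
    ring
  set S : Set (Eu n × Eu n) := univ ×ˢ ball (0 : Eu n) ρ with hSd
  have hnorm : ∀ {X : Type} [MeasurableSpace X] (ν : Measure X) (G : X → ℝ),
      ENNReal.ofReal |∫ q, G q ∂ν| ≤ ∫⁻ q, ENNReal.ofReal |G q| ∂ν := by
    intro X _ ν G
    have := enorm_integral_le_lintegral_enorm (μ := ν) G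
    simpa only [Real.enorm_eq_ofReal_abs] using this
  -- T1
  have T1 : ENNReal.ofReal |∫ x in ball (0 : Eu n) 1, f x * phiF η g h x| ≤ m * Λ + m' * (ENNReal.ofReal C1 * N) := by
    refine (hnorm _ _).trans ?_
    calc _ ≤ ∫⁻ x in ball (0 : Eu n) 1, (m * ENNReal.ofReal (|f x| ^ (p / (p - 1))) + m' * ENNReal.ofReal (|phiF η g h x| ^ p)) := by
          apply lintegral_mono; intro x; beta_reduce
          rw [← ENNReal.ofReal_mul (by positivity), ← ENNReal.ofReal_mul (by positivity),
            ← ENNReal.ofReal_add (by positivity) (by positivity), abs_mul]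
          exact ENNReal.ofReal_le_ofReal (young_conj hp (abs_nonneg _) (abs_nonneg _) hμ)
      _ = m * Nr n (p / (p - 1)) 1 f + m' * Nr n p 1 (phiF η g h) := by
          have := hS.mf
          rw [lintegral_add_left (by fun_prop), lintegral_const_mul' _ _ ENNReal.ofReal_ne_top,
            lintegral_const_mul' _ _ ENNReal.ofReal_ne_top]; rfl
      _ ≤ _ := by
          refine add_le_add (mul_le_mul' le_rfl ?_) (mul_le_mul' le_rfl hNφ)
          rw [hΛ, Lam]; exact le_add_self
  have T2 : ENNReal.ofReal |∫ q in univ ×ˢ (ball (0 : Eu n) ρ)ᶜ, Jker n p s U (phiF η g h) q ∂(volume.prod volume)| ≤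
      ENNReal.ofReal C3 * (m * Λ + m' * (ENNReal.ofReal C1 * N)) := by
    refine (hnorm _ _).trans ((hA3 U _ hUm hφm hφ0 μ hμ).trans ?_)
    refine mul_le_mul' le_rfl (add_le_add (mul_le_mul' le_rfl ?_) (mul_le_mul' le_rfl hNφ))
    rw [hΛ, Lam]
    calc _ ≤ Nr n p 1 U + gagliardoE n s p (ball 0 1) U + TL n s p U ^ (p / (p - 1)) := by
          gcongr; exact le_self_add
      _ ≤ _ := le_self_add
  have T3 : ENNReal.ofReal |∫ q in S, Jp p (U (q.1 + q.2) - U q.1) *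
      (eeF η g (q.1 - h) q.2 - eeF η g q.1 q.2) * kz n s p q.2 ∂(volume.prod volume)| ≤
      m * Λ + m' * (ENNReal.ofReal C2 * N) := by
    refine (hnorm _ _).trans ?_
    have hee : Measurable (fun q : Eu n × Eu n => eeF η g (q.1 - h) q.2 - eeF η g q.1 q.2) := by
      unfold eeF; fun_prop
    rw [hSd, ← Measure.prod_restrict, Measure.restrict_univ, lintegral_prod_symm _ (by fun_prop)]
    calc _ ≤ ∫⁻ z in ball (0 : Eu n) ρ, ((∫⁻ x in ball (0 : Eu n) (r + 4 * ρ), m * ENNReal.ofReal (|U (x + z) - U x| ^ p * kz n s p z))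
          + ∫⁻ x, m' * ENNReal.ofReal (|eeF η g (x - h) z - eeF η g x z| ^ p * kz n s p z)) := by
          refine setLIntegral_mono' measurableSet_ball fun z hz => ?_
          have k0 := kz_nonneg (n := n) (s := s) (p := p) z
          rw [← lintegral_indicator measurableSet_ball, ← lintegral_add_left (by
            refine Measurable.indicator ?_ measurableSet_ball; fun_prop)]
          apply lintegral_mono; intro x; beta_reduce
          by_cases hx : x ∈ ball (0 : Eu n) (r + 4 * ρ)
          · rw [indicator_of_mem hx, ← ENNReal.ofReal_mul (by positivity), ← ENNReal.ofReal_mul (by positivity),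
              ← ENNReal.ofReal_add (by positivity) (by positivity), abs_mul, abs_mul, abs_Jp hp, abs_of_nonneg k0]
            apply ENNReal.ofReal_le_ofReal
            have := mul_le_mul_of_nonneg_right (young_p hp (abs_nonneg (U (x + z) - U x)) (abs_nonneg (eeF η g (x - h) z - eeF η g x z)) hμ) k0
            refine this.trans (le_of_eq ?_)
            ring
          · rw [(ee_bound (U := U) hr hρ hη hη2 hh x z hz).1 hx]
            simp
      _ = m * D2 n p (s * p) (r + 4 * ρ) ρ U + m' * ∫⁻ z in ball (0 : Eu n) ρ, ∫⁻ x,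
          ENNReal.ofReal (|eeF η g (x - h) z - eeF η g x z| ^ p * kz n s p z) := by
          have hm1 : m ≠ ⊤ := ENNReal.ofReal_ne_top
          have hm2 : m' ≠ ⊤ := ENNReal.ofReal_ne_top
          simp_rw [lintegral_const_mul' _ _ hm1, lintegral_const_mul' _ _ hm2]
          rw [lintegral_add_left, lintegral_const_mul' _ _ hm1, lintegral_const_mul' _ _ hm2]
          · rfl
          · refine Measurable.const_mul ?_ _
            refine Measurable.lintegral_prod_right' (f := fun q : Eu n × Eu n => ENNReal.ofReal (|U (q.2 + q.1) - U q.2| ^ p * kz n s p q.1)) ?_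
            fun_prop
      _ ≤ _ := by
          refine add_le_add (mul_le_mul' le_rfl ?_) (mul_le_mul' le_rfl (hA2 U η h hη hη2 hUm hh))
          refine (D2_le_gag hUm (by linarith : r + 4 * ρ + ρ ≤ 1) (by linarith)).trans ?_
          rw [hΛ, Lam]
          exact le_add_self.trans (le_self_add.trans le_self_add)
  -- lower bound
  have hnn : ∀ q : Eu n × Eu n, 0 ≤ (Jp p (U (q.1 + h + q.2) - U (q.1 + h)) - Jp p (U (q.1 + q.2) - U q.1)) *
      chiF η g q.1 q.2 * kz n s p q.2 := by
    intro q
    have e : g (q.1 + q.2) - g q.1 = (U (q.1 + h + q.2) - U (q.1 + h)) - (U (q.1 + q.2) - U q.1) := by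
      simp only [hg, tau]; rw [add_right_comm]; ring
    refine mul_nonneg ?_ (kz_nonneg _)
    rw [chiF, e]
    have := Q_nonneg hp (U (q.1 + h + q.2) - U (q.1 + h)) (U (q.1 + q.2) - U q.1)
    have h2 : 0 ≤ (η q.1 + η (q.1 + q.2)) / 2 := by have := hη.nn q.1; have := hη.nn (q.1 + q.2); linarith
    have := mul_nonneg h2 this
    linarith
  have hlow : ∫⁻ z in ball (0 : Eu n) ρ, ∫⁻ x in ball (0 : Eu n) r,
      ENNReal.ofReal ((Jp p (U (x + h + z) - U (x + h)) - Jp p (U (x + z) - U x)) *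
        (g (x + z) - g x) * kz n s p z) ≤ ENNReal.ofReal (∫ q in S, (Jp p (U (q.1 + h + q.2) - U (q.1 + h)) - Jp p (U (q.1 + q.2) - U q.1)) *
      chiF η g q.1 q.2 * kz n s p q.2 ∂(volume.prod volume)) := by
    rw [ofReal_integral_eq_lintegral_ofReal hI (Filter.Eventually.of_forall hnn)]
    have hχm : Measurable (fun q : Eu n × Eu n => chiF η g q.1 q.2) := by unfold chiF; fun_prop
    rw [hSd, ← Measure.prod_restrict, Measure.restrict_univ, lintegral_prod_symm _ (by fun_prop)]
    refine setLIntegral_mono' measurableSet_ball fun z hz => ?_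
    refine le_trans ?_ (setLIntegral_le_lintegral (ball (0 : Eu n) r) _)
    refine setLIntegral_mono' measurableSet_ball fun x hx => ?_
    rw [mem_ball_zero_iff] at hx hz
    simp only [chiF]
    rw [hη1 x (by rw [mem_ball_zero_iff]; linarith), hη1 (x + z) (by
      rw [mem_ball_zero_iff]; exact (norm_add_le _ _).trans_lt (by linarith))]
    apply le_of_eq; congr 1; ring
  refine hlow.trans ?_
  rw [hE]
  set X1 := ∫ x in ball (0 : Eu n) 1, f x * phiF η g h x
  set X2 := ∫ q in univ ×ˢ (ball (0 : Eu n) ρ)ᶜ, Jker n p s U (phiF η g h) q ∂(volume.prod volume)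
  set X3 := ∫ q in S, Jp p (U (q.1 + q.2) - U q.1) *
      (eeF η g (q.1 - h) q.2 - eeF η g q.1 q.2) * kz n s p q.2 ∂(volume.prod volume)
  have hX : X1 - X2 - X3 ≤ |X1| + |X2| + |X3| := by
    have := le_abs_self X1; have := neg_abs_le X2; have := neg_abs_le X3; linarith
  refine (ENNReal.ofReal_le_ofReal hX).trans ?_
  rw [ENNReal.ofReal_add (by positivity) (by positivity), ENNReal.ofReal_add (by positivity) (by positivity)]
  refine (add_le_add (add_le_add T1 T2) T3).trans ?_
  have gen : ∀ C : ℝ, 0 < C → m * Λ + m' * (ENNReal.ofReal C * N) ≤ ENNReal.ofReal (1 + C) * (m * Λ + m' * N) := by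
    intro C hC
    rw [ENNReal.ofReal_add (by norm_num) hC.le, ENNReal.ofReal_one]
    calc m * Λ + m' * (ENNReal.ofReal C * N) ≤ (m * Λ + m' * (ENNReal.ofReal C * N)) + (m' * N + ENNReal.ofReal C * (m * Λ)) := le_self_add
      _ = _ := by ring
  rw [ENNReal.ofReal_add (by positivity) (by positivity), ENNReal.ofReal_add (by positivity) (by positivity),
    ENNReal.ofReal_mul hC3.le, add_mul, add_mul, mul_assoc]
  exact add_le_add (add_le_add (gen C1 hC1) (mul_le_mul' le_rfl (gen C1 hC1))) (gen C2 hC2)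




/-- second differences -/
def PP (n : ℕ) (p s γ : ℝ) : Prop := ∀ r : ℝ, 0 < r → r < 1 → ∃ C : ℝ, 0 < C ∧ ∃ h0 : ℝ, 0 < h0 ∧
  ∀ f U : Eu n → ℝ, Sol n p s f U → ∀ h : Eu n, h ≠ 0 → ‖h‖ ≤ h0 →
    Nr n p r (tau h (tau h U)) ≤ ENNReal.ofReal (C * ‖h‖ ^ (γ * p)) * Lam n p s f U

/-- first differences -/
def PQ (n : ℕ) (p s γ : ℝ) : Prop := ∀ r : ℝ, 0 < r → r < 1 → ∃ C : ℝ, 0 < C ∧ ∃ h0 : ℝ, 0 < h0 ∧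
  ∀ f U : Eu n → ℝ, Sol n p s f U → ∀ h : Eu n, h ≠ 0 → ‖h‖ ≤ h0 →
    Nr n p r (tau h U) ≤ ENNReal.ofReal (C * ‖h‖ ^ (γ * p)) * Lam n p s f U

lemma PP_mono {n : ℕ} {p s γ γ' : ℝ} (hp : 0 < p) (h : PP n p s γ) (hγ : γ' ≤ γ) : PP n p s γ' := by
  intro r hr hr1
  obtain ⟨C, hC, h0, hh0, H⟩ := h r hr hr1
  refine ⟨C, hC, min h0 1, lt_min hh0 one_pos, fun f U hU h hne hh => ?_⟩
  refine (H f U hU h hne (hh.trans (min_le_left _ _))).trans ?_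
  refine mul_le_mul' (ENNReal.ofReal_le_ofReal ?_) le_rfl
  refine mul_le_mul_of_nonneg_left ?_ hC.le
  exact Real.rpow_le_rpow_of_exponent_ge (norm_pos_iff.mpr hne) (hh.trans (min_le_right _ _))
    (mul_le_mul_of_nonneg_right hγ hp.le)

lemma gag_le_Lam {n : ℕ} {p s : ℝ} (f U : Eu n → ℝ) : gagliardoE n s p (ball 0 1) U ≤ Lam n p s f U :=
  le_add_self.trans (le_self_add.trans le_self_add)

lemma Nr_le_Lam {n : ℕ} {p s : ℝ} (f U : Eu n → ℝ) : Nr n p 1 U ≤ Lam n p s f U :=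
  le_self_add.trans (le_self_add.trans le_self_add)

lemma Nr_sub_le {n : ℕ} {p r : ℝ} (hp : 0 ≤ p) {g1 g2 : Eu n → ℝ} (h1 : Measurable g1) :
    Nr n p r (fun x => g1 x - g2 x) ≤ ENNReal.ofReal (2 ^ p) * (Nr n p r g1 + Nr n p r g2) := by
  unfold Nr
  rw [← lintegral_add_left (by fun_prop), ← lintegral_const_mul' _ _ ENNReal.ofReal_ne_top]
  refine lintegral_mono fun x => ?_
  rw [← ENNReal.ofReal_add (by positivity) (by positivity), ← ENNReal.ofReal_mul (by positivity)]
  exact ENNReal.ofReal_le_ofReal (abs_sub_rpow_le hp _ _)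

lemma Nr_tau_le {n : ℕ} {p r r' : ℝ} (hp : 0 ≤ p) {g : Eu n → ℝ} (hg : Measurable g) (h : Eu n)
    (hr : r + ‖h‖ ≤ r') :
    Nr n p r (tau h g) ≤ ENNReal.ofReal (2 * 2 ^ p) * Nr n p r' g := by
  unfold tau
  refine (Nr_sub_le hp (by fun_prop : Measurable fun x => g (x + h))).trans ?_
  have a1 : Nr n p r (fun x => g (x + h)) ≤ Nr n p r' g :=
    setlint_shift_le (fun x => ENNReal.ofReal (|g x| ^ p)) h hr
  have a2 : Nr n p r g ≤ Nr n p r' g := Nr_mono g (by have := norm_nonneg h; linarith)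
  calc _ ≤ ENNReal.ofReal (2 ^ p) * (Nr n p r' g + Nr n p r' g) := by gcongr
    _ = _ := by
      rw [ENNReal.ofReal_mul (by norm_num), ENNReal.ofReal_ofNat]; ring

lemma PQ_start {n : ℕ} {p s : ℝ} (hp : 1 < p) (hs : 0 < s) : PQ n p s s := by
  intro r hr hr1
  obtain ⟨C, hC, H⟩ := nikolskii (n := n) (by linarith : 0 < p) (by positivity : 0 < s * p)
  refine ⟨C, hC, (1 - r) / 3, by linarith, fun f U hU h hne hh => ?_⟩
  refine (H r U hU.mU h hne).trans (mul_le_mul' le_rfl ?_)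
  exact (D2_le_gag hU.mU (by linarith) (by linarith)).trans (gag_le_Lam f U)

lemma PP_start {n : ℕ} {p s : ℝ} (hp : 1 < p) (hs : 0 < s) : PP n p s s := by
  intro r hr hr1
  obtain ⟨C, hC, h0, hh0, H⟩ := PQ_start (n := n) hp hs ((1 + r) / 2) (by linarith) (by linarith)
  refine ⟨2 * 2 ^ p * C, by positivity, min h0 ((1 - r) / 2), lt_min hh0 (by linarith), fun f U hU h hne hh => ?_⟩
  refine (Nr_tau_le (by linarith) (measurable_tau h hU.mU) h (r' := (1 + r) / 2) ?_).trans ?_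
  · have := hh.trans (min_le_right _ _); linarith
  · refine (mul_le_mul' le_rfl (H f U hU h hne (hh.trans (min_le_left _ _)))).trans (le_of_eq ?_)
    rw [← mul_assoc, ← ENNReal.ofReal_mul (by positivity)]
    congr 2; ring

/-- weighted convexity -/
lemma conv_rpow {p : ℝ} (hp : 1 < p) {q : ℝ} (hq : 1 < q) : ∃ C : ℝ, 0 < C ∧ ∀ a b : ℝ,
    |a - b| ^ p ≤ q * |a| ^ p + C * |b| ^ p := by
  have hp1 : 0 < p - 1 := by linarith
  set t : ℝ := q ^ (-(1 / (p - 1))) with ht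
  have ht0 : 0 < t := by positivity
  have ht1 : t < 1 := Real.rpow_lt_one_of_one_lt_of_neg hq (by rw [neg_lt_zero]; positivity)
  have htq : t * (1 / t) ^ p = q := by
    have : (1 / t) = q ^ (1 / (p - 1)) := by rw [ht, Real.rpow_neg (by linarith)]; simp
    rw [this, ht, ← Real.rpow_mul (by linarith), ← Real.rpow_add (by linarith)]
    conv_rhs => rw [← Real.rpow_one q]
    congr 1; field_simp; ring
  have h1t : 0 < 1 - t := by linarith
  refine ⟨(1 - t) * (1 / (1 - t)) ^ p, by positivity, fun a b => ?_⟩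
  have m1 : 1 / t * |a| ∈ Ici (0:ℝ) := by rw [mem_Ici]; positivity
  have m2 : 1 / (1 - t) * |b| ∈ Ici (0:ℝ) := by rw [mem_Ici]; positivity
  have h := (convexOn_rpow hp.le).2 m1 m2 ht0.le h1t.le (by ring)
  simp only [smul_eq_mul] at h
  rw [Real.mul_rpow (by positivity) (abs_nonneg _), Real.mul_rpow (by positivity) (abs_nonneg _),
    ← mul_assoc, ← mul_assoc, ← mul_assoc, ← mul_assoc, htq, mul_one_div_cancel ht0.ne',
    mul_one_div_cancel h1t.ne', one_mul, one_mul] at h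
  refine le_trans (Real.rpow_le_rpow (abs_nonneg _) (abs_sub a b) (by linarith)) h

lemma marchaud {n : ℕ} {p s γ : ℝ} (hp : 1 < p) (hγ : 0 < γ) (hγ1 : γ < 1) (H : PP n p s γ) :
    PQ n p s γ := by
  intro r hr hr1
  have hp0 : 0 < p := by linarith
  obtain ⟨C, hC, h0', hh0', HC⟩ := H r hr hr1
  set h0 := min h0' ((1 - r) / 2) with hh0d
  have hh0 : 0 < h0 := lt_min hh0' (by linarith)
  -- choose `q`
  set q1 : ℝ := 2 ^ ((1 - γ) * p / 2) with hq1
  have hq1' : 1 < q1 := Real.one_lt_rpow (by norm_num) (by have : 0 < 1 - γ := by linarith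
                                                           positivity)
  obtain ⟨C1, hC1, hconv⟩ := conv_rpow hp hq1'
  set q : ℝ := q1⁻¹ with hq
  have hq0 : 0 < q := by positivity
  have hql : q < 1 := inv_lt_one_of_one_lt₀ hq1'
  have hqq : (1 / 2) ^ p * q1 * 2 ^ (γ * p) = q := by
    rw [hq, hq1, one_div, Real.inv_rpow (by norm_num), ← Real.rpow_neg (by norm_num), ← Real.rpow_neg (by norm_num),
      ← Real.rpow_add (by norm_num), ← Real.rpow_add (by norm_num)]
    congr 1; ring
  set A := max (2 * 2 ^ p * (h0 / 2) ^ (-(γ * p))) ((1 / 2) ^ p * C1 * C / (1 - q)) with hA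
  have hA0 : 0 < A := lt_max_of_lt_left (by positivity)
  refine ⟨A, hA0, h0, hh0, ?_⟩
  intro f U hU
  set Λ := Lam n p s f U
  have rec1 : ∀ h : Eu n, h ≠ 0 → ‖h‖ ≤ h0 → Nr n p r (tau h U) ≤
      ENNReal.ofReal ((1 / 2) ^ p * q1) * Nr n p r (tau (2 • h) U) + 
      ENNReal.ofReal ((1 / 2) ^ p * C1) * Nr n p r (tau h (tau h U)) := by
    intro h hne hh
    unfold Nr
    have hm := measurable_tau (2 • h) hU.mU
    rw [← lintegral_const_mul' _ _ ENNReal.ofReal_ne_top, ← lintegral_const_mul' _ _ ENNReal.ofReal_ne_top,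
      ← lintegral_add_left (by fun_prop)]
    refine lintegral_mono fun x => ?_
    rw [← ENNReal.ofReal_mul (by positivity), ← ENNReal.ofReal_mul (by positivity),
      ← ENNReal.ofReal_add (by positivity) (by positivity)]
    apply ENNReal.ofReal_le_ofReal
    have e : tau h U x = 1 / 2 * (tau (2 • h) U x - tau h (tau h U) x) := by
      simp only [tau, two_smul, add_assoc]; ring
    rw [e, abs_mul, abs_of_nonneg (by norm_num : (0:ℝ) ≤ 1 / 2), Real.mul_rpow (by norm_num) (abs_nonneg _)]
    have := mul_le_mul_of_nonneg_left (hconv (tau (2 • h) U x) (tau h (tau h U) x)) (by positivity : (0:ℝ) ≤ (1 / 2) ^ p)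
    refine this.trans (le_of_eq ?_)
    ring
  have base : ∀ h : Eu n, h0 / 2 ≤ ‖h‖ → ‖h‖ ≤ h0 → Nr n p r (tau h U) ≤ ENNReal.ofReal (A * ‖h‖ ^ (γ * p)) * Λ := by
    intro h hl hh
    refine (Nr_tau_le hp0.le hU.mU h (r' := 1) ?_).trans ?_
    · have := hh.trans (min_le_right _ _); linarith
    · refine mul_le_mul' (ENNReal.ofReal_le_ofReal ?_) (Nr_le_Lam f U)
      have : (h0 / 2) ^ (γ * p) ≤ ‖h‖ ^ (γ * p) := Real.rpow_le_rpow (by positivity) hl (by positivity)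
      calc 2 * 2 ^ p = 2 * 2 ^ p * (h0 / 2) ^ (-(γ * p)) * (h0 / 2) ^ (γ * p) := by
            rw [mul_assoc (2 * 2 ^ p), ← Real.rpow_add (by positivity)]; simp
        _ ≤ A * ‖h‖ ^ (γ * p) := by
            refine mul_le_mul (le_max_left _ _) this (by positivity) hA0.le
  have ind : ∀ k : ℕ, ∀ h : Eu n, h0 / 2 ^ (k + 1) ≤ ‖h‖ → ‖h‖ ≤ h0 →
      Nr n p r (tau h U) ≤ ENNReal.ofReal (A * ‖h‖ ^ (γ * p)) * Λ := by
    intro k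
    induction k with
    | zero => intro h hl hh; exact base h (by simpa using hl) hh
    | succ k ih =>
      intro h hl hh
      rcases le_or_gt (h0 / 2) ‖h‖ with hc | hc
      · exact base h hc hh
      have hpos : 0 < ‖h‖ := lt_of_lt_of_le (by positivity) hl
      have hne : h ≠ 0 := norm_pos_iff.mp hpos
      have n2 : ‖2 • h‖ = 2 * ‖h‖ := by
        rw [two_smul, ← two_smul ℝ h, norm_smul]; norm_num
      have h1 := ih (2 • h) (by rw [n2]; rw [pow_succ, ← div_div, div_le_iff₀ (by norm_num)] at hl; linarith) (by rw [n2]; linarith)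
      have h2 := HC f U hU h hne (hh.trans (min_le_left _ _))
      refine (rec1 h hne hh).trans ?_
      refine (add_le_add (mul_le_mul' le_rfl h1) (mul_le_mul' le_rfl h2)).trans ?_
      rw [← mul_assoc, ← mul_assoc, ← add_mul, ← ENNReal.ofReal_mul (by positivity), ← ENNReal.ofReal_mul (by positivity),
        ← ENNReal.ofReal_add (by positivity) (by positivity)]
      refine mul_le_mul' (ENNReal.ofReal_le_ofReal ?_) le_rfl
      rw [n2, Real.mul_rpow (by norm_num) hpos.le]
      have e1 : (1 / 2) ^ p * q1 * (A * (2 ^ (γ * p) * ‖h‖ ^ (γ * p))) = q * A * ‖h‖ ^ (γ * p) := by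
        rw [← hqq]; ring
      rw [e1]
      have e2 : (1 / 2) ^ p * C1 * C ≤ (1 - q) * A := by
        have := le_max_right (2 * 2 ^ p * (h0 / 2) ^ (-(γ * p))) ((1 / 2) ^ p * C1 * C / (1 - q))
        rw [← hA, div_le_iff₀ (by linarith)] at this
        linarith
      have e3 : 0 ≤ ‖h‖ ^ (γ * p) := by positivity
      nlinarith
  intro h hne hh
  have hpos : 0 < ‖h‖ := norm_pos_iff.mpr hne
  obtain ⟨k, hk⟩ := exists_pow_lt_of_lt_one (by positivity : 0 < ‖h‖ / h0) (by norm_num : (1:ℝ) / 2 < 1)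
  refine ind k h ?_ hh
  rw [lt_div_iff₀ hh0, one_div, inv_pow] at hk
  refine le_trans ?_ hk.le
  rw [div_eq_mul_inv, mul_comm]
  refine mul_le_mul_of_nonneg_right ?_ hh0.le
  exact inv_anti₀ (by positivity) (pow_le_pow_right₀ (by norm_num) (by omega))

lemma D2_of_PQ {n : ℕ} (hn : 0 < n) {p s σ σ' : ℝ} (hp : 1 < p) (hσ : 0 < σ) (hσ' : σ < σ') (H : PQ n p s σ') :
    ∀ r : ℝ, 0 < r → r < 1 → ∃ C : ℝ, 0 < C ∧ ∃ ρ0 : ℝ, 0 < ρ0 ∧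
      ∀ f U : Eu n → ℝ, Sol n p s f U → D2 n p (σ * p) r ρ0 U ≤ ENNReal.ofReal C * Lam n p s f U := by
  intro r hr hr1
  have hp0 : 0 < p := by linarith
  obtain ⟨C, hC, h0, hh0, HC⟩ := H r hr hr1
  obtain ⟨C2, hC2, h2⟩ := kernel_int (n := n) hn (by positivity : 0 < σ * p) (mul_lt_mul_of_pos_right hσ' hp0)
  refine ⟨C * (C2 * 1 ^ (-(σ * p))), by positivity, min h0 1, lt_min hh0 one_pos, fun f U hU => ?_⟩
  have h21 := h2 1 one_pos
  set Λ := Lam n p s f U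
  unfold D2
  calc _ ≤ ∫⁻ z in ball (0 : Eu n) (min h0 1), (ENNReal.ofReal C * 
        ENNReal.ofReal (min 1 (‖z‖ / 1) ^ (σ' * p) * ‖z‖ ^ (-((n:ℝ) + σ * p)))) * Λ := by
        refine setLIntegral_mono' measurableSet_ball fun z hz => ?_
        rw [mem_ball_zero_iff] at hz
        rcases eq_or_ne z 0 with h0 | hne
        · subst h0
          simp [Real.zero_rpow hp0.ne']
        have hz1 : min 1 (‖z‖ / 1) = ‖z‖ := by
          rw [div_one]; exact min_eq_right (hz.le.trans (min_le_right _ _))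
        rw [hz1]
        have := HC f U hU z hne (hz.le.trans (min_le_left _ _))
        have e : ∀ x, ENNReal.ofReal (|U (x + z) - U x| ^ p * ‖z‖ ^ (-((n:ℝ) + σ * p))) =
          ENNReal.ofReal (‖z‖ ^ (-((n:ℝ) + σ * p))) * ENNReal.ofReal (|tau z U x| ^ p) := by
          intro x; rw [← ENNReal.ofReal_mul (by positivity), mul_comm]; rfl
        simp_rw [e]
        rw [lintegral_const_mul' _ _ ENNReal.ofReal_ne_top]
        refine (mul_le_mul' le_rfl this).trans (le_of_eq ?_)
        rw [← ENNReal.ofReal_mul (by positivity), ← mul_assoc, ← ENNReal.ofReal_mul (by positivity)]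
        congr 2; ring
    _ ≤ ∫⁻ z : Eu n, (ENNReal.ofReal C * 
        ENNReal.ofReal (min 1 (‖z‖ / 1) ^ (σ' * p) * ‖z‖ ^ (-((n:ℝ) + σ * p)))) * Λ := setLIntegral_le_lintegral _ _
    _ ≤ _ := by
        rw [lintegral_mul_const _ (by fun_prop), lintegral_const_mul' _ _ ENNReal.ofReal_ne_top,
          ENNReal.ofReal_mul hC.le]
        exact mul_le_mul' (mul_le_mul' le_rfl h21) le_rfl

lemma step_pt {p s σ γ : ℝ} {m C : ℝ} (hC : ∀ lam : ℝ, 0 < lam → ∀ a b : ℝ,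
    |a - b| ^ p ≤ C * (lam ^ (-(1 - thetaP p)) * ((Jp p a - Jp p b) * (a - b))
      + lam ^ (thetaP p) * (|a| ^ p + |b| ^ p))) {H Z : ℝ} (hH : 0 < H) (hZ : 0 < Z) (a b : ℝ) :
    |a - b| ^ p * Z ^ (-(m + (s * thetaP p + σ * (1 - thetaP p)) * p)) ≤
    C * (H ^ (-(γ * (1 - thetaP p))) * ((Jp p a - Jp p b) * (a - b) * Z ^ (-(m + s * p)))
      + H ^ (γ * thetaP p) * (|a| ^ p * Z ^ (-(m + σ * p)) + |b| ^ p * Z ^ (-(m + σ * p)))) := by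
  have h := hC (H ^ γ * Z ^ ((s - σ) * p)) (by positivity) a b
  set θ := thetaP p
  have hz : 0 ≤ Z ^ (-(m + (s * θ + σ * (1 - θ)) * p)) := by positivity
  refine (mul_le_mul_of_nonneg_right h hz).trans (le_of_eq ?_)
  rw [Real.mul_rpow (by positivity) (by positivity), Real.mul_rpow (by positivity) (by positivity),
    ← Real.rpow_mul hH.le, ← Real.rpow_mul hH.le, ← Real.rpow_mul hZ.le, ← Real.rpow_mul hZ.le]
  have e1 : Z ^ (-(m + s * p)) = Z ^ ((s - σ) * p * -(1 - θ)) * Z ^ (-(m + (s * θ + σ * (1 - θ)) * p)) := by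
    rw [← Real.rpow_add hZ]; congr 1; ring
  have e2 : Z ^ (-(m + σ * p)) = Z ^ ((s - σ) * p * θ) * Z ^ (-(m + (s * θ + σ * (1 - θ)) * p)) := by
    rw [← Real.rpow_add hZ]; congr 1; ring
  rw [e1, e2, show -(γ * (1 - θ)) = γ * -(1 - θ) by ring]
  ring

lemma boot_step {n : ℕ} (hn : 0 < n) {p s σ γ : ℝ} (hp : 1 < p) (hs : 0 < s) (hs1 : s < 1) (hσ : 0 < σ)
    (hγ : 0 < γ) (hγ1 : γ ≤ 1 + s) (H : PP n p s γ)
    (HD : ∀ r : ℝ, 0 < r → r < 1 → ∃ C : ℝ, 0 < C ∧ ∃ ρ0 : ℝ, 0 < ρ0 ∧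
      ∀ f U : Eu n → ℝ, Sol n p s f U → D2 n p (σ * p) r ρ0 U ≤ ENNReal.ofReal C * Lam n p s f U) :
    PP n p s (s * thetaP p + σ * (1 - thetaP p) + γ * thetaP p / p) := by
  intro r hr hr1
  have hp0 : 0 < p := by linarith
  have hθ := thetaP_pos hp
  have hθ1 := thetaP_le p
  set θ := thetaP p with hθd
  set t := s * θ + σ * (1 - θ) with ht
  have ht0 : 0 < t := by
    have : 0 < s * θ := by positivity
    have : 0 ≤ σ * (1 - θ) := mul_nonneg hσ.le (by linarith)
    linarith
  have hr2 : 0 < 1 - r := by linarith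
  obtain ⟨C1, hC1, ρ1, hρ1, H1⟩ := HD ((1 + r) / 2) (by linarith) (by linarith)
  set ρ := min ((1 - r) / 32) ρ1 with hρd
  have hρ : 0 < ρ := lt_min (by linarith) hρ1
  have hρr : ρ ≤ (1 - r) / 32 := min_le_left _ _
  have hρρ : ρ ≤ ρ1 := min_le_right _ _
  obtain ⟨C2, hC2, h2, hh2, H2⟩ := H (r + ρ + 4 * ρ) (by linarith) (by linarith)
  obtain ⟨C3, hC3, h3, hh3, H3⟩ := PQ_start (n := n) hp hs (r + ρ + 4 * ρ) (by linarith) (by linarith)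
  obtain ⟨C4, hC4, H4⟩ := KE (n := n) hn hp hs hs1 (by linarith : 0 < r + ρ) hρ (by linarith)
  obtain ⟨C5, hC5, H5⟩ := mono_main hp
  obtain ⟨C6, hC6, H6⟩ := nikolskii (n := n) hp0 (by positivity : 0 < t * p)
  refine ⟨C6 * (C5 * (C4 * (1 + C2 + C3) + 2 * C1)), by positivity, min (min h2 h3) (min (ρ / 2) 1), by positivity, 
    fun f U hU h hne hh => ?_⟩
  have a1 : ‖h‖ ≤ h2 := hh.trans ((min_le_left _ _).trans (min_le_left _ _))
  have a2 : ‖h‖ ≤ h3 := hh.trans ((min_le_left _ _).trans (min_le_right _ _))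
  have a3 : ‖h‖ ≤ ρ / 2 := hh.trans ((min_le_right _ _).trans (min_le_left _ _))
  have a4 : ‖h‖ ≤ 1 := hh.trans ((min_le_right _ _).trans (min_le_right _ _))
  have hH : 0 < ‖h‖ := norm_pos_iff.mpr hne
  have K := H4 f U hU h (by linarith) (‖h‖ ^ γ) (by positivity)
  have b2 := H2 f U hU h hne a1
  have b3 := H3 f U hU h hne a2
  have bD := H1 f U hU
  set Λ := Lam n p s f U
  have hUm := hU.mU
  have KK : ∫⁻ z in ball (0 : Eu n) ρ, ∫⁻ x in ball (0 : Eu n) (r + ρ),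
      ENNReal.ofReal ((Jp p (U (x + h + z) - U (x + h)) - Jp p (U (x + z) - U x)) *
        (tau h U (x + z) - tau h U x) * kz n s p z) ≤ ENNReal.ofReal (C4 * (1 + C2 + C3) * ‖h‖ ^ γ) * Λ := by
    refine K.trans ?_
    calc _ ≤ ENNReal.ofReal C4 * (ENNReal.ofReal (‖h‖ ^ γ) * Λ + ENNReal.ofReal ((‖h‖ ^ γ) ^ (1 - p)) *
        (ENNReal.ofReal (C2 * ‖h‖ ^ (γ * p)) * Λ + ENNReal.ofReal (‖h‖ ^ p) * (ENNReal.ofReal (C3 * ‖h‖ ^ (s * p)) * Λ))) := by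
          gcongr
      _ = ENNReal.ofReal (C4 * (‖h‖ ^ γ + (‖h‖ ^ γ) ^ (1 - p) * (C2 * ‖h‖ ^ (γ * p) + ‖h‖ ^ p * (C3 * ‖h‖ ^ (s * p))))) * Λ := by
          rw [ENNReal.ofReal_mul (p := C4) (by positivity), ENNReal.ofReal_add (by positivity) (by positivity),
            ENNReal.ofReal_mul (p := (‖h‖ ^ γ) ^ (1 - p)) (by positivity), ENNReal.ofReal_add (by positivity) (by positivity),
            ENNReal.ofReal_mul (p := ‖h‖ ^ p) (by positivity)]
          ring
      _ ≤ _ := by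
          refine mul_le_mul' (ENNReal.ofReal_le_ofReal ?_) le_rfl
          have e1 : (‖h‖ ^ γ) ^ (1 - p) * ‖h‖ ^ (γ * p) = ‖h‖ ^ γ := by
            rw [← Real.rpow_mul hH.le, ← Real.rpow_add hH]; congr 1; ring
          have e2 : (‖h‖ ^ γ) ^ (1 - p) * (‖h‖ ^ p * ‖h‖ ^ (s * p)) ≤ ‖h‖ ^ γ := by
            rw [← Real.rpow_mul hH.le, ← Real.rpow_add hH, ← Real.rpow_add hH]
            refine Real.rpow_le_rpow_of_exponent_ge hH a4 ?_
            nlinarith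
          calc _ = C4 * (‖h‖ ^ γ + C2 * ((‖h‖ ^ γ) ^ (1 - p) * ‖h‖ ^ (γ * p)) + 
                C3 * ((‖h‖ ^ γ) ^ (1 - p) * (‖h‖ ^ p * ‖h‖ ^ (s * p)))) := by ring
            _ ≤ C4 * (‖h‖ ^ γ + C2 * ‖h‖ ^ γ + C3 * ‖h‖ ^ γ) := by rw [e1]; gcongr
            _ = _ := by ring
  set g := tau h U with hg
  have hgm : Measurable g := measurable_tau h hUm
  have hJ := measurable_Jp p
  have DD : D2 n p (t * p) (r + ρ) ρ g ≤ ENNReal.ofReal (C5 * (C4 * (1 + C2 + C3) + 2 * C1) * ‖h‖ ^ (γ * θ)) * Λ := by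
    unfold D2
    set c1 := C5 * ‖h‖ ^ (-(γ * (1 - θ))) with hc1
    set c2 := C5 * ‖h‖ ^ (γ * θ) with hc2
    have hc1p : 0 < c1 := by positivity
    have hc2p : 0 < c2 := by positivity
    have M1 : Measurable (fun q : Eu n × Eu n => ENNReal.ofReal ((Jp p (U (q.2 + h + q.1) - U (q.2 + h)) - Jp p (U (q.2 + q.1) - U q.2)) *
        (g (q.2 + q.1) - g q.2) * kz n s p q.1)) := by fun_prop
    have M2 : Measurable (fun q : Eu n × Eu n => ENNReal.ofReal (|U (q.2 + h + q.1) - U (q.2 + h)| ^ p * ‖q.1‖ ^ (-((n:ℝ) + σ * p)))) := by fun_prop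
    calc _ ≤ ∫⁻ z in ball (0 : Eu n) ρ, (ENNReal.ofReal c1 * (∫⁻ x in ball (0 : Eu n) (r + ρ),
          ENNReal.ofReal ((Jp p (U (x + h + z) - U (x + h)) - Jp p (U (x + z) - U x)) * (g (x + z) - g x) * kz n s p z)) +
          ENNReal.ofReal c2 * ((∫⁻ x in ball (0 : Eu n) (r + ρ), ENNReal.ofReal (|U (x + h + z) - U (x + h)| ^ p * ‖z‖ ^ (-((n:ℝ) + σ * p)))) +
          ∫⁻ x in ball (0 : Eu n) (r + ρ), ENNReal.ofReal (|U (x + z) - U x| ^ p * ‖z‖ ^ (-((n:ℝ) + σ * p))))) := by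
          refine setLIntegral_mono' measurableSet_ball fun z hz => ?_
          rcases eq_or_ne z 0 with h0 | hzne
          · subst h0
            simp [Real.zero_rpow hp0.ne']
          have hZ : 0 < ‖z‖ := norm_pos_iff.mpr hzne
          rw [← lintegral_add_left (by fun_prop), ← lintegral_const_mul' _ _ ENNReal.ofReal_ne_top,
            ← lintegral_const_mul' _ _ ENNReal.ofReal_ne_top, ← lintegral_add_left (by fun_prop)]
          refine lintegral_mono fun x => ?_
          have hab : g (x + z) - g x = (U (x + h + z) - U (x + h)) - (U (x + z) - U x) := by
            simp only [hg, tau]; rw [show x + z + h = x + h + z by abel]; ring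
          rw [hab]
          have q0 := Q_nonneg hp (U (x + h + z) - U (x + h)) (U (x + z) - U x)
          have k0 := kz_nonneg (n := n) (s := s) (p := p) z
          rw [← ENNReal.ofReal_add (by positivity) (by positivity), ← ENNReal.ofReal_mul (by positivity),
            ← ENNReal.ofReal_mul (by positivity), ← ENNReal.ofReal_add (by positivity) (by positivity)]
          apply ENNReal.ofReal_le_ofReal
          refine (step_pt (s := s) (σ := σ) (γ := γ) (m := (n:ℝ)) H5 hH hZ _ _).trans (le_of_eq ?_)
          rw [hc1, hc2, kz]
          ring
      _ = ENNReal.ofReal c1 * (∫⁻ z in ball (0 : Eu n) ρ, ∫⁻ x in ball (0 : Eu n) (r + ρ),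
          ENNReal.ofReal ((Jp p (U (x + h + z) - U (x + h)) - Jp p (U (x + z) - U x)) * (g (x + z) - g x) * kz n s p z)) +
          ENNReal.ofReal c2 * ((∫⁻ z in ball (0 : Eu n) ρ, ∫⁻ x in ball (0 : Eu n) (r + ρ), ENNReal.ofReal (|U (x + h + z) - U (x + h)| ^ p * ‖z‖ ^ (-((n:ℝ) + σ * p)))) +
            D2 n p (σ * p) (r + ρ) ρ U) := by
          rw [lintegral_add_left, lintegral_const_mul' _ _ ENNReal.ofReal_ne_top, lintegral_const_mul' _ _ ENNReal.ofReal_ne_top,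
            lintegral_add_left]
          · rfl
          · exact M2.lintegral_prod_right'
          · exact (M1.lintegral_prod_right').const_mul _
      _ ≤ ENNReal.ofReal c1 * (ENNReal.ofReal (C4 * (1 + C2 + C3) * ‖h‖ ^ γ) * Λ) + 
          ENNReal.ofReal c2 * (ENNReal.ofReal C1 * Λ + ENNReal.ofReal C1 * Λ) := by
          have d1 : D2 n p (σ * p) (r + ρ) ρ U ≤ ENNReal.ofReal C1 * Λ := (D2_mono U (by linarith) hρρ).trans bD
          have d2 : ∫⁻ z in ball (0 : Eu n) ρ, ∫⁻ x in ball (0 : Eu n) (r + ρ), ENNReal.ofReal (|U (x + h + z) - U (x + h)| ^ p * ‖z‖ ^ (-((n:ℝ) + σ * p)))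
              ≤ ENNReal.ofReal C1 * Λ := by
            refine le_trans ?_ bD
            unfold D2
            refine le_trans (lintegral_mono fun z => ?_) (lintegral_mono_set (ball_subset_ball hρρ))
            exact setlint_shift_le (fun x => ENNReal.ofReal (|U (x + z) - U x| ^ p * ‖z‖ ^ (-((n:ℝ) + σ * p)))) h (by linarith)
          gcongr
      _ = ENNReal.ofReal (c1 * (C4 * (1 + C2 + C3) * ‖h‖ ^ γ) + c2 * (C1 + C1)) * Λ := by
          rw [ENNReal.ofReal_add (by positivity) (by positivity), ENNReal.ofReal_mul hc1p.le, ENNReal.ofReal_mul hc2p.le,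
            ENNReal.ofReal_add hC1.le hC1.le]
          ring
      _ = _ := by
          congr 2
          have e : ‖h‖ ^ (γ * θ) = ‖h‖ ^ (-(γ * (1 - θ))) * ‖h‖ ^ γ := by
            rw [← Real.rpow_add hH]; congr 1; ring
          rw [hc1, hc2, e]; ring
  refine (H6 r g hgm h hne).trans ?_
  refine (mul_le_mul' le_rfl ((D2_mono g (by linarith) (by linarith)).trans DD)).trans (le_of_eq ?_)
  rw [← mul_assoc, ← ENNReal.ofReal_mul (by positivity)]
  congr 2
  have e : ‖h‖ ^ ((t + γ * θ / p) * p) = ‖h‖ ^ (t * p) * ‖h‖ ^ (γ * θ) := by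
    rw [← Real.rpow_add hH]; congr 1; field_simp
  rw [e]; ring

lemma boot {n : ℕ} (hn : 0 < n) {p s α : ℝ} (hp : 1 < p) (hs : 0 < s) (hs1 : s < 1)
    (hsp : 1 < s * (p / (p - 1))) (hα : 0 < α) (hα2 : α < (s * (p / (p - 1)) - 1) * min 1 (p - 1)) :
    PP n p s (1 + α) := by
  have hp0 : 0 < p := by linarith
  have hp1 : 0 < p - 1 := by linarith
  have hθ := thetaP_pos hp
  have hθ1 := thetaP_le p
  have hsp' : p - 1 < s * p := by
    rw [← mul_div_assoc, lt_div_iff₀ hp1] at hsp; linarith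
  have hgap : 0 < s * thetaP p + 1 - thetaP p - (1 + α) * (1 - thetaP p / p) := by
    unfold thetaP
    rcases le_total p 2 with h | h
    · rw [min_eq_right (by linarith)] at hα2 ⊢
      have : (s * (p / (p - 1)) - 1) * (p - 1) = s * p - p + 1 := by field_simp; ring
      rw [this] at hα2
      have : p / 2 / p = 1 / 2 := by field_simp
      rw [this]; linarith
    · rw [min_eq_left (by linarith), mul_one] at hα2
      rw [min_eq_left (by linarith)]
      have h3 : (1 + α) * (p - 1) < s * p := by
        have : 1 + α < s * p / (p - 1) := by rw [mul_div_assoc]; linarith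
        rwa [lt_div_iff₀ hp1] at this
      have : 1 - 1 / p = (p - 1) / p := by field_simp
      rw [this, ← mul_div_assoc]
      have : (1 + α) * (p - 1) / p < s := by rw [div_lt_iff₀ hp0]; exact h3
      linarith
  have hαs : α ≤ s := by
    rcases le_total p 2 with h | h
    · rw [min_eq_right (by linarith)] at hα2 
      have : (s * (p / (p - 1)) - 1) * (p - 1) = s * p - p + 1 := by field_simp; ring
      rw [this] at hα2
      nlinarith
    · rw [min_eq_left (by linarith), mul_one] at hα2
      have : p / (p - 1) ≤ 2 := by rw [div_le_iff₀ hp1]; linarith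
      nlinarith
  set θ := thetaP p
  have hg1 : 0 < θ * (s - (p - 1) / p) := by
    have : (p - 1) / p < s := by rw [div_lt_iff₀ hp0]; linarith
    have : 0 < s - (p - 1) / p := by linarith
    positivity
  set gap := s * θ + 1 - θ - (1 + α) * (1 - θ / p)
  set κ := min (min (θ * (s - (p - 1) / p)) gap / 2) (s / 2) with hκ
  have hκ0 : 0 < κ := by positivity
  have hκs : κ ≤ s / 2 := min_le_right _ _
  have hm := min_le_left (min (θ * (s - (p - 1) / p)) gap / 2) (s / 2)
  have hk1 : 2 * κ ≤ θ * (s - (p - 1) / p) := by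
    have := min_le_left (θ * (s - (p - 1) / p)) gap; linarith
  have hk2 : 2 * κ ≤ gap := by
    have := min_le_right (θ * (s - (p - 1) / p)) gap; linarith
  have hθp : θ / p ≤ 1 := by rw [div_le_one hp0]; linarith
  have hθp0 : 0 < θ / p := by positivity
  have step : ∀ γ, s ≤ γ → γ ≤ 1 + α → PP n p s γ → PP n p s (γ + κ) := by
    intro γ hγs hγα H
    have hms : s ≤ min γ 1 := le_min hγs hs1.le
    set σ := min γ 1 - κ with hσ
    have hσ0 : 0 < σ := by linarith
    have HQ : PQ n p s (min γ 1 - κ / 2) := by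
      refine marchaud hp (by linarith) ?_ (PP_mono hp0 H ?_)
      · have := min_le_right γ 1; linarith
      · have := min_le_left γ 1; linarith
    have HD := D2_of_PQ hn hp hσ0 (by linarith : σ < min γ 1 - κ / 2) HQ
    refine PP_mono hp0 (boot_step hn hp hs hs1 hσ0 (by linarith) (by linarith) H HD) ?_
    change γ + κ ≤ s * θ + σ * (1 - θ) + γ * θ / p
    have k1 : κ * (1 - θ) ≤ κ := by nlinarith
    rcases le_total γ 1 with h | h
    · rw [hσ, min_eq_left h]
      have : (p - 1) / p = 1 - 1 / p := by field_simp
      rw [this] at hk1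
      have e : γ * θ / p = θ * γ * (1 / p) := by field_simp
      have e2 : 0 ≤ 1 - 1 / p := by rw [← this]; positivity
      have e3 : θ * (s - γ * (1 - 1 / p)) ≥ θ * (s - (1 - 1 / p)) := by
        refine mul_le_mul_of_nonneg_left ?_ hθ.le
        nlinarith
      rw [e]; nlinarith
    · rw [hσ, min_eq_right h]
      have e : γ * θ / p = γ * (θ / p) := by ring
      rw [e]
      have : γ * (1 - θ / p) ≤ (1 + α) * (1 - θ / p) := mul_le_mul_of_nonneg_right hγα (by linarith)
      change 2 * κ ≤ s * θ + 1 - θ - (1 + α) * (1 - θ / p) at hk2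
      nlinarith
  have ind : ∀ k : ℕ, PP n p s (min (s + k * κ) (1 + α)) := by
    intro k
    induction k with
    | zero => exact PP_mono hp0 (PP_start hp hs) (by simp)
    | succ k ih =>
      have h0 : 0 ≤ k * κ := by positivity
      have h1 : s ≤ min (s + k * κ) (1 + α) := le_min (by linarith) (by linarith)
      refine PP_mono hp0 (step _ h1 (min_le_right _ _) ih) ?_
      push_cast
      rcases le_total (s + k * κ) (1 + α) with h | h
      · rw [min_eq_left h]
        exact (min_le_left _ _).trans (by linarith)
      · rw [min_eq_right h]
        exact (min_le_right _ _).trans (by linarith)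
  obtain ⟨k, hk⟩ := exists_nat_gt ((1 + α - s) / κ)
  rw [div_lt_iff₀ hκ0] at hk
  refine PP_mono hp0 (ind k) (le_min (by linarith) le_rfl)




lemma fatou_ev {X : Type*} [MeasurableSpace X] (μ : Measure X) {f : ℕ → X → ℝ≥0∞} {g : X → ℝ≥0∞}
    (hf : ∀ j, Measurable (f j)) (h : ∀ x, ∀ᶠ j in Filter.atTop, f j x = g x) {M : ℝ≥0∞}
    (hM : ∀ j, ∫⁻ x, f j x ∂μ ≤ M) : ∫⁻ x, g x ∂μ ≤ M := by
  have e : ∀ x, g x = Filter.liminf (fun j => f j x) Filter.atTop := by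
    intro x
    have : Filter.Tendsto (fun j => f j x) Filter.atTop (nhds (g x)) :=
      tendsto_const_nhds.congr' ((h x).mono fun j hj => hj.symm)
    exact this.liminf_eq.symm
  simp_rw [e]
  refine (lintegral_liminf_le hf).trans ?_
  refine Filter.liminf_le_of_frequently_le' (Filter.Frequently.of_forall hM)

lemma gag_eq {n : ℕ} {s p : ℝ} (D : Set (Eu n)) (g : Eu n → ℝ) :
    gagliardoE n s p D g = ∫⁻ x in D, ∫⁻ y in D, ENNReal.ofReal (|g y - g x| ^ p * kz n s p (y - x)) := by
  unfold gagliardoE kz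
  congr 1; ext x; congr 1; ext y
  rw [Real.rpow_neg (norm_nonneg _), ← div_eq_mul_inv, dist_comm, dist_eq_norm, abs_sub_comm]

lemma vol_shift {n : ℕ} (g : Eu n → ℝ≥0∞) (x : Eu n) : ∫⁻ y, g (y - x) = ∫⁻ y, g y :=
  lintegral_sub_right_eq_self g x

lemma bary {n : ℕ} (hn : 0 < n) {s p : ℝ} (hsp : 0 < s * p) (hs : s * p < p) : ∃ C : ℝ, 0 < C ∧
    ∀ d : ℝ, 0 < d → ∀ x : Eu n, ∫⁻ y, ENNReal.ofReal (min 1 (‖y - x‖ / d) ^ p * kz n s p (y - x))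
      ≤ ENNReal.ofReal (C * d ^ (-(s * p))) := by
  obtain ⟨C, hC, h⟩ := kernel_int (n := n) hn hsp hs
  refine ⟨C, hC, fun d hd x => ?_⟩
  rw [vol_shift (fun y => ENNReal.ofReal (min 1 (‖y‖ / d) ^ p * kz n s p y))]
  exact h d hd

lemma kappa_upper {n : ℕ} (hn : 0 < n) {s p : ℝ} (hsp : 0 < s * p) (hs : s * p < p) : ∃ C : ℝ, 0 < C ∧
    ∀ x ∈ ball (0 : Eu n) 1, ∫⁻ y in (ball (0 : Eu n) 1)ᶜ, ENNReal.ofReal (kz n s p (y - x))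
      ≤ ENNReal.ofReal (C * (1 - ‖x‖) ^ (-(s * p))) := by
  obtain ⟨C, hC, h⟩ := bary (n := n) hn hsp hs
  refine ⟨C, hC, fun x hx => ?_⟩
  rw [mem_ball_zero_iff] at hx
  refine le_trans ?_ (h (1 - ‖x‖) (by linarith) x)
  refine le_trans ?_ (setLIntegral_le_lintegral (ball (0 : Eu n) 1)ᶜ _)
  refine setLIntegral_mono' measurableSet_ball.compl fun y hy => ?_
  have hy : 1 ≤ ‖y‖ := by simpa using hy
  have : 1 ≤ ‖y - x‖ / (1 - ‖x‖) := by
    rw [le_div_iff₀ (by linarith)]; have := norm_sub_norm_le y x; linarith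
  rw [min_eq_left this, Real.one_rpow, one_mul]

lemma kappa_lower {n : ℕ} (hn : 0 < n) {s p : ℝ} (hsp : 0 < s * p) : ∃ c : ℝ, 0 < c ∧
    ∀ x ∈ ball (0 : Eu n) 1, ENNReal.ofReal (c * (1 - ‖x‖) ^ (-(s * p))) ≤
      ∫⁻ y in ball (0 : Eu n) 2 \ ball 0 1, ENNReal.ofReal (kz n s p (y - x)) := by
  set V := (volume (ball (0 : Eu n) 1)).toReal with hV
  have hVfin : volume (ball (0 : Eu n) 1) ≠ ⊤ := measure_ball_lt_top.ne
  have hVpos : 0 < V := ENNReal.toReal_pos (measure_ball_pos _ _ one_pos).ne' hVfin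
  refine ⟨2 ^ (-((n:ℝ) + s * p)) * (1 / 2) ^ (n:ℝ) * V, by positivity, fun x hx => ?_⟩
  rw [mem_ball_zero_iff] at hx
  set d := 1 - ‖x‖ with hd
  have hd0 : 0 < d := by linarith
  obtain ⟨e, he, hxe⟩ : ∃ e : Eu n, ‖e‖ = 1 ∧ x = ‖x‖ • e := by
    rcases eq_or_ne x 0 with h | h
    · have : Nonempty (Fin n) := ⟨⟨0, hn⟩⟩
      obtain ⟨e, he⟩ := exists_norm_eq (Eu n) (zero_le_one : (0:ℝ) ≤ 1)
      exact ⟨e, he, by simp [h]⟩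
    · refine ⟨‖x‖⁻¹ • x, ?_, ?_⟩
      · rw [norm_smul, norm_inv, norm_norm, inv_mul_cancel₀ (norm_ne_zero_iff.mpr h)]
      · rw [smul_smul, mul_inv_cancel₀ (norm_ne_zero_iff.mpr h), one_smul]
  set c := (1 + d / 2) • e with hc
  have hcn : ‖c‖ = 1 + d / 2 := by
    rw [hc, norm_smul, he, mul_one, Real.norm_of_nonneg (by linarith)]
  have hcx : ‖c - x‖ = 3 / 2 * d := by
    have : c - x = (3 / 2 * d) • e := by
      conv_lhs => rw [hxe, hc, ← sub_smul]
      congr 1; rw [hd]; ring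
    rw [this, norm_smul, he, mul_one, Real.norm_of_nonneg (by linarith)]
  have hsub : ball c (d / 2) ⊆ ball (0 : Eu n) 2 \ ball 0 1 := by
    intro y hy
    rw [mem_ball, dist_eq_norm] at hy
    have h1 := norm_sub_norm_le c y
    rw [norm_sub_rev] at h1
    have h2 := norm_sub_norm_le y c
    refine ⟨?_, ?_⟩
    · rw [mem_ball_zero_iff]; have := norm_nonneg x; linarith
    · rw [mem_ball_zero_iff, not_lt]; linarith
  refine le_trans ?_ (lintegral_mono_set hsub)
  calc _ = ENNReal.ofReal ((2 * d) ^ (-((n:ℝ) + s * p))) * volume (ball c (d / 2)) := by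
        rw [vol_ball (by positivity), ← ENNReal.ofReal_toReal hVfin, ← hV, ← ENNReal.ofReal_mul (by positivity), 
          ← ENNReal.ofReal_mul (by positivity)]
        congr 1
        rw [show d / 2 = 1 / 2 * d by ring, Real.mul_rpow (by norm_num) hd0.le, Real.mul_rpow (by norm_num) hd0.le]
        have : d ^ (-(s * p)) = d ^ (-((n:ℝ) + s * p)) * d ^ (n:ℝ) := by
          rw [← Real.rpow_add hd0]; congr 1; ring
        rw [this]; ring
    _ = ∫⁻ y in ball c (d / 2), ENNReal.ofReal ((2 * d) ^ (-((n:ℝ) + s * p))) := by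
        rw [setLIntegral_const]
    _ ≤ _ := by
        refine setLIntegral_mono' measurableSet_ball fun y hy => ?_
        rw [mem_ball, dist_eq_norm] at hy
        apply ENNReal.ofReal_le_ofReal
        unfold kz
        have h1 := norm_sub_norm_le (c - x) (c - y)
        rw [show c - x - (c - y) = y - x by abel, norm_sub_rev c y] at h1
        have h2 := norm_add_le (y - c) (c - x)
        rw [show y - c + (c - x) = y - x by abel] at h2
        refine Real.rpow_le_rpow_of_nonpos (by linarith) (by linarith) ?_
        have : (0:ℝ) ≤ n := by positivity
        linarith

/-- boundary cutoff -/
def etk (n : ℕ) (k : ℝ) (x : Eu n) : ℝ := max 0 (min 1 (k * (1 - ‖x‖) - 1))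

@[fun_prop]
lemma measurable_etk (n : ℕ) (k : ℝ) : Measurable (etk n k) := by unfold etk; fun_prop

lemma etk_cut {n : ℕ} {k : ℝ} (hk : 0 < k) : Cut n (1 - 1 / k) k (etk n k) where
  m := measurable_etk n k
  nn x := le_max_left _ _
  le x := max_le zero_le_one (min_le_left _ _)
  z x hx := by
    rw [mem_ball_zero_iff, not_lt] at hx
    refine max_eq_left ((min_le_right _ _).trans ?_)
    have : k * (1 - ‖x‖) ≤ k * (1 / k) := mul_le_mul_of_nonneg_left (by linarith) hk.le
    rw [mul_one_div_cancel hk.ne'] at this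
    linarith
  L0 := hk.le
  lip x y := by
    unfold etk
    have h0 := abs_max_sub_max_le_max 0 (min 1 (k * (1 - ‖x‖) - 1)) 0 (min 1 (k * (1 - ‖y‖) - 1))
    refine h0.trans ?_
    rw [sub_self, abs_zero, max_eq_right (abs_nonneg _)]
    have h1 := abs_min_sub_min_le_max 1 (k * (1 - ‖x‖) - 1) 1 (k * (1 - ‖y‖) - 1)
    refine h1.trans ?_
    rw [sub_self, abs_zero, max_eq_right (abs_nonneg _)]
    have : k * (1 - ‖x‖) - 1 - (k * (1 - ‖y‖) - 1) = k * (‖y‖ - ‖x‖) := by ring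
    rw [this, abs_mul, abs_of_pos hk]
    refine mul_le_mul_of_nonneg_left ?_ hk.le
    rw [norm_sub_rev]; exact abs_norm_sub_norm_le y x

lemma etk_one {n : ℕ} {k : ℝ} (hk : 0 < k) {x : Eu n} (h : 2 / k ≤ 1 - ‖x‖) : etk n k x = 1 := by
  unfold etk
  rw [div_le_iff₀ hk] at h
  rw [min_eq_left (by linarith), max_eq_right zero_le_one]

lemma etk_pos {n : ℕ} {k : ℝ} (hk : 0 < k) {x : Eu n} (h : 0 < etk n k x) : 1 / k ≤ 1 - ‖x‖ := by
  by_contra hc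
  rw [not_le] at hc
  have := (etk_cut (n := n) hk).z x (by rw [mem_ball_zero_iff, not_lt]; linarith)
  linarith

lemma etk_diff {n : ℕ} {k : ℝ} (hk : 0 < k) {x y : Eu n} (h : etk n k y ≤ etk n k x) (hx : ‖x‖ < 1) :
    etk n k x - etk n k y ≤ 4 * min 1 (‖y - x‖ / (1 - ‖x‖)) := by
  have c := etk_cut (n := n) hk
  have hd : 0 < 1 - ‖x‖ := by linarith
  rcases le_or_gt (4 / k) (1 - ‖x‖) with h4 | h4
  · have h1 : etk n k x = 1 := etk_one hk (le_trans (by gcongr; norm_num) h4)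
    rcases le_or_gt (2 / k) (1 - ‖y‖) with h2 | h2
    · rw [h1, etk_one hk h2]; simp; positivity
    · have := norm_sub_norm_le y x
      have h5 : 1 / 2 ≤ ‖y - x‖ / (1 - ‖x‖) := by
        rw [le_div_iff₀ hd]
        have : 4 / k = 2 * (2 / k) := by ring
        linarith
      have : 1 / 2 ≤ min 1 (‖y - x‖ / (1 - ‖x‖)) := le_min (by norm_num) h5
      have := c.nn y; have := c.le x
      linarith
  · have h1 := c.nn y; have h2 := c.le x
    have h3 := le_of_abs_le (c.lip x y)
    rw [norm_sub_rev] at h3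
    have h5 : k * ‖y - x‖ ≤ 4 * (‖y - x‖ / (1 - ‖x‖)) := by
      rw [← mul_div_assoc, le_div_iff₀ hd]
      rw [lt_div_iff₀ hk] at h4
      have := norm_nonneg (y - x)
      nlinarith
    rcases le_total 1 (‖y - x‖ / (1 - ‖x‖)) with h6 | h6
    · rw [min_eq_left h6]; linarith
    · rw [min_eq_right h6]; linarith




/-- comparison configuration on the unit ball -/
structure Cmp (n : ℕ) (p s : ℝ) (f u v : Eu n → ℝ) : Prop where
  su : Sol n p s f u
  sv : Sol n p s (fun _ => 0) v
  out : ∀ x, x ∉ ball (0 : Eu n) 1 → v x = u x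
  gu : gagliardoE n s p (ball 0 2) u < ⊤

/-- multiplier -/
def mmF (n : ℕ) (η : Eu n → ℝ) (x y : Eu n) : ℝ :=
  open Classical in if x ∈ ball (0 : Eu n) 1 ∧ y ∈ ball (0 : Eu n) 1 then min (η x) (η y) else η x + η y

/-- error -/
def erF (n : ℕ) (η w : Eu n → ℝ) (x y : Eu n) : ℝ :=
  η y * w y - η x * w x - mmF n η x y * (w y - w x)

/-- nonlinear difference -/
def DJ (n : ℕ) (p : ℝ) (u v : Eu n → ℝ) (x y : Eu n) : ℝ := Jp p (u y - u x) - Jp p (v y - v x)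

/-- monotone quantity -/
def QJ (n : ℕ) (p : ℝ) (u v : Eu n → ℝ) (x y : Eu n) : ℝ :=
  DJ n p u v x y * ((u y - u x) - (v y - v x))

lemma QJ_nonneg {n : ℕ} {p : ℝ} (hp : 1 < p) (u v : Eu n → ℝ) (x y : Eu n) : 0 ≤ QJ n p u v x y :=
  Q_nonneg hp _ _

lemma measurable_mmF {n : ℕ} {η : Eu n → ℝ} (h : Measurable η) :
    Measurable (fun q : Eu n × Eu n => mmF n η q.1 q.2) := by
  unfold mmF
  refine Measurable.ite ?_ (by fun_prop) (by fun_prop)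
  exact (measurable_fst measurableSet_ball).inter (measurable_snd measurableSet_ball)

lemma measurable_erF {n : ℕ} {η w : Eu n → ℝ} (h : Measurable η) (hw : Measurable w) :
    Measurable (fun q : Eu n × Eu n => erF n η w q.1 q.2) := by
  unfold erF
  have := measurable_mmF h
  fun_prop

lemma measurable_DJ {n : ℕ} {p : ℝ} {u v : Eu n → ℝ} (h : Measurable u) (hw : Measurable v) :
    Measurable (fun q : Eu n × Eu n => DJ n p u v q.1 q.2) := by
  unfold DJ
  have := measurable_Jp p
  fun_prop

lemma measurable_QJ {n : ℕ} {p : ℝ} {u v : Eu n → ℝ} (h : Measurable u) (hw : Measurable v) :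
    Measurable (fun q : Eu n × Eu n => QJ n p u v q.1 q.2) := by
  unfold QJ
  have := measurable_DJ (p := p) h hw
  fun_prop

/-- from (x,z) to (x,y) coordinates -/
lemma lint_xz {n : ℕ} {F : Eu n × Eu n → ℝ≥0∞} (hF : Measurable F) :
    ∫⁻ q : Eu n × Eu n, F (q.1, q.1 + q.2) ∂(volume.prod volume) = ∫⁻ x, ∫⁻ y, F (x, y) := by
  rw [lintegral_prod _ (by fun_prop)]
  congr 1; ext x
  exact lintegral_add_left_eq_self (fun y => F (x, y)) x

lemma lint_cmp {X : Type*} [MeasurableSpace X] {μ : Measure X} {G E M : X → ℝ} (hG : Integrable G μ)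
    (hE : Measurable E) (hE0 : ∀ x, 0 ≤ E x) (hM0 : ∀ x, 0 ≤ M x) (hM : ∀ x, M x ≤ G x + E x) {c : ℝ}
    (hc : ∫ x, G x ∂μ ≤ c) :
    ∫⁻ x, ENNReal.ofReal (M x) ∂μ ≤ ENNReal.ofReal c + ∫⁻ x, ENNReal.ofReal (E x) ∂μ := by
  by_cases ht : ∫⁻ x, ENNReal.ofReal (E x) ∂μ = ⊤
  · rw [ht]; simp
  have hEi : Integrable E μ := by
    refine ⟨hE.aestronglyMeasurable, ?_⟩
    rw [hasFiniteIntegral_iff_ofReal (Filter.Eventually.of_forall hE0)]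
    exact lt_top_iff_ne_top.mpr ht
  calc _ ≤ ∫⁻ x, ENNReal.ofReal (G x + E x) ∂μ := lintegral_mono fun x => ENNReal.ofReal_le_ofReal (hM x)
    _ = ENNReal.ofReal (∫ x, (G x + E x) ∂μ) := by
        exact (ofReal_integral_eq_lintegral_ofReal (hG.add hEi)
          (Filter.Eventually.of_forall fun x => (hM0 x).trans (hM x))).symm
    _ = ENNReal.ofReal (∫ x, G x ∂μ + ∫ x, E x ∂μ) := by rw [integral_add hG hEi]
    _ ≤ ENNReal.ofReal (c + ∫ x, E x ∂μ) := ENNReal.ofReal_le_ofReal (by linarith)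
    _ ≤ ENNReal.ofReal c + ENNReal.ofReal (∫ x, E x ∂μ) := ENNReal.ofReal_add_le
    _ = _ := by rw [ofReal_integral_eq_lintegral_ofReal hEi (Filter.Eventually.of_forall hE0)]

lemma measM1 {n : ℕ} {p s : ℝ} {η u v : Eu n → ℝ} (hη : Measurable η) (hu : Measurable u) (hv : Measurable v) :
    Measurable (fun q : Eu n × Eu n => mmF n η q.1 q.2 * QJ n p u v q.1 q.2 * kz n s p (q.2 - q.1)) :=
  ((measurable_mmF hη).mul (measurable_QJ (p := p) hu hv)).mul
    (measurable_kz.comp (measurable_snd.sub measurable_fst))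

lemma measM2 {n : ℕ} {p s : ℝ} {η u v w : Eu n → ℝ} (hη : Measurable η) (hu : Measurable u) (hv : Measurable v)
    (hw : Measurable w) :
    Measurable (fun q : Eu n × Eu n => |DJ n p u v q.1 q.2| * |erF n η w q.1 q.2| * kz n s p (q.2 - q.1)) :=
  ((measurable_DJ (p := p) hu hv).norm.mul (measurable_erF hη hw).norm).mul
    (measurable_kz.comp (measurable_snd.sub measurable_fst))

lemma KI_pt {n : ℕ} {p s : ℝ} {η u v w : Eu n → ℝ} (hw : ∀ x, w x = u x - v x) (x z : Eu n) :
    mmF n η x (x + z) * QJ n p u v x (x + z) * kz n s p (x + z - x) ≤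
      (Jker n p s u (fun x => η x * w x) (x, z) - Jker n p s v (fun x => η x * w x) (x, z)) +
      |DJ n p u v x (x + z)| * |erF n η w x (x + z)| * kz n s p (x + z - x) := by
  have k0 := kz_nonneg (n := n) (s := s) (p := p) z
  simp only [Jker, add_sub_cancel_left]
  have e : Jp p (u (x + z) - u x) * (η (x + z) * w (x + z) - η x * w x) * kz n s p z -
      Jp p (v (x + z) - v x) * (η (x + z) * w (x + z) - η x * w x) * kz n s p z =
      (mmF n η x (x + z) * QJ n p u v x (x + z) + DJ n p u v x (x + z) * erF n η w x (x + z)) * kz n s p z := by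
    simp only [QJ, DJ, erF, hw]; ring
  rw [e, ← add_mul]
  refine mul_le_mul_of_nonneg_right ?_ k0
  have := neg_abs_le (DJ n p u v x (x + z) * erF n η w x (x + z))
  rw [abs_mul] at this
  linarith

lemma mmF_nonneg {n : ℕ} {η : Eu n → ℝ} (h : ∀ x, 0 ≤ η x) (x y : Eu n) : 0 ≤ mmF n η x y := by
  unfold mmF
  have := h x; have := h y
  split_ifs <;> positivity

lemma KI {n : ℕ} (hn : 0 < n) {p s : ℝ} (hp : 1 < p) (hs : 0 < s) (hs1 : s < 1) {f u v : Eu n → ℝ}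
    (h : Cmp n p s f u v) {R0 L : ℝ} {η : Eu n → ℝ} (hR : R0 < 1) (hη : Cut n R0 L η)
    {w : Eu n → ℝ} (hwm : Measurable w) (hw : ∀ x, w x = u x - v x) :
    ∫⁻ x, ∫⁻ y, ENNReal.ofReal (mmF n η x y * QJ n p u v x y * kz n s p (y - x)) ≤
      (∫⁻ x in ball (0 : Eu n) 1, ENNReal.ofReal (|f x| * |w x|)) +
      ∫⁻ x, ∫⁻ y, ENNReal.ofReal (|DJ n p u v x y| * |erF n η w x y| * kz n s p (y - x)) := by
  obtain ⟨Lu, hLu, lu⟩ := h.su.lip R0 hR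
  obtain ⟨Lv, hLv, lv⟩ := h.sv.lip R0 hR
  have lw : ∀ x ∈ ball (0 : Eu n) R0, ∀ y ∈ ball (0 : Eu n) R0, |w x - w y| ≤ (Lu + Lv) * ‖x - y‖ := by
    intro x hx y hy
    have e : w x - w y = (u x - u y) - (v x - v y) := by rw [hw, hw]; ring
    rw [e]
    refine (abs_sub _ _).trans ?_
    have := lu x hx y hy; have := lv x hx y hy
    linarith
  obtain ⟨L', hL', hl⟩ := lip_mul hη (add_nonneg hLu hLv) lw
  have hφm : Measurable (fun x => η x * w x) := hη.m.mul hwm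
  have hφ0 : ∀ x, x ∉ ball (0 : Eu n) R0 → η x * w x = 0 := fun x hx => by rw [hη.z x hx, zero_mul]
  obtain ⟨iu, eu⟩ := h.su.weak hn hp hs hs1 hφm hR hφ0 hl
  obtain ⟨iv, ev⟩ := h.sv.weak hn hp hs hs1 hφm hR hφ0 hl
  have M1 := measM1 (s := s) (p := p) hη.m h.su.mU h.sv.mU
  have M2 := measM2 (s := s) (p := p) hη.m h.su.mU h.sv.mU hwm
  have hm : Measurable (fun q : Eu n × Eu n => (q.1, q.1 + q.2)) := by fun_prop
  have E1 := lint_xz M1.ennreal_ofReal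
  have E2 := lint_xz M2.ennreal_ofReal
  have M2' := M2.comp hm
  have hJint : ∫ q, (Jker n p s u (fun x => η x * w x) q - Jker n p s v (fun x => η x * w x) q) ∂(volume.prod volume) =
      ∫ x in ball (0 : Eu n) 1, f x * (η x * w x) := by
    rw [integral_sub iu iv, eu, ev]; simp
  have key := lint_cmp (μ := (volume : Measure (Eu n)).prod volume)
    (M := fun q : Eu n × Eu n => mmF n η q.1 (q.1 + q.2) * QJ n p u v q.1 (q.1 + q.2) * kz n s p (q.1 + q.2 - q.1))
    (E := fun q : Eu n × Eu n => |DJ n p u v q.1 (q.1 + q.2)| * |erF n η w q.1 (q.1 + q.2)| * kz n s p (q.1 + q.2 - q.1))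
    (G := fun q => Jker n p s u (fun x => η x * w x) q - Jker n p s v (fun x => η x * w x) q)
    (iu.sub iv) M2' (fun q => mul_nonneg (mul_nonneg (abs_nonneg _) (abs_nonneg _)) (kz_nonneg _))
    (fun q => mul_nonneg (mul_nonneg (mmF_nonneg hη.nn _ _) (QJ_nonneg hp _ _ _ _)) (kz_nonneg _))
    (fun q => KI_pt hw q.1 q.2) hJint.le
  rw [← E1, ← E2]
  refine key.trans (add_le_add ?_ le_rfl)
  refine (ENNReal.ofReal_le_ofReal (le_abs_self _)).trans ?_
  rw [← Real.enorm_eq_ofReal_abs]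
  refine (enorm_integral_le_lintegral_enorm _).trans ?_
  refine lintegral_mono fun x => ?_
  rw [Real.enorm_eq_ofReal_abs]
  apply ENNReal.ofReal_le_ofReal
  rw [abs_mul, abs_mul, abs_of_nonneg (hη.nn x)]
  refine mul_le_mul_of_nonneg_left ?_ (abs_nonneg _)
  exact mul_le_of_le_one_left (abs_nonneg _) (hη.le x)

lemma erF_bound {n : ℕ} {k : ℝ} (hk : 0 < k) {w : Eu n → ℝ} (hw0 : ∀ x, x ∉ ball (0 : Eu n) 1 → w x = 0)
    (x y : Eu n) :
    (¬ (x ∈ ball (0 : Eu n) 1 ∧ y ∈ ball (0 : Eu n) 1) → erF n (etk n k) w x y = 0) ∧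
    |erF n (etk n k) w x y| ≤ (({x | 0 < etk n k x}.indicator (fun x => |w x|) x)) * (4 * min 1 (‖y - x‖ / (1 - ‖x‖)))
      + (({x | 0 < etk n k x}.indicator (fun x => |w x|) y)) * (4 * min 1 (‖x - y‖ / (1 - ‖y‖))) := by
  have c := etk_cut (n := n) hk
  have hz : ∀ x, x ∉ ball (0 : Eu n) 1 → etk n k x = 0 := by
    intro x hx
    refine c.z x fun hc => hx (ball_subset_ball ?_ hc)
    have : 0 < 1 / k := by positivity
    linarith
  have pos : ∀ x y : Eu n, x ∈ ball (0 : Eu n) 1 → 0 ≤ (({x | 0 < etk n k x}.indicator (fun x => |w x|) x)) * (4 * min 1 (‖y - x‖ / (1 - ‖x‖))) := by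
    intro x y hx
    rw [mem_ball_zero_iff] at hx
    have : 0 < 1 - ‖x‖ := by linarith
    refine mul_nonneg (indicator_nonneg (fun _ _ => abs_nonneg _) _) (by positivity)
  have A : ¬ (x ∈ ball (0 : Eu n) 1 ∧ y ∈ ball (0 : Eu n) 1) → erF n (etk n k) w x y = 0 := by
    intro h
    rw [erF, mmF, if_neg h]
    rcases not_and_or.mp h with h | h
    · rw [hz x h, hw0 x h]; ring
    · rw [hz y h, hw0 y h]; ring
  refine ⟨A, ?_⟩
  by_cases h : x ∈ ball (0 : Eu n) 1 ∧ y ∈ ball (0 : Eu n) 1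
  · have px := pos x y h.1
    have py := pos y x h.2
    rw [erF, mmF, if_pos h]
    have key : ∀ x y : Eu n, x ∈ ball (0 : Eu n) 1 → etk n k y ≤ etk n k x → |w x| * (etk n k x - etk n k y) ≤
      (({x | 0 < etk n k x}.indicator (fun x => |w x|) x)) * (4 * min 1 (‖y - x‖ / (1 - ‖x‖))) := by
      intro x y hx hxy
      by_cases h0 : 0 < etk n k x
      · rw [indicator_of_mem (by exact h0)]
        exact mul_le_mul_of_nonneg_left (etk_diff hk hxy (by simpa using hx)) (abs_nonneg _)
      · have e1 : etk n k x = 0 := le_antisymm (not_lt.mp h0) (c.nn x)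
        have e2 : etk n k y = 0 := le_antisymm (hxy.trans e1.le) (c.nn y)
        rw [e1, e2, sub_self, mul_zero]; exact pos x y hx
    rcases le_total (etk n k x) (etk n k y) with hxy | hxy
    · rw [min_eq_left hxy]
      have e : etk n k y * w y - etk n k x * w x - etk n k x * (w y - w x) = w y * (etk n k y - etk n k x) := by ring
      rw [e, abs_mul, abs_of_nonneg (by linarith : 0 ≤ etk n k y - etk n k x)]
      have := key y x h.2 hxy
      linarith
    · rw [min_eq_right hxy]
      have e : etk n k y * w y - etk n k x * w x - etk n k y * (w y - w x) = -(w x * (etk n k x - etk n k y)) := by ring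
      rw [e, abs_neg, abs_mul, abs_of_nonneg (by linarith : 0 ≤ etk n k x - etk n k y)]
      have := key x y h.1 hxy
      linarith
  · rw [A h, abs_zero]
    have gen : ∀ x y : Eu n, 0 ≤ (({x | 0 < etk n k x}.indicator (fun x => |w x|) x)) * (4 * min 1 (‖y - x‖ / (1 - ‖x‖))) := by
      intro x y
      by_cases hx : x ∈ ball (0 : Eu n) 1
      · exact pos x y hx
      · rw [indicator_of_notMem (by simp [hz x hx])]; simp
    have := gen x y; have := gen y x; linarith




/-- error majorant -/
def eA (n : ℕ) (A : Eu n → ℝ) (x y : Eu n) : ℝ := A x * (4 * min 1 (‖y - x‖ / (1 - ‖x‖)))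

/-- Young majorant -/
def Phi (n : ℕ) (p s : ℝ) (u v A : Eu n → ℝ) (μ : ℝ) (x y : Eu n) : ℝ≥0∞ :=
  ENNReal.ofReal μ * (ENNReal.ofReal (|u y - u x| ^ p * kz n s p (y - x)) + ENNReal.ofReal (|v y - v x| ^ p * kz n s p (y - x)))
  + ENNReal.ofReal (μ ^ (1 - p) * 2 ^ (p + 1)) *
    (ENNReal.ofReal (eA n A x y ^ p * kz n s p (y - x)) + ENNReal.ofReal (eA n A y x ^ p * kz n s p (x - y)))

lemma Phi_ge {n : ℕ} {p s : ℝ} (hp : 1 < p) {u v A : Eu n → ℝ} {μ : ℝ} (hμ : 0 < μ) {x y : Eu n} {e : ℝ}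
    (h1 : 0 ≤ eA n A x y) (h2 : 0 ≤ eA n A y x) (he : |e| ≤ eA n A x y + eA n A y x) :
    ENNReal.ofReal (|DJ n p u v x y| * |e| * kz n s p (y - x)) ≤ Phi n p s u v A μ x y := by
  have k0 := kz_nonneg (n := n) (s := s) (p := p) (y - x)
  have kk : kz n s p (x - y) = kz n s p (y - x) := by rw [← kz_neg, neg_sub]
  have hDJ : |DJ n p u v x y| ≤ |u y - u x| ^ (p - 1) + |v y - v x| ^ (p - 1) := by
    rw [← abs_Jp hp, ← abs_Jp hp]; exact abs_sub _ _
  have y1 := young_p hp (abs_nonneg (u y - u x)) (abs_nonneg e) hμ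
  have y2 := young_p hp (abs_nonneg (v y - v x)) (abs_nonneg e) hμ
  have h3 : |e| ^ p ≤ 2 ^ p * (eA n A x y ^ p + eA n A y x ^ p) :=
    (Real.rpow_le_rpow (abs_nonneg _) he (by linarith)).trans (add_rpow_le (by linarith) h1 h2)
  have m0 : 0 ≤ μ ^ (1 - p) := by positivity
  have h4 : |DJ n p u v x y| * |e| ≤ μ * (|u y - u x| ^ p + |v y - v x| ^ p) +
      μ ^ (1 - p) * 2 ^ (p + 1) * (eA n A x y ^ p + eA n A y x ^ p) := by
    have := mul_le_mul_of_nonneg_right hDJ (abs_nonneg e)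
    have h5 := mul_le_mul_of_nonneg_left h3 m0
    rw [Real.rpow_add (by norm_num), Real.rpow_one]
    nlinarith
  have E1 : 0 ≤ eA n A x y ^ p := by positivity
  have E2 : 0 ≤ eA n A y x ^ p := by positivity
  rw [Phi, kk, ← ENNReal.ofReal_add (by positivity) (by positivity), ← ENNReal.ofReal_add (by positivity) (by positivity),
    ← ENNReal.ofReal_mul (by positivity), ← ENNReal.ofReal_mul (by positivity), ← ENNReal.ofReal_add (by positivity) (by positivity)]
  apply ENNReal.ofReal_le_ofReal
  have := mul_le_mul_of_nonneg_right h4 k0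
  linarith

lemma measurable_eA {n : ℕ} {A : Eu n → ℝ} (hA : Measurable A) :
    Measurable (fun q : Eu n × Eu n => eA n A q.1 q.2) := by
  unfold eA; fun_prop

lemma measurable_Phi {n : ℕ} {p s : ℝ} {u v A : Eu n → ℝ} (hu : Measurable u) (hv : Measurable v) (hA : Measurable A) (μ : ℝ) :
    Measurable (fun q : Eu n × Eu n => Phi n p s u v A μ q.1 q.2) := by
  unfold Phi
  have h1 := measurable_eA hA
  have h2 : Measurable (fun q : Eu n × Eu n => eA n A q.2 q.1) := h1.comp measurable_swap
  have k1 : Measurable (fun q : Eu n × Eu n => kz n s p (q.2 - q.1)) := measurable_kz.comp (measurable_snd.sub measurable_fst)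
  have k2 : Measurable (fun q : Eu n × Eu n => kz n s p (q.1 - q.2)) := measurable_kz.comp (measurable_fst.sub measurable_snd)
  fun_prop

lemma lint_lin {X : Type*} [MeasurableSpace X] (μ : Measure X) {a b c d : X → ℝ≥0∞} (ha : Measurable a) (hb : Measurable b)
    (hc : Measurable c) (hd : Measurable d) {m l : ℝ≥0∞} :
    ∫⁻ x, (m * (a x + b x) + l * (c x + d x)) ∂μ =
      m * (∫⁻ x, a x ∂μ + ∫⁻ x, b x ∂μ) + l * (∫⁻ x, c x ∂μ + ∫⁻ x, d x ∂μ) := by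
  rw [lintegral_add_left (by fun_prop), lintegral_const_mul _ (by fun_prop), lintegral_const_mul _ (by fun_prop),
    lintegral_add_left ha, lintegral_add_left hc]

/-- Hardy-type integral -/
def Hd (n : ℕ) (p s : ℝ) (A : Eu n → ℝ) : ℝ≥0∞ :=
  ∫⁻ x in ball (0 : Eu n) 1, ENNReal.ofReal (A x ^ p * (1 - ‖x‖) ^ (-(s * p)))

lemma lint_eA {n : ℕ} (hn : 0 < n) {p s : ℝ} (hp : 1 < p) (hs : 0 < s) (hs1 : s < 1) : ∃ C : ℝ, 0 < C ∧
    ∀ A : Eu n → ℝ, Measurable A → (∀ x, 0 ≤ A x) →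
    ∫⁻ x in ball (0 : Eu n) 1, ∫⁻ y in ball (0 : Eu n) 1, ENNReal.ofReal (eA n A x y ^ p * kz n s p (y - x)) ≤
      ENNReal.ofReal C * Hd n p s A := by
  obtain ⟨C, hC, h⟩ := bary (n := n) hn (s := s) (p := p) (by nlinarith) (by nlinarith)
  refine ⟨4 ^ p * C, by positivity, fun A hA hA0 => ?_⟩
  rw [Hd, ← lintegral_const_mul' _ _ ENNReal.ofReal_ne_top]
  refine setLIntegral_mono' measurableSet_ball fun x hx => ?_
  rw [mem_ball_zero_iff] at hx
  have hd : 0 < 1 - ‖x‖ := by linarith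
  have e : ∀ y, ENNReal.ofReal (eA n A x y ^ p * kz n s p (y - x)) =
      ENNReal.ofReal (4 ^ p * A x ^ p) * ENNReal.ofReal (min 1 (‖y - x‖ / (1 - ‖x‖)) ^ p * kz n s p (y - x)) := by
    intro y
    have := hA0 x
    rw [← ENNReal.ofReal_mul (by positivity), eA, Real.mul_rpow (by positivity) (by positivity), Real.mul_rpow (by positivity) (by positivity)]
    congr 1; ring
  simp_rw [e]
  rw [lintegral_const_mul' _ _ ENNReal.ofReal_ne_top]
  refine (mul_le_mul' le_rfl ((setLIntegral_le_lintegral _ _).trans (h _ hd x))).trans ?_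
  have := hA0 x
  rw [← ENNReal.ofReal_mul (by positivity), ← ENNReal.ofReal_mul (by positivity)]
  apply ENNReal.ofReal_le_ofReal
  apply le_of_eq; ring

lemma lint_Phi {n : ℕ} (hn : 0 < n) {p s : ℝ} (hp : 1 < p) (hs : 0 < s) (hs1 : s < 1) : ∃ C : ℝ, 0 < C ∧
    ∀ u v A : Eu n → ℝ, Measurable u → Measurable v → Measurable A → (∀ x, 0 ≤ A x) → ∀ μ : ℝ, 0 < μ →
    ∫⁻ x in ball (0 : Eu n) 1, ∫⁻ y in ball (0 : Eu n) 1, Phi n p s u v A μ x y ≤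
      ENNReal.ofReal μ * (gagliardoE n s p (ball 0 1) u + gagliardoE n s p (ball 0 1) v) +
      ENNReal.ofReal (C * μ ^ (1 - p)) * Hd n p s A := by
  obtain ⟨C, hC, h⟩ := lint_eA (n := n) hn hp hs hs1
  refine ⟨2 ^ (p + 1) * (2 * C), by positivity, fun u v A hu hv hA hA0 μ hμ => ?_⟩
  have h1 := measurable_eA hA
  have h2 : Measurable (fun q : Eu n × Eu n => eA n A q.2 q.1) := h1.comp measurable_swap
  have k1 : Measurable (fun q : Eu n × Eu n => kz n s p (q.2 - q.1)) := measurable_kz.comp (measurable_snd.sub measurable_fst)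
  have k2 : Measurable (fun q : Eu n × Eu n => kz n s p (q.1 - q.2)) := measurable_kz.comp (measurable_fst.sub measurable_snd)
  have mU : Measurable (fun q : Eu n × Eu n => ENNReal.ofReal (|u q.2 - u q.1| ^ p * kz n s p (q.2 - q.1))) := by fun_prop
  have mV : Measurable (fun q : Eu n × Eu n => ENNReal.ofReal (|v q.2 - v q.1| ^ p * kz n s p (q.2 - q.1))) := by fun_prop
  have m1 : Measurable (fun q : Eu n × Eu n => ENNReal.ofReal (eA n A q.1 q.2 ^ p * kz n s p (q.2 - q.1))) := by fun_prop
  have m2 : Measurable (fun q : Eu n × Eu n => ENNReal.ofReal (eA n A q.2 q.1 ^ p * kz n s p (q.1 - q.2))) := m1.comp measurable_swap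
  have hA1 := h A hA hA0
  have hA2 : ∫⁻ x in ball (0 : Eu n) 1, ∫⁻ y in ball (0 : Eu n) 1, ENNReal.ofReal (eA n A y x ^ p * kz n s p (x - y)) ≤
      ENNReal.ofReal C * Hd n p s A := by
    rw [lintegral_lintegral_swap m2.aemeasurable]; exact hA1
  set ν := (volume : Measure (Eu n)).restrict (ball 0 1) with hν
  rw [← lintegral_prod (μ := ν) (ν := ν) (fun q : Eu n × Eu n => Phi n p s u v A μ q.1 q.2) (measurable_Phi hu hv hA μ).aemeasurable]
  unfold Phi
  rw [lint_lin _ mU mV m1 m2, lintegral_prod _ mU.aemeasurable, lintegral_prod _ mV.aemeasurable,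
    lintegral_prod _ m1.aemeasurable, lintegral_prod _ m2.aemeasurable, gag_eq, gag_eq]
  refine add_le_add le_rfl ((mul_le_mul' le_rfl (add_le_add hA1 hA2)).trans (le_of_eq ?_))
  rw [← add_mul, ← mul_assoc, ← ENNReal.ofReal_add hC.le hC.le, ← ENNReal.ofReal_mul (by positivity)]
  congr 2; ring




lemma mono_abs {p : ℝ} (hp : 1 < p) : ∃ C : ℝ, 0 < C ∧ ∃ l0 : ℝ, 0 < l0 ∧ l0 ≤ 1 ∧ ∀ lam : ℝ, 0 < lam → lam ≤ l0 → ∀ a b : ℝ,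
    |a - b| ^ p ≤ C * (lam ^ (-(1 - thetaP p)) * ((Jp p a - Jp p b) * (a - b)) + lam ^ (thetaP p) * |a| ^ p) := by
  obtain ⟨C, hC, h⟩ := mono_main hp
  have ht := thetaP_pos hp
  have h2 : (0:ℝ) < 2 ^ p := by positivity
  refine ⟨2 * C * (1 + 2 ^ p), by positivity, min 1 ((1 / (2 * 2 ^ p * C)) ^ (1 / thetaP p)), by positivity, min_le_left _ _, fun lam hl hl0 a b => ?_⟩
  have hlt : lam ^ (thetaP p) ≤ 1 / (2 * 2 ^ p * C) := by
    have := Real.rpow_le_rpow hl.le (hl0.trans (min_le_right _ _)) ht.le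
    rwa [← Real.rpow_mul (by positivity), one_div_mul_cancel ht.ne', Real.rpow_one] at this
  have e := h lam hl a b
  have hb : |b| ^ p ≤ 2 ^ p * (|a| ^ p + |a - b| ^ p) := by
    have := abs_sub_rpow_le (q := p) (by linarith) a (a - b)
    rwa [sub_sub_cancel] at this
  have hQ := Q_nonneg hp a b
  have l1 : 0 < lam ^ (-(1 - thetaP p)) := by positivity
  have l2 : 0 < lam ^ (thetaP p) := by positivity
  have ha : 0 ≤ |a| ^ p := by positivity
  have hab : 0 ≤ |a - b| ^ p := by positivity
  set Q := (Jp p a - Jp p b) * (a - b)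
  set L1 := lam ^ (-(1 - thetaP p))
  set L2 := lam ^ (thetaP p)
  have k1 : C * L2 * 2 ^ p ≤ 1 / 2 := by
    have := mul_le_mul_of_nonneg_left hlt (by positivity : 0 ≤ C * 2 ^ p)
    calc C * L2 * 2 ^ p = C * 2 ^ p * L2 := by ring
      _ ≤ _ := this
      _ = 1 / 2 := by field_simp
  have k2 : C * L2 * |b| ^ p ≤ C * L2 * (2 ^ p * (|a| ^ p + |a - b| ^ p)) := mul_le_mul_of_nonneg_left hb (by positivity)
  have k3 : C * L2 * 2 ^ p * |a - b| ^ p ≤ 1 / 2 * |a - b| ^ p := mul_le_mul_of_nonneg_right k1 hab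
  have k4 : |a - b| ^ p ≤ 2 * (C * (L1 * Q) + C * L2 * |a| ^ p + C * L2 * 2 ^ p * |a| ^ p) := by nlinarith
  have k5 : 0 ≤ C * 2 ^ p * (L1 * Q) := by positivity
  nlinarith

lemma lint_BB {n : ℕ} {F : Eu n → Eu n → ℝ≥0∞} (D : Set (Eu n)) (hD : MeasurableSet D)
    (h : ∀ x y, ¬ (x ∈ D ∧ y ∈ D) → F x y = 0) :
    ∫⁻ x, ∫⁻ y, F x y = ∫⁻ x in D, ∫⁻ y in D, F x y := by
  rw [← lintegral_indicator hD]
  congr 1; ext x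
  by_cases hx : x ∈ D
  · rw [indicator_of_mem hx, ← lintegral_indicator hD]
    congr 1; ext y
    by_cases hy : y ∈ D
    · rw [indicator_of_mem hy]
    · rw [indicator_of_notMem hy, h x y (fun c => hy c.2)]
  · rw [indicator_of_notMem hx]
    simp [fun y => h x y (fun c => hx c.1)]

/-- truncated modulus -/
def Ak (n : ℕ) (w : Eu n → ℝ) (k : ℝ) : Eu n → ℝ := {x | 0 < etk n k x}.indicator (fun x => |w x|)

lemma measurable_Ak {n : ℕ} {w : Eu n → ℝ} (hw : Measurable w) (k : ℝ) : Measurable (Ak n w k) :=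
  hw.abs.indicator (measurableSet_lt measurable_const (measurable_etk n k))

lemma Ak_nonneg {n : ℕ} (w : Eu n → ℝ) (k : ℝ) (x : Eu n) : 0 ≤ Ak n w k x := indicator_nonneg (fun _ _ => abs_nonneg _) _

lemma Ak_le {n : ℕ} (w : Eu n → ℝ) (k : ℝ) (x : Eu n) : Ak n w k x ≤ |w x| := by
  unfold Ak
  exact indicator_le_self' (fun _ _ => abs_nonneg _) _

lemma eA_nonneg {n : ℕ} {A : Eu n → ℝ} (hA : ∀ x, 0 ≤ A x) {x : Eu n} (hx : x ∈ ball (0 : Eu n) 1) (y : Eu n) : 0 ≤ eA n A x y := by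
  rw [mem_ball_zero_iff] at hx
  have : 0 < 1 - ‖x‖ := by linarith
  exact mul_nonneg (hA x) (by positivity)

lemma err_k {n : ℕ} (hn : 0 < n) {p s : ℝ} (hp : 1 < p) (hs : 0 < s) (hs1 : s < 1) : ∃ C : ℝ, 0 < C ∧
    ∀ u v w : Eu n → ℝ, Measurable u → Measurable v → Measurable w → (∀ x, x ∉ ball (0 : Eu n) 1 → w x = 0) →
    ∀ k : ℝ, 0 < k → ∀ μ : ℝ, 0 < μ →
    ∫⁻ x, ∫⁻ y, ENNReal.ofReal (|DJ n p u v x y| * |erF n (etk n k) w x y| * kz n s p (y - x)) ≤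
      ENNReal.ofReal μ * (gagliardoE n s p (ball 0 1) u + gagliardoE n s p (ball 0 1) v) +
      ENNReal.ofReal (C * μ ^ (1 - p)) * Hd n p s (Ak n w k) := by
  obtain ⟨C, hC, h⟩ := lint_Phi (n := n) hn hp hs hs1
  refine ⟨C, hC, fun u v w hu hv hw hw0 k hk μ hμ => ?_⟩
  refine le_trans ?_ (h u v (Ak n w k) hu hv (measurable_Ak hw k) (Ak_nonneg w k) μ hμ)
  rw [lint_BB (ball (0 : Eu n) 1) measurableSet_ball]
  · refine setLIntegral_mono' measurableSet_ball fun x hx => setLIntegral_mono' measurableSet_ball fun y hy => ?_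
    exact Phi_ge hp hμ (eA_nonneg (Ak_nonneg w k) hx _) (eA_nonneg (Ak_nonneg w k) hy _) (erF_bound hk hw0 x y).2
  · intro x y hxy
    rw [(erF_bound hk hw0 x y).1 hxy]; simp

lemma hardy_low {n : ℕ} (hn : 0 < n) {p s : ℝ} (hp : 1 < p) (hs : 0 < s) : ∃ C : ℝ, 0 < C ∧
    ∀ u v w η : Eu n → ℝ, Measurable u → Measurable v → Measurable η → (∀ x, w x = u x - v x) →
    (∀ x, x ∉ ball (0 : Eu n) 1 → w x = 0) → (∀ x, 0 ≤ η x) → (∀ x, η x ≤ 1) → (∀ x, x ∉ ball (0 : Eu n) 1 → η x = 0) →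
    ∫⁻ x in ball (0 : Eu n) 1, ENNReal.ofReal (η x * |w x| ^ p * (1 - ‖x‖) ^ (-(s * p))) ≤
      ENNReal.ofReal C * ((∫⁻ x, ∫⁻ y, ENNReal.ofReal (mmF n η x y * QJ n p u v x y * kz n s p (y - x))) +
        gagliardoE n s p (ball 0 2) u) := by
  obtain ⟨C, hC, l0, hl0, -, h⟩ := mono_abs hp
  obtain ⟨c, hc, hk⟩ := kappa_lower (n := n) hn (s := s) (p := p) (by nlinarith)
  have ht := thetaP_pos hp
  set M := C * (l0 ^ (-(1 - thetaP p)) + l0 ^ (thetaP p)) with hM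
  have hM0 : 0 < M := by positivity
  refine ⟨c⁻¹ * M, by positivity, fun u v w η hu hv hη hw hw0 h0 h1 hz => ?_⟩
  have mK := measM1 (s := s) (p := p) hη hu hv
  have pt : ∀ x ∈ ball (0 : Eu n) 1, ∀ y ∈ ball (0 : Eu n) 2 \ ball 0 1,
      η x * |w x| ^ p * kz n s p (y - x) ≤ M * (mmF n η x y * QJ n p u v x y * kz n s p (y - x) + |u y - u x| ^ p * kz n s p (y - x)) := by
    intro x hx y hy
    have e := h l0 hl0 le_rfl (u y - u x) (v y - v x)
    have e1 : |(u y - u x) - (v y - v x)| = |w x| := by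
      have := hw0 y hy.2
      rw [hw] at this
      have : u y - u x - (v y - v x) = - (u x - v x) := by linarith
      rw [this, abs_neg, hw]
    have em : mmF n η x y = η x := by
      rw [mmF, if_neg (fun c => hy.2 c.2), hz y hy.2, add_zero]
    rw [e1] at e
    have k0 := kz_nonneg (n := n) (s := s) (p := p) (y - x)
    rw [em, ← add_mul, ← mul_assoc]
    refine mul_le_mul_of_nonneg_right ?_ k0
    have hQ := QJ_nonneg hp u v x y
    have hQ' : QJ n p u v x y = (Jp p (u y - u x) - Jp p (v y - v x)) * (u y - u x - (v y - v x)) := rfl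
    rw [← hQ'] at e
    have l1 : 0 < l0 ^ (-(1 - thetaP p)) := by positivity
    have l2 : 0 < l0 ^ (thetaP p) := by positivity
    have ha : 0 ≤ |u y - u x| ^ p := by positivity
    generalize QJ n p u v x y = Q at *
    generalize |u y - u x| ^ p = a at *
    generalize l0 ^ (-(1 - thetaP p)) = L1 at *
    generalize l0 ^ (thetaP p) = L2 at *
    have i1 : η x * |w x| ^ p ≤ η x * (C * (L1 * Q + L2 * a)) := mul_le_mul_of_nonneg_left e (h0 x)
    refine i1.trans ?_
    rw [hM]
    have j1 : 0 ≤ C * L2 * (η x * Q) := by have := h0 x; positivity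
    have j2 : 0 ≤ C * (L1 * a) := by positivity
    have j3 : C * L2 * (η x * a) ≤ C * L2 * a := by
      refine mul_le_mul_of_nonneg_left (mul_le_of_le_one_left ha (h1 x)) (by positivity)
    nlinarith
  have ci : ENNReal.ofReal (c⁻¹ * M) = ENNReal.ofReal c⁻¹ * ENNReal.ofReal M := ENNReal.ofReal_mul (by positivity)
  have step : ∀ x ∈ ball (0 : Eu n) 1, ENNReal.ofReal (η x * |w x| ^ p * (1 - ‖x‖) ^ (-(s * p))) ≤
      ENNReal.ofReal (c⁻¹ * M) * ((∫⁻ y, ENNReal.ofReal (mmF n η x y * QJ n p u v x y * kz n s p (y - x))) +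
        ∫⁻ y in ball (0 : Eu n) 2, ENNReal.ofReal (|u y - u x| ^ p * kz n s p (y - x))) := by
    intro x hx
    have hx' := hx
    rw [mem_ball_zero_iff] at hx'
    have hd : 0 < 1 - ‖x‖ := by linarith
    have e0 : 0 ≤ η x * |w x| ^ p := by have := h0 x; positivity
    have e1 : ENNReal.ofReal (η x * |w x| ^ p * (1 - ‖x‖) ^ (-(s * p))) =
      ENNReal.ofReal c⁻¹ * (ENNReal.ofReal (η x * |w x| ^ p) * ENNReal.ofReal (c * (1 - ‖x‖) ^ (-(s * p)))) := by
      rw [← ENNReal.ofReal_mul e0, ← ENNReal.ofReal_mul (by positivity)]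
      congr 1; field_simp
    rw [e1, ci, mul_assoc]
    refine mul_le_mul' le_rfl ((mul_le_mul' le_rfl (hk x hx)).trans ?_)
    rw [← lintegral_const_mul' _ _ ENNReal.ofReal_ne_top]
    have mq : Measurable fun y => ENNReal.ofReal (mmF n η x y * QJ n p u v x y * kz n s p (y - x)) :=
      (mK.comp (measurable_prodMk_left (x := x))).ennreal_ofReal
    calc _ ≤ ∫⁻ y in ball (0 : Eu n) 2 \ ball 0 1, ENNReal.ofReal M * (ENNReal.ofReal (mmF n η x y * QJ n p u v x y * kz n s p (y - x))
            + ENNReal.ofReal (|u y - u x| ^ p * kz n s p (y - x))) := by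
          refine setLIntegral_mono' (measurableSet_ball.diff measurableSet_ball) fun y hy => ?_
          have k0 := kz_nonneg (n := n) (s := s) (p := p) (y - x)
          rw [← ENNReal.ofReal_mul e0, ← ENNReal.ofReal_add (mul_nonneg (mul_nonneg (mmF_nonneg h0 _ _) (QJ_nonneg hp _ _ _ _)) k0)
            (by positivity), ← ENNReal.ofReal_mul hM0.le]
          exact ENNReal.ofReal_le_ofReal (pt x hx y hy)
      _ = ENNReal.ofReal M * ((∫⁻ y in ball (0 : Eu n) 2 \ ball 0 1, ENNReal.ofReal (mmF n η x y * QJ n p u v x y * kz n s p (y - x)))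
            + ∫⁻ y in ball (0 : Eu n) 2 \ ball 0 1, ENNReal.ofReal (|u y - u x| ^ p * kz n s p (y - x))) := by
          rw [lintegral_const_mul' _ _ ENNReal.ofReal_ne_top, lintegral_add_left mq]
      _ ≤ _ := mul_le_mul' le_rfl (add_le_add (setLIntegral_le_lintegral _ _) (lintegral_mono_set diff_subset))
  refine (setLIntegral_mono' measurableSet_ball step).trans ?_
  rw [lintegral_const_mul' _ _ ENNReal.ofReal_ne_top, lintegral_add_left, gag_eq]
  · refine mul_le_mul' le_rfl (add_le_add (setLIntegral_le_lintegral _ _) (lintegral_mono_set (ball_subset_ball (by norm_num))))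
  · exact mK.ennreal_ofReal.lintegral_prod_right'

lemma iter_abs {a : ℕ → ℝ≥0∞} {M N : ℝ≥0∞} {ε b : ℝ} (hε : 0 ≤ ε) (hε2 : ε ≤ 1 / 2) (hb : 0 ≤ b) (hεb : ε * b ≤ 1 / 2)
    (hM : M < ⊤) (hN : N < ⊤) (h1 : ∀ j, a j ≤ M + ENNReal.ofReal ε * a (j + 1))
    (h2 : ∀ j, a j ≤ ENNReal.ofReal (b ^ j) * N) (j : ℕ) : a j ≤ 2 * M := by
  have af : ∀ j, a j ≠ ⊤ := fun j => ((h2 j).trans_lt (ENNReal.mul_lt_top ENNReal.ofReal_lt_top hN)).ne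
  lift M to NNReal using hM.ne
  lift N to NNReal using hN.ne
  lift a to ℕ → NNReal using af
  lift ε to NNReal using hε
  lift b to NNReal using hb
  simp only [ENNReal.ofReal_coe_nnreal] at h1 h2 ⊢
  have h2' : ∀ j, (a j : ℝ) ≤ (b:ℝ) ^ j * N := by
    intro j
    have := h2 j
    rw [← NNReal.coe_pow, ENNReal.ofReal_coe_nnreal] at this
    exact_mod_cast this
  have h1' : ∀ j, (a j : ℝ) ≤ M + ε * a (j + 1) := fun j => by exact_mod_cast h1 j
  have P : ∀ m : ℕ, ∀ j, (a j : ℝ) ≤ 2 * M + (1 / 2) ^ m * (b ^ j * N) := by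
    intro m
    induction m with
    | zero => intro j; have := h2' j; have := M.2; simp; linarith
    | succ m ih =>
      intro j
      have i1 := h1' j
      have i2 := mul_le_mul_of_nonneg_left (ih (j + 1)) (NNReal.coe_nonneg ε)
      rw [mul_add] at i2
      have i3 : (ε:ℝ) * (2 * M) ≤ M := by have := mul_le_mul_of_nonneg_right hε2 M.2; simp at this; nlinarith
      have i4 : (ε:ℝ) * ((1 / 2) ^ m * (b ^ (j + 1) * N)) ≤ (1 / 2) ^ (m + 1) * (b ^ j * N) := by
        calc (ε:ℝ) * ((1 / 2) ^ m * (b ^ (j + 1) * N)) = (ε * b) * ((1 / 2) ^ m * (b ^ j * N)) := by ring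
          _ ≤ 1 / 2 * ((1 / 2) ^ m * (b ^ j * N)) := mul_le_mul_of_nonneg_right hεb (by positivity)
          _ = _ := by ring
      linarith
  have : (a j : ℝ) ≤ 2 * M := by
    have T : Filter.Tendsto (fun m : ℕ => 2 * (M:ℝ) + (1 / 2) ^ m * (b ^ j * N)) Filter.atTop (nhds (2 * M + 0 * (b ^ j * N))) :=
      ((tendsto_pow_atTop_nhds_zero_of_lt_one (by norm_num) (by norm_num)).mul_const _).const_add _
    rw [zero_mul, add_zero] at T
    exact ge_of_tendsto' T fun m => P m j
  exact_mod_cast this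




lemma etk_out {n : ℕ} {k : ℝ} (hk : 0 < k) (x : Eu n) (hx : x ∉ ball (0 : Eu n) 1) : etk n k x = 0 := by
  refine (etk_cut (n := n) hk).z x fun hc => hx (ball_subset_ball ?_ hc)
  have : 0 < 1 / k := by positivity
  linarith

lemma Hd_Ak_le {n : ℕ} {p s : ℝ} (hp : 1 < p) (hs : 0 < s) (w : Eu n → ℝ) {k : ℝ} (hk : 0 < k) :
    Hd n p s (Ak n w k) ≤ ENNReal.ofReal (k ^ (s * p)) * Nr n p 1 w := by
  unfold Hd Nr
  rw [← lintegral_const_mul' _ _ ENNReal.ofReal_ne_top]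
  refine setLIntegral_mono' measurableSet_ball fun x hx => ?_
  rw [mem_ball_zero_iff] at hx
  rw [← ENNReal.ofReal_mul (by positivity)]
  apply ENNReal.ofReal_le_ofReal
  by_cases h0 : 0 < etk n k x
  · have h1 := etk_pos hk h0
    have hd : 0 < 1 / k := by positivity
    have e : Ak n w k x = |w x| := indicator_of_mem (by exact h0) _
    rw [e, mul_comm]
    refine mul_le_mul_of_nonneg_right ?_ (by positivity)
    have := Real.rpow_le_rpow_of_nonpos hd h1 (z := -(s * p)) (by nlinarith)
    refine this.trans (le_of_eq ?_)
    rw [one_div, Real.inv_rpow hk.le, Real.rpow_neg hk.le, inv_inv]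
  · have e : Ak n w k x = 0 := indicator_of_notMem (by exact h0) _
    rw [e, Real.zero_rpow (by linarith), zero_mul]; positivity

lemma Hd_half {n : ℕ} {p s : ℝ} (hp : 1 < p) (w : Eu n → ℝ) {k : ℝ} (hk : 0 < k) :
    Hd n p s (Ak n w (k / 2)) ≤ ∫⁻ x in ball (0 : Eu n) 1, ENNReal.ofReal (etk n k x * |w x| ^ p * (1 - ‖x‖) ^ (-(s * p))) := by
  refine setLIntegral_mono' measurableSet_ball fun x hx => ?_
  rw [mem_ball_zero_iff] at hx
  have hd : 0 < 1 - ‖x‖ := by linarith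
  apply ENNReal.ofReal_le_ofReal
  refine mul_le_mul_of_nonneg_right ?_ (by positivity)
  by_cases h0 : 0 < etk n (k / 2) x
  · have h1 := etk_pos (by positivity) h0
    have e : Ak n w (k / 2) x = |w x| := indicator_of_mem (by exact h0) _
    rw [etk_one hk (by rw [one_div_div] at h1; exact h1), one_mul, e]
  · have e : Ak n w (k / 2) x = 0 := indicator_of_notMem (by exact h0) _
    rw [e, Real.zero_rpow (by linarith)]
    have := (etk_cut (n := n) hk).nn x
    positivity

lemma fw_fin {n : ℕ} {p : ℝ} (hp : 1 < p) {f w : Eu n → ℝ} (hf : Measurable f) (hw : Measurable w) {μ : ℝ} (hμ : 0 < μ) :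
    ∫⁻ x in ball (0 : Eu n) 1, ENNReal.ofReal (|f x| * |w x|) ≤
      ENNReal.ofReal μ * Nr n (p / (p - 1)) 1 f + ENNReal.ofReal (μ ^ (1 - p)) * Nr n p 1 w := by
  unfold Nr
  rw [← lintegral_const_mul' _ _ ENNReal.ofReal_ne_top, ← lintegral_const_mul' _ _ ENNReal.ofReal_ne_top,
    ← lintegral_add_left (by fun_prop)]
  refine lintegral_mono fun x => ?_
  rw [← ENNReal.ofReal_mul (by positivity), ← ENNReal.ofReal_mul (by positivity), ← ENNReal.ofReal_add (by positivity) (by positivity)]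
  exact ENNReal.ofReal_le_ofReal (young_conj hp (abs_nonneg _) (abs_nonneg _) hμ)

lemma Cmp.w_lp {n : ℕ} {p s : ℝ} (hp : 1 < p) {f u v w : Eu n → ℝ} (h : Cmp n p s f u v) (hw : ∀ x, w x = u x - v x) :
    Nr n p 1 w < ⊤ := by
  have e : w = fun x => u x - v x := funext hw
  rw [e]
  exact (Nr_sub_le (by linarith) h.su.mU).trans_lt (ENNReal.mul_lt_top ENNReal.ofReal_lt_top (ENNReal.add_lt_top.mpr ⟨h.su.lp, h.sv.lp⟩))

lemma Cmp.w_out {n : ℕ} {p s : ℝ} {f u v w : Eu n → ℝ} (h : Cmp n p s f u v) (hw : ∀ x, w x = u x - v x) :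
    ∀ x, x ∉ ball (0 : Eu n) 1 → w x = 0 := fun x hx => by rw [hw, h.out x hx, sub_self]

lemma Cmp.w_m {n : ℕ} {p s : ℝ} {f u v w : Eu n → ℝ} (h : Cmp n p s f u v) (hw : ∀ x, w x = u x - v x) :
    Measurable w := by
  have e : w = fun x => u x - v x := funext hw
  rw [e]; exact h.su.mU.sub h.sv.mU

lemma Cmp.hardy {n : ℕ} (hn : 0 < n) {p s : ℝ} (hp : 1 < p) (hs : 0 < s) (hs1 : s < 1) {f u v w : Eu n → ℝ}
    (h : Cmp n p s f u v) (hw : ∀ x, w x = u x - v x) : Hd n p s (fun x => |w x|) < ⊤ := by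
  obtain ⟨C1, hC1, H1⟩ := hardy_low (n := n) hn hp hs
  obtain ⟨C2, hC2, H2⟩ := err_k (n := n) hn hp hs hs1
  have wm := h.w_m hw
  have w0 := h.w_out hw
  set b : ℝ := 2 ^ (s * p) with hb
  have hb0 : 0 < b := by positivity
  set ε : ℝ := min (1 / 2) (1 / (2 * b)) with hε
  have hε0 : 0 < ε := by positivity
  set μ : ℝ := (ε / (C1 * C2)) ^ (1 / (1 - p)) with hμ
  have hμ0 : 0 < μ := by positivity
  have hμp : μ ^ (1 - p) = ε / (C1 * C2) := by
    rw [hμ, ← Real.rpow_mul (by positivity), one_div_mul_cancel (by linarith), Real.rpow_one]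
  have N := h.w_lp hp hw
  set E0 := gagliardoE n s p (ball 0 1) u + gagliardoE n s p (ball 0 1) v with hE0
  have hE0f : E0 < ⊤ := ENNReal.add_lt_top.mpr ⟨h.su.gag, h.sv.gag⟩
  set FW := ∫⁻ x in ball (0 : Eu n) 1, ENNReal.ofReal (|f x| * |w x|) with hFW
  have hFWf : FW < ⊤ := by
    refine (fw_fin hp h.su.mf wm one_pos).trans_lt ?_
    exact ENNReal.add_lt_top.mpr ⟨ENNReal.mul_lt_top ENNReal.ofReal_lt_top h.su.F, ENNReal.mul_lt_top ENNReal.ofReal_lt_top N⟩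
  set U := gagliardoE n s p (ball 0 2) u with hU
  have hUf : U < ⊤ := h.gu
  have step : ∀ k : ℝ, 0 < k → Hd n p s (Ak n w (k / 2)) ≤
      ENNReal.ofReal C1 * (FW + ENNReal.ofReal μ * E0 + U) + ENNReal.ofReal ε * Hd n p s (Ak n w k) := by
    intro k hk
    have hc := etk_cut (n := n) hk
    have hk1 : 1 - 1 / k < 1 := by have : 0 < 1 / k := by positivity
                                   linarith
    have a1 := H1 u v w (etk n k) h.su.mU h.sv.mU hc.m hw w0 hc.nn hc.le (etk_out hk)
    have a2 := KI hn hp hs hs1 h hk1 hc wm hw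
    have a3 := H2 u v w h.su.mU h.sv.mU wm w0 k hk μ hμ0
    refine (Hd_half hp w hk).trans (a1.trans ?_)
    refine (mul_le_mul' le_rfl (add_le_add (a2.trans (add_le_add le_rfl a3)) le_rfl)).trans (le_of_eq ?_)
    rw [hμp]
    have e : ENNReal.ofReal ε = ENNReal.ofReal C1 * ENNReal.ofReal (C2 * (ε / (C1 * C2))) := by
      rw [← ENNReal.ofReal_mul hC1.le]; congr 1; field_simp
    rw [e]; ring
  have it : ∀ j : ℕ, Hd n p s (Ak n w (2 ^ j)) ≤ 2 * (ENNReal.ofReal C1 * (FW + ENNReal.ofReal μ * E0 + U)) := by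
    refine iter_abs (N := Nr n p 1 w) (ε := ε) (b := b) hε0.le (min_le_left _ _) hb0.le ?_ ?_ N ?_ ?_
    · have := mul_le_mul_of_nonneg_right (min_le_right (1 / 2) (1 / (2 * b))) hb0.le
      refine this.trans (le_of_eq ?_); field_simp
    · refine ENNReal.mul_lt_top ENNReal.ofReal_lt_top (ENNReal.add_lt_top.mpr ⟨ENNReal.add_lt_top.mpr ⟨hFWf, ?_⟩, hUf⟩)
      exact ENNReal.mul_lt_top ENNReal.ofReal_lt_top hE0f
    · intro j
      have := step (2 ^ (j + 1)) (by positivity)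
      rwa [show (2:ℝ) ^ (j + 1) / 2 = 2 ^ j by rw [pow_succ]; ring] at this
    · intro j
      refine (Hd_Ak_le hp hs w (by positivity)).trans (le_of_eq ?_)
      congr 2
      rw [hb, ← Real.rpow_natCast, ← Real.rpow_natCast, ← Real.rpow_mul (by norm_num), ← Real.rpow_mul (by norm_num), mul_comm]
  have fin : 2 * (ENNReal.ofReal C1 * (FW + ENNReal.ofReal μ * E0 + U)) < ⊤ := by
    refine ENNReal.mul_lt_top (by simp) (ENNReal.mul_lt_top ENNReal.ofReal_lt_top (ENNReal.add_lt_top.mpr ⟨ENNReal.add_lt_top.mpr ⟨hFWf, ?_⟩, hUf⟩))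
    exact ENNReal.mul_lt_top ENNReal.ofReal_lt_top hE0f
  refine lt_of_le_of_lt ?_ fin
  unfold Hd at it ⊢
  simp_rw [← lintegral_indicator (measurableSet_ball (x := (0 : Eu n)) (ε := 1))] at it ⊢
  refine fatou_ev volume (fun j => ?_) (fun x => ?_) it
  · have := measurable_Ak wm (2 ^ j)
    exact Measurable.indicator (by fun_prop) measurableSet_ball
  · by_cases hx : x ∈ ball (0 : Eu n) 1
    · have hd : 0 < 1 - ‖x‖ := by rw [mem_ball_zero_iff] at hx; linarith
      have T : ∀ᶠ j : ℕ in Filter.atTop, 2 / (1 - ‖x‖) ≤ (2:ℝ) ^ j :=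
        (tendsto_pow_atTop_atTop_of_one_lt (by norm_num)).eventually_ge_atTop _
      filter_upwards [T] with j hj
      rw [indicator_of_mem hx, indicator_of_mem hx]
      have e1 : etk n (2 ^ j) x = 1 := etk_one (by positivity) (by
        rw [div_le_iff₀ hd] at hj
        rw [div_le_iff₀ (by positivity)]; linarith)
      have e : Ak n w (2 ^ j) x = |w x| := indicator_of_mem (by simp [e1]) _
      rw [e]
    · simp [indicator_of_notMem hx]




lemma etk_ev {n : ℕ} {x : Eu n} (hx : x ∈ ball (0 : Eu n) 1) : ∀ᶠ j : ℕ in Filter.atTop, etk n (2 ^ j) x = 1 := by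
  have hd : 0 < 1 - ‖x‖ := by rw [mem_ball_zero_iff] at hx; linarith
  have T : ∀ᶠ j : ℕ in Filter.atTop, 2 / (1 - ‖x‖) ≤ (2:ℝ) ^ j :=
    (tendsto_pow_atTop_atTop_of_one_lt (by norm_num)).eventually_ge_atTop _
  filter_upwards [T] with j hj
  refine etk_one (by positivity) ?_
  rw [div_le_iff₀ hd] at hj
  rw [div_le_iff₀ (by positivity)]; linarith

lemma erF_ev {n : ℕ} {w : Eu n → ℝ} (hw0 : ∀ x, x ∉ ball (0 : Eu n) 1 → w x = 0) (x y : Eu n) :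
    ∀ᶠ j : ℕ in Filter.atTop, erF n (etk n (2 ^ j)) w x y = 0 := by
  by_cases h : x ∈ ball (0 : Eu n) 1 ∧ y ∈ ball (0 : Eu n) 1
  · filter_upwards [etk_ev h.1, etk_ev h.2] with j h1 h2
    rw [erF, mmF, if_pos h, h1, h2]; simp
  · exact Filter.Eventually.of_forall fun j => (erF_bound (by positivity) hw0 x y).1 h

lemma mmF_ev {n : ℕ} {p : ℝ} {u v : Eu n → ℝ} (hout : ∀ x, x ∉ ball (0 : Eu n) 1 → v x = u x) (x y : Eu n) :
    ∀ᶠ j : ℕ in Filter.atTop, mmF n (etk n (2 ^ j)) x y * QJ n p u v x y = QJ n p u v x y := by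
  by_cases hx : x ∈ ball (0 : Eu n) 1
  · by_cases hy : y ∈ ball (0 : Eu n) 1
    · filter_upwards [etk_ev hx, etk_ev hy] with j h1 h2
      rw [mmF, if_pos ⟨hx, hy⟩, h1, h2]; simp
    · filter_upwards [etk_ev hx] with j h1
      rw [mmF, if_neg (fun c => hy c.2), h1, etk_out (by positivity) y hy]; simp
  · by_cases hy : y ∈ ball (0 : Eu n) 1
    · filter_upwards [etk_ev hy] with j h1
      rw [mmF, if_neg (fun c => hx c.1), h1, etk_out (by positivity) x hx]; simp
    · refine Filter.Eventually.of_forall fun j => ?_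
      rw [QJ, hout x hx, hout y hy]; simp

lemma Cmp.err_tendsto {n : ℕ} (hn : 0 < n) {p s : ℝ} (hp : 1 < p) (hs : 0 < s) (hs1 : s < 1) {f u v w : Eu n → ℝ}
    (h : Cmp n p s f u v) (hw : ∀ x, w x = u x - v x) :
    Filter.Tendsto (fun j : ℕ => ∫⁻ x, ∫⁻ y, ENNReal.ofReal (|DJ n p u v x y| * |erF n (etk n (2 ^ j)) w x y| * kz n s p (y - x)))
      Filter.atTop (nhds 0) := by
  obtain ⟨C, hC, H⟩ := lint_Phi (n := n) hn hp hs hs1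
  have wm := h.w_m hw
  have w0 := h.w_out hw
  have hH := h.hardy hn hp hs hs1 hw
  have hB : MeasurableSet ((ball (0 : Eu n) 1) ×ˢ (ball (0 : Eu n) 1)) := measurableSet_ball.prod measurableSet_ball
  have mP := measurable_Phi (n := n) (p := p) (s := s) h.su.mU h.sv.mU wm.abs 1
  have mM : ∀ j : ℕ, Measurable (fun q : Eu n × Eu n => ENNReal.ofReal (|DJ n p u v q.1 q.2| * |erF n (etk n (2 ^ j)) w q.1 q.2| * kz n s p (q.2 - q.1))) :=
    fun j => (measM2 (measurable_etk n (2 ^ j)) h.su.mU h.sv.mU wm).ennreal_ofReal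
  have D := tendsto_lintegral_of_dominated_convergence (μ := (volume : Measure (Eu n)).prod volume)
    (F := fun (j : ℕ) (q : Eu n × Eu n) => ENNReal.ofReal (|DJ n p u v q.1 q.2| * |erF n (etk n (2 ^ j)) w q.1 q.2| * kz n s p (q.2 - q.1)))
    (f := fun _ => 0)
    (((ball (0 : Eu n) 1) ×ˢ (ball (0 : Eu n) 1)).indicator (fun q => Phi n p s u v (fun x => |w x|) 1 q.1 q.2)) mM ?_ ?_ ?_
  · simp only [lintegral_zero] at D
    refine D.congr fun j => ?_
    rw [lintegral_prod _ (mM j).aemeasurable]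
  · intro j
    refine Filter.Eventually.of_forall fun q => ?_
    by_cases hq : q.1 ∈ ball (0 : Eu n) 1 ∧ q.2 ∈ ball (0 : Eu n) 1
    · rw [indicator_of_mem (by exact hq)]
      have p1 := eA_nonneg (A := fun x => |w x|) (fun x => abs_nonneg _) hq.1 q.2
      have p2 := eA_nonneg (A := fun x => |w x|) (fun x => abs_nonneg _) hq.2 q.1
      refine Phi_ge hp one_pos p1 p2 ((erF_bound (k := 2 ^ j) (by positivity) w0 q.1 q.2).2.trans ?_)
      have hx := hq.1
      have hy := hq.2
      rw [mem_ball_zero_iff] at hx hy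
      have d1 : 0 < 1 - ‖q.1‖ := by linarith
      have d2 : 0 < 1 - ‖q.2‖ := by linarith
      exact add_le_add (mul_le_mul_of_nonneg_right (Ak_le w (2 ^ j) _) (by positivity))
        (mul_le_mul_of_nonneg_right (Ak_le w (2 ^ j) _) (by positivity))
    · dsimp only
      rw [(erF_bound (by positivity) w0 q.1 q.2).1 hq]; simp
  · rw [lintegral_indicator hB, ← Measure.prod_restrict, lintegral_prod _ mP.aemeasurable]
    refine ((H u v _ h.su.mU h.sv.mU wm.abs (fun x => abs_nonneg _) 1 one_pos).trans_lt ?_).ne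
    refine ENNReal.add_lt_top.mpr ⟨ENNReal.mul_lt_top ENNReal.ofReal_lt_top (ENNReal.add_lt_top.mpr ⟨h.su.gag, h.sv.gag⟩),
      ENNReal.mul_lt_top ENNReal.ofReal_lt_top hH⟩
  · refine Filter.Eventually.of_forall fun q => tendsto_const_nhds.congr' ?_
    filter_upwards [erF_ev w0 q.1 q.2] with j hj
    rw [hj]; simp

lemma Cmp.energy {n : ℕ} (hn : 0 < n) {p s : ℝ} (hp : 1 < p) (hs : 0 < s) (hs1 : s < 1) {f u v w : Eu n → ℝ}
    (h : Cmp n p s f u v) (hw : ∀ x, w x = u x - v x) :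
    ∫⁻ x, ∫⁻ y, ENNReal.ofReal (QJ n p u v x y * kz n s p (y - x)) ≤
      ∫⁻ x in ball (0 : Eu n) 1, ENNReal.ofReal (|f x| * |w x|) := by
  have T := h.err_tendsto hn hp hs hs1 hw
  have wm := h.w_m hw
  have mQ : Measurable (fun q : Eu n × Eu n => ENNReal.ofReal (QJ n p u v q.1 q.2 * kz n s p (q.2 - q.1))) :=
    ((measurable_QJ h.su.mU h.sv.mU).mul (measurable_kz.comp (measurable_snd.sub measurable_fst))).ennreal_ofReal
  have mM : ∀ j : ℕ, Measurable (fun q : Eu n × Eu n => ENNReal.ofReal (mmF n (etk n (2 ^ j)) q.1 q.2 * QJ n p u v q.1 q.2 * kz n s p (q.2 - q.1))) :=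
    fun j => (measM1 (measurable_etk n (2 ^ j)) h.su.mU h.sv.mU).ennreal_ofReal
  refine ENNReal.le_of_forall_pos_le_add fun ε hε _ => ?_
  have ev := T.eventually (ge_mem_nhds (show (0:ℝ≥0∞) < ε by exact_mod_cast hε))
  obtain ⟨J, hJ⟩ := Filter.eventually_atTop.mp ev
  rw [← lintegral_prod (fun q : Eu n × Eu n => ENNReal.ofReal (QJ n p u v q.1 q.2 * kz n s p (q.2 - q.1))) mQ.aemeasurable]
  refine fatou_ev (volume.prod volume) (fun j => mM (j + J)) (fun q => ?_) (fun j => ?_)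
  · have := (Filter.tendsto_add_atTop_nat J).eventually (mmF_ev (p := p) h.out q.1 q.2)
    filter_upwards [this] with j hj
    rw [hj]
  · rw [lintegral_prod _ (mM (j + J)).aemeasurable]
    have hk : (0:ℝ) < 2 ^ (j + J) := by positivity
    have hc := etk_cut (n := n) hk
    have hk1 : 1 - 1 / (2:ℝ) ^ (j + J) < 1 := by
      have : 0 < 1 / (2:ℝ) ^ (j + J) := by positivity
      linarith
    exact (KI hn hp hs hs1 h hk1 hc wm hw).trans (add_le_add le_rfl (hJ (j + J) (by omega)))




lemma poinc {n : ℕ} (hn : 0 < n) {p s : ℝ} (hp : 1 < p) (hs : 0 < s) : ∃ C : ℝ, 0 < C ∧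
    ∀ w : Eu n → ℝ, (∀ x, x ∉ ball (0 : Eu n) 1 → w x = 0) →
    Nr n p 1 w ≤ ENNReal.ofReal C * gagliardoE n s p (ball 0 2) w := by
  obtain ⟨c, hc, hk⟩ := kappa_lower (n := n) hn (s := s) (p := p) (by nlinarith)
  refine ⟨c⁻¹, by positivity, fun w hw0 => ?_⟩
  have ci : ENNReal.ofReal c⁻¹ * ENNReal.ofReal c = 1 := by
    rw [← ENNReal.ofReal_mul (by positivity), inv_mul_cancel₀ hc.ne', ENNReal.ofReal_one]
  rw [gag_eq, ← lintegral_const_mul' _ _ ENNReal.ofReal_ne_top]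
  refine le_trans ?_ (lintegral_mono_set (ball_subset_ball (by norm_num : (1:ℝ) ≤ 2)))
  refine setLIntegral_mono' measurableSet_ball fun x hx => ?_
  have hx' := hx
  rw [mem_ball_zero_iff] at hx'
  have hd : 0 < 1 - ‖x‖ := by linarith
  have h1 : ENNReal.ofReal c ≤ ∫⁻ y in ball (0 : Eu n) 2 \ ball 0 1, ENNReal.ofReal (kz n s p (y - x)) := by
    refine le_trans (ENNReal.ofReal_le_ofReal ?_) (hk x hx)
    refine le_mul_of_one_le_right hc.le (Real.one_le_rpow_of_pos_of_le_one_of_nonpos hd ?_ ?_)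
    · have := norm_nonneg x; linarith
    · nlinarith
  calc ENNReal.ofReal (|w x| ^ p) = ENNReal.ofReal c⁻¹ * (ENNReal.ofReal (|w x| ^ p) * ENNReal.ofReal c) := by
        rw [mul_comm (ENNReal.ofReal (|w x| ^ p)), ← mul_assoc, ci, one_mul]
    _ ≤ ENNReal.ofReal c⁻¹ * (ENNReal.ofReal (|w x| ^ p) * ∫⁻ y in ball (0 : Eu n) 2 \ ball 0 1, ENNReal.ofReal (kz n s p (y - x))) :=
        mul_le_mul' le_rfl (mul_le_mul' le_rfl h1)
    _ ≤ _ := by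
        refine mul_le_mul' le_rfl ?_
        rw [← lintegral_const_mul' _ _ ENNReal.ofReal_ne_top]
        refine le_trans ?_ (lintegral_mono_set (diff_subset (t := ball (0 : Eu n) 1)))
        refine setLIntegral_mono' (measurableSet_ball.diff measurableSet_ball) fun y hy => ?_
        rw [← ENNReal.ofReal_mul (by positivity), hw0 y hy.2, zero_sub, abs_neg]

lemma measQ {n : ℕ} {p s : ℝ} {u v : Eu n → ℝ} (hu : Measurable u) (hv : Measurable v) :
    Measurable (fun q : Eu n × Eu n => ENNReal.ofReal (QJ n p u v q.1 q.2 * kz n s p (q.2 - q.1))) :=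
  ((measurable_QJ hu hv).mul (measurable_kz.comp (measurable_snd.sub measurable_fst))).ennreal_ofReal

lemma X_int {n : ℕ} {p s : ℝ} {u w : Eu n → ℝ} {Q : Eu n → Eu n → ℝ} (hQ : Measurable fun q : Eu n × Eu n => Q q.1 q.2)
    {m1 m2 : ℝ≥0∞} (h1 : m1 ≠ ⊤) (h2 : m2 ≠ ⊤)
    (pt : ∀ x y, ENNReal.ofReal (|w y - w x| ^ p * kz n s p (y - x)) ≤
      m1 * ENNReal.ofReal (Q x y * kz n s p (y - x)) + m2 * ENNReal.ofReal (|u y - u x| ^ p * kz n s p (y - x))) :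
    gagliardoE n s p (ball 0 2) w ≤ m1 * (∫⁻ x, ∫⁻ y, ENNReal.ofReal (Q x y * kz n s p (y - x))) + m2 * gagliardoE n s p (ball 0 2) u := by
  have mQ : Measurable (fun q : Eu n × Eu n => ENNReal.ofReal (Q q.1 q.2 * kz n s p (q.2 - q.1))) :=
    (hQ.mul (measurable_kz.comp (measurable_snd.sub measurable_fst))).ennreal_ofReal
  rw [gag_eq, gag_eq]
  calc _ ≤ ∫⁻ x in ball (0 : Eu n) 2, (m1 * (∫⁻ y in ball (0 : Eu n) 2, ENNReal.ofReal (Q x y * kz n s p (y - x))) +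
      m2 * ∫⁻ y in ball (0 : Eu n) 2, ENNReal.ofReal (|u y - u x| ^ p * kz n s p (y - x))) := by
        refine lintegral_mono fun x => ?_
        have mq : Measurable fun y => ENNReal.ofReal (Q x y * kz n s p (y - x)) := mQ.comp (measurable_prodMk_left (x := x))
        refine (lintegral_mono fun y => pt x y).trans ?_
        rw [lintegral_add_left (mq.const_mul _), lintegral_const_mul' _ _ h1, lintegral_const_mul' _ _ h2]
    _ = m1 * (∫⁻ x in ball (0 : Eu n) 2, ∫⁻ y in ball (0 : Eu n) 2, ENNReal.ofReal (Q x y * kz n s p (y - x))) +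
      m2 * ∫⁻ x in ball (0 : Eu n) 2, ∫⁻ y in ball (0 : Eu n) 2, ENNReal.ofReal (|u y - u x| ^ p * kz n s p (y - x)) := by
        have mm1 : Measurable fun x => ∫⁻ y in ball (0 : Eu n) 2, ENNReal.ofReal (Q x y * kz n s p (y - x)) :=
          mQ.lintegral_prod_right'
        rw [lintegral_add_left (mm1.const_mul _), lintegral_const_mul' _ _ h1, lintegral_const_mul' _ _ h2]
    _ ≤ _ := by
        refine add_le_add (mul_le_mul' le_rfl ?_) le_rfl
        exact (setLIntegral_le_lintegral _ _).trans (lintegral_mono fun x => setLIntegral_le_lintegral _ _)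

lemma X_pt {n : ℕ} {p s : ℝ} (hp : 1 < p) {u v w : Eu n → ℝ} {C lam : ℝ} (hC : 0 < C) (hl : 0 < lam)
    (h : ∀ a b : ℝ, |a - b| ^ p ≤ C * (lam ^ (-(1 - thetaP p)) * ((Jp p a - Jp p b) * (a - b)) + lam ^ (thetaP p) * |a| ^ p))
    (hw : ∀ x, w x = u x - v x) (x y : Eu n) : ENNReal.ofReal (|w y - w x| ^ p * kz n s p (y - x)) ≤
      ENNReal.ofReal (C * lam ^ (-(1 - thetaP p))) * ENNReal.ofReal (QJ n p u v x y * kz n s p (y - x)) +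
      ENNReal.ofReal (C * lam ^ (thetaP p)) * ENNReal.ofReal (|u y - u x| ^ p * kz n s p (y - x)) := by
  have l1 : 0 < lam ^ (-(1 - thetaP p)) := by positivity
  have l2 : 0 < lam ^ (thetaP p) := by positivity
  have k0 := kz_nonneg (n := n) (s := s) (p := p) (y - x)
  have hQ := QJ_nonneg hp u v x y
  rw [← ENNReal.ofReal_mul (by positivity), ← ENNReal.ofReal_mul (by positivity), ← ENNReal.ofReal_add (by positivity) (by positivity)]
  apply ENNReal.ofReal_le_ofReal
  have e := h (u y - u x) (v y - v x)
  have hQ' : QJ n p u v x y = (Jp p (u y - u x) - Jp p (v y - v x)) * (u y - u x - (v y - v x)) := rfl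
  rw [← hQ'] at e
  have e1 : w y - w x = u y - u x - (v y - v x) := by rw [hw, hw]; ring
  rw [e1]
  have := mul_le_mul_of_nonneg_right e k0
  linarith

lemma X_le {n : ℕ} (hn : 0 < n) {p s : ℝ} (hp : 1 < p) (hs : 0 < s) (hs1 : s < 1) : ∃ C : ℝ, 0 < C ∧ ∃ l0 : ℝ, 0 < l0 ∧ l0 ≤ 1 ∧
    ∀ f u v w : Eu n → ℝ, Cmp n p s f u v → (∀ x, w x = u x - v x) → ∀ lam : ℝ, 0 < lam → lam ≤ l0 →
    gagliardoE n s p (ball 0 2) w ≤ ENNReal.ofReal (C * lam ^ (-(1 - thetaP p))) * (∫⁻ x in ball (0 : Eu n) 1, ENNReal.ofReal (|f x| * |w x|))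
      + ENNReal.ofReal (C * lam ^ (thetaP p)) * gagliardoE n s p (ball 0 2) u := by
  obtain ⟨C, hC, l0, hl0, hl1, h⟩ := mono_abs hp
  refine ⟨C, hC, l0, hl0, hl1, fun f u v w hc hw lam hl hll => ?_⟩
  refine le_trans ?_ (add_le_add (mul_le_mul' le_rfl (hc.energy hn hp hs hs1 hw)) le_rfl)
  refine X_int (measurable_QJ hc.su.mU hc.sv.mU) ENNReal.ofReal_ne_top ENNReal.ofReal_ne_top fun x y => X_pt hp hC hl ?_ hw x y
  exact fun a b => h lam hl hll a b

lemma absorb {N a b : ℝ≥0∞} (hN : N ≠ ⊤) (h : N ≤ a + b) (hb : b ≤ ENNReal.ofReal (1 / 2) * N) : N ≤ 2 * a := by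
  by_cases ha : a = ⊤
  · rw [ha]; simp
  have h1 : N ≤ a + ENNReal.ofReal (1 / 2) * N := h.trans (add_le_add le_rfl hb)
  lift N to NNReal using hN
  lift a to NNReal using ha
  have e : ENNReal.ofReal (1 / 2) = ((1 / 2 : NNReal) : ℝ≥0∞) := by
    rw [ENNReal.ofReal]; congr 1; ext; simp
  rw [e] at h1
  have h2 : N ≤ a + (1 / 2) * N := by exact_mod_cast h1
  have h3 : (N:ℝ) ≤ a + (1 / 2) * N := by exact_mod_cast h2
  have h4 : (N:ℝ) ≤ 2 * a := by linarith
  exact_mod_cast h4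

/-- the comparison estimate -/
lemma comp_est {n : ℕ} (hn : 0 < n) {p s : ℝ} (hp : 1 < p) (hs : 0 < s) (hs1 : s < 1) : ∃ C : ℝ, 0 < C ∧ ∃ l0 : ℝ, 0 < l0 ∧ l0 ≤ 1 ∧
    ∀ f u v w : Eu n → ℝ, Cmp n p s f u v → (∀ x, w x = u x - v x) → ∀ lam : ℝ, 0 < lam → lam ≤ l0 →
    gagliardoE n s p (ball 0 2) w ≤ ENNReal.ofReal (C * lam ^ (-((1 - thetaP p) * (p / (p - 1))))) * Nr n (p / (p - 1)) 1 f
      + ENNReal.ofReal (C * lam ^ (thetaP p)) * gagliardoE n s p (ball 0 2) u := by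
  obtain ⟨K, hK, HK⟩ := poinc (n := n) hn (s := s) hp hs
  obtain ⟨C, hC, l0, hl0, hl1, h⟩ := X_le (n := n) hn hp hs hs1
  have hp1 : 0 < p - 1 := by linarith
  refine ⟨2 * C * (1 + (2 * K * C) ^ (1 / (p - 1))), by positivity, l0, hl0, hl1, fun f u v w hc hw lam hl hll => ?_⟩
  set L := lam ^ (-(1 - thetaP p)) with hL
  have hL0 : 0 < L := by positivity
  set T := lam ^ (thetaP p) with hT
  have hT0 : 0 < T := by positivity
  have hN := hc.w_lp hp hw
  have hP := HK w (hc.w_out hw)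
  have hX := h f u v w hc hw lam hl hll
  set μ := (2 * K * C * L) ^ (1 / (p - 1)) with hμ
  have hμ0 : 0 < μ := by positivity
  have hμp : μ ^ (1 - p) = (2 * K * C * L)⁻¹ := by
    rw [hμ, ← Real.rpow_mul (by positivity), show 1 / (p - 1) * (1 - p) = -1 by field_simp; ring, Real.rpow_neg_one]
  have hF := fw_fin hp hc.su.mf (hc.w_m hw) hμ0
  set FW := ∫⁻ x in ball (0 : Eu n) 1, ENNReal.ofReal (|f x| * |w x|)
  set X := gagliardoE n s p (ball 0 2) w
  set N := Nr n p 1 w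
  set F := Nr n (p / (p - 1)) 1 f
  set U := gagliardoE n s p (ball 0 2) u
  have hX2 : X ≤ (ENNReal.ofReal (C * L * μ) * F + ENNReal.ofReal (C * T) * U) + ENNReal.ofReal (1 / (2 * K)) * N := by
    refine (hX.trans (add_le_add (mul_le_mul' le_rfl hF) le_rfl)).trans (le_of_eq ?_)
    rw [mul_add, ← mul_assoc, ← mul_assoc, ← ENNReal.ofReal_mul (by positivity), ← ENNReal.ofReal_mul (by positivity), hμp]
    have : C * L * (2 * K * C * L)⁻¹ = 1 / (2 * K) := by field_simp
    rw [this]; ring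
  set a := ENNReal.ofReal (C * L * μ) * F + ENNReal.ofReal (C * T) * U with ha
  have hN2 : N ≤ 2 * (ENNReal.ofReal K * a) := by
    refine absorb hN.ne (b := ENNReal.ofReal K * (ENNReal.ofReal (1 / (2 * K)) * N)) ?_ (le_of_eq ?_)
    · rw [← mul_add]; exact hP.trans (mul_le_mul' le_rfl hX2)
    · rw [← mul_assoc, ← ENNReal.ofReal_mul hK.le]; congr 2; field_simp
  have hX3 : X ≤ 2 * a := by
    refine (hX2.trans (add_le_add le_rfl (mul_le_mul' le_rfl hN2))).trans (le_of_eq ?_)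
    have : ENNReal.ofReal (1 / (2 * K)) * (2 * (ENNReal.ofReal K * a)) = a := by
      rw [show (2 : ℝ≥0∞) = ENNReal.ofReal 2 by simp, ← mul_assoc, ← mul_assoc, ← ENNReal.ofReal_mul (by positivity), ← ENNReal.ofReal_mul (by positivity)]
      have : 1 / (2 * K) * 2 * K = 1 := by field_simp
      rw [this, ENNReal.ofReal_one, one_mul]
    rw [this, two_mul]
  refine hX3.trans ?_
  rw [ha, mul_add, show (2 : ℝ≥0∞) = ENNReal.ofReal 2 by simp, ← mul_assoc, ← mul_assoc, ← ENNReal.ofReal_mul (by positivity), ← ENNReal.ofReal_mul (by positivity)]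
  have q0 : 0 < (2 * K * C) ^ (1 / (p - 1)) := by positivity
  refine add_le_add (mul_le_mul' (ENNReal.ofReal_le_ofReal ?_) le_rfl) (mul_le_mul' (ENNReal.ofReal_le_ofReal ?_) le_rfl)
  · have e : lam ^ (-((1 - thetaP p) * (p / (p - 1)))) = L * L ^ (1 / (p - 1)) := by
      rw [hL, ← Real.rpow_mul hl.le, ← Real.rpow_add hl]; congr 1; field_simp; ring
    rw [e, hμ, Real.mul_rpow (by positivity) hL0.le]
    have : 0 ≤ 2 * C * (L * L ^ (1 / (p - 1))) := by positivity
    nlinarith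
  · have : 0 ≤ 2 * C * T * (2 * K * C) ^ (1 / (p - 1)) := by positivity
    nlinarith




/-- the norm -/
def Np (n : ℕ) (p r : ℝ) (g : Eu n → ℝ) : ℝ≥0∞ := (Nr n p r g) ^ (1 / p)

lemma Np_pow {n : ℕ} {p : ℝ} (hp : 0 < p) (r : ℝ) (g : Eu n → ℝ) : Np n p r g ^ p = Nr n p r g := by
  rw [Np, ← ENNReal.rpow_mul, one_div_mul_cancel hp.ne', ENNReal.rpow_one]

lemma Np_eq {n : ℕ} {p : ℝ} (hp : 0 < p) (r : ℝ) (g : Eu n → ℝ) :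
    Np n p r g = (∫⁻ x in ball (0 : Eu n) r, (ENNReal.ofReal |g x|) ^ p) ^ (1 / p) := by
  unfold Np Nr
  simp_rw [ENNReal.ofReal_rpow_of_nonneg (abs_nonneg _) hp.le]

lemma Np_add {n : ℕ} {p : ℝ} (hp : 1 < p) (r : ℝ) {g1 g2 g : Eu n → ℝ} (h1 : Measurable g1) (h2 : Measurable g2)
    (h : ∀ x, g x = g1 x + g2 x) : Np n p r g ≤ Np n p r g1 + Np n p r g2 := by
  have hp0 : 0 < p := by linarith
  rw [Np_eq hp0, Np_eq hp0, Np_eq hp0]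
  refine le_trans ?_ (ENNReal.lintegral_Lp_add_le (μ := volume.restrict (ball (0 : Eu n) r)) (f := fun x => ENNReal.ofReal |g1 x|)
    (g := fun x => ENNReal.ofReal |g2 x|) (by fun_prop) (by fun_prop) hp.le)
  refine ENNReal.rpow_le_rpow (lintegral_mono fun x => ENNReal.rpow_le_rpow ?_ hp0.le) (by positivity)
  simp only [Pi.add_apply]
  rw [← ENNReal.ofReal_add (abs_nonneg _) (abs_nonneg _), h]
  exact ENNReal.ofReal_le_ofReal (abs_add_le _ _)

lemma Np_smul {n : ℕ} {p : ℝ} (hp : 0 < p) (r : ℝ) {c : ℝ} (hc : 0 ≤ c) (g : Eu n → ℝ) :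
    Np n p r (fun x => c * g x) = ENNReal.ofReal c * Np n p r g := by
  unfold Np Nr
  have : ∀ x, ENNReal.ofReal (|c * g x| ^ p) = ENNReal.ofReal (c ^ p) * ENNReal.ofReal (|g x| ^ p) := by
    intro x
    rw [← ENNReal.ofReal_mul (by positivity), abs_mul, abs_of_nonneg hc, Real.mul_rpow hc (abs_nonneg _)]
  simp_rw [this]
  rw [lintegral_const_mul' _ _ ENNReal.ofReal_ne_top, ENNReal.mul_rpow_of_nonneg _ _ (by positivity)]
  congr 1
  rw [ENNReal.ofReal_rpow_of_nonneg (by positivity) (by positivity), ← Real.rpow_mul hc, mul_one_div_cancel hp.ne', Real.rpow_one]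

lemma geo_bound {q : ℝ} (hq0 : 0 ≤ q) (hq : q < 1) {a : ℕ → ℝ≥0∞} {b : ℝ≥0∞} (h : ∀ k, a (k + 1) ≤ a k + ENNReal.ofReal (q ^ k) * b)
    (k : ℕ) : a k ≤ a 0 + ENNReal.ofReal (1 / (1 - q)) * b := by
  have h1 : 0 < 1 - q := by linarith
  have P : ∀ k, a k ≤ a 0 + ENNReal.ofReal ((1 - q ^ k) / (1 - q)) * b := by
    intro k
    induction k with
    | zero => simp
    | succ k ih =>
      refine (h k).trans ((add_le_add ih le_rfl).trans (le_of_eq ?_))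
      have hk : q ^ k ≤ 1 := pow_le_one₀ hq0 hq.le
      rw [add_assoc, ← add_mul, ← ENNReal.ofReal_add (div_nonneg (by linarith) h1.le) (by positivity)]
      congr 3
      field_simp; ring
  refine (P k).trans (add_le_add le_rfl (mul_le_mul' (ENNReal.ofReal_le_ofReal ?_) le_rfl))
  have : 0 ≤ q ^ k := by positivity
  gcongr; linarith

lemma dir_est {n : ℕ} {p α : ℝ} (hp : 1 < p) (hα : 0 < α) : ∃ C : ℝ, 0 < C ∧ ∀ (r : ℝ) (w G : Eu n → ℝ) (h : Eu n) (B : ℝ≥0∞),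
    Measurable w → Measurable G →
    (∀ k : ℕ, Nr n p r (tau ((2:ℝ)⁻¹ ^ (k + 1) • h) (tau ((2:ℝ)⁻¹ ^ (k + 1) • h) w)) ≤ ENNReal.ofReal (((2:ℝ)⁻¹ ^ k) ^ ((1 + α) * p)) * B) →
    (∀ x ∈ ball (0 : Eu n) r, Filter.Tendsto (fun k : ℕ => 2 ^ k * tau ((2:ℝ)⁻¹ ^ k • h) w x) Filter.atTop (nhds (G x))) →
    Nr n p r G ≤ ENNReal.ofReal C * (Nr n p r (tau h w) + B) := by
  have hp0 : 0 < p := by linarith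
  set q : ℝ := 2⁻¹ ^ α with hq
  have hq0 : 0 ≤ q := by positivity
  have hq1 : q < 1 := Real.rpow_lt_one (by norm_num) (by norm_num) hα
  have h1q : 0 < 1 - q := by linarith
  refine ⟨2 ^ (p - 1) * (1 + (1 / (1 - q)) ^ p), by positivity, fun r w G h B hw hG hB hT => ?_⟩
  set D : ℕ → Eu n → ℝ := fun k x => 2 ^ k * tau ((2:ℝ)⁻¹ ^ k • h) w x with hD
  have mD : ∀ k, Measurable (D k) := fun k => (measurable_tau _ hw).const_mul _
  have step : ∀ k, Np n p r (D (k + 1)) ≤ Np n p r (D k) + ENNReal.ofReal (q ^ k) * B ^ (1 / p) := by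
    intro k
    set τ := tau ((2:ℝ)⁻¹ ^ (k + 1) • h) (tau ((2:ℝ)⁻¹ ^ (k + 1) • h) w) with hτ
    have mτ : Measurable τ := measurable_tau _ (measurable_tau _ hw)
    have e : ∀ x, D (k + 1) x = D k x + 2 ^ k * ((-1) * τ x) := by
      intro x
      simp only [hD, hτ, tau]
      have e1 : x + (2:ℝ)⁻¹ ^ (k + 1) • h + (2:ℝ)⁻¹ ^ (k + 1) • h = x + (2:ℝ)⁻¹ ^ k • h := by
        rw [add_assoc, ← add_smul, pow_succ]; congr 2; ring
      rw [e1, pow_succ]; ring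
    refine (Np_add hp r (mD k) (by fun_prop) e).trans (add_le_add le_rfl ?_)
    rw [Np_smul hp0 r (by positivity)]
    have e2 : Np n p r (fun x => -1 * τ x) = Np n p r τ := by
      unfold Np Nr; simp
    rw [e2]
    have e3 : Np n p r τ ≤ ENNReal.ofReal (((2:ℝ)⁻¹ ^ k) ^ (1 + α)) * B ^ (1 / p) := by
      unfold Np
      refine (ENNReal.rpow_le_rpow (hB k) (by positivity)).trans (le_of_eq ?_)
      rw [ENNReal.mul_rpow_of_nonneg _ _ (by positivity), ENNReal.ofReal_rpow_of_nonneg (by positivity) (by positivity), ← Real.rpow_mul (by positivity)]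
      congr 3; field_simp
    refine (mul_le_mul' le_rfl e3).trans (le_of_eq ?_)
    rw [← mul_assoc, ← ENNReal.ofReal_mul (by positivity)]
    congr 2
    rw [Real.rpow_add (by positivity), Real.rpow_one, ← mul_assoc, ← mul_pow, mul_inv_cancel₀ (by norm_num), one_pow, one_mul, hq,
      ← Real.rpow_natCast, ← Real.rpow_natCast, ← Real.rpow_mul (by norm_num), ← Real.rpow_mul (by norm_num), mul_comm]
  have bd := geo_bound hq0 hq1 step
  have D0 : Np n p r (D 0) = Np n p r (tau h w) := by
    congr 1; ext x; simp [hD]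
  have fat : Nr n p r G ≤ (Np n p r (tau h w) + ENNReal.ofReal (1 / (1 - q)) * B ^ (1 / p)) ^ p := by
    have L : ∀ᵐ x ∂(volume.restrict (ball (0 : Eu n) r)), ENNReal.ofReal (|G x| ^ p) = Filter.liminf (fun k => ENNReal.ofReal (|D k x| ^ p)) Filter.atTop := by
      refine (ae_restrict_iff' measurableSet_ball).mpr (Filter.Eventually.of_forall fun x hx => ?_)
      have T := hT x hx
      have : Filter.Tendsto (fun k => ENNReal.ofReal (|D k x| ^ p)) Filter.atTop (nhds (ENNReal.ofReal (|G x| ^ p))) :=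
        ENNReal.tendsto_ofReal (T.abs.rpow_const (Or.inr hp0.le))
      exact this.liminf_eq.symm
    unfold Nr
    rw [lintegral_congr_ae L]
    refine (lintegral_liminf_le fun k => ?_).trans ?_
    · have := mD k; fun_prop
    · refine Filter.liminf_le_of_frequently_le' (Filter.Frequently.of_forall fun k => ?_)
      have := ENNReal.rpow_le_rpow (bd k) hp0.le
      rw [Np_pow hp0, D0] at this
      exact this
  refine fat.trans ?_
  refine (ENNReal.rpow_add_le_mul_rpow_add_rpow _ _ hp.le).trans ?_
  rw [Np_pow hp0, ENNReal.mul_rpow_of_nonneg _ _ hp0.le, ← ENNReal.rpow_mul, one_div_mul_cancel hp0.ne', ENNReal.rpow_one,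
    ENNReal.ofReal_rpow_of_nonneg (by positivity) hp0.le]
  have e2 : (2 : ℝ≥0∞) ^ (p - 1) = ENNReal.ofReal (2 ^ (p - 1)) := by
    rw [← ENNReal.ofReal_rpow_of_pos (by norm_num)]; simp
  rw [e2, ENNReal.ofReal_mul (by positivity), mul_assoc]
  refine mul_le_mul' le_rfl ?_
  rw [ENNReal.ofReal_add (by norm_num) (by positivity), ENNReal.ofReal_one, add_mul, one_mul, mul_add, add_comm (ENNReal.ofReal _ * _)]
  refine (add_le_add (le_add_of_nonneg_right (zero_le (a := B))) (le_add_of_nonneg_right (zero_le))).trans (le_of_eq rfl)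




lemma conv_t {n : ℕ} {K g : Eu n → ℝ≥0∞} (hK : Measurable K) (hg : Measurable g) (t : ℝ) :
    ∫⁻ x, ∫⁻ y, K (y - x) * g (x + t • (y - x)) = (∫⁻ z, K z) * ∫⁻ x, g x := by
  have h1 : ∀ x, ∫⁻ y, K (y - x) * g (x + t • (y - x)) = ∫⁻ z, K z * g (x + t • z) :=
    fun x => vol_shift (fun z => K z * g (x + t • z)) x
  simp_rw [h1]
  rw [lintegral_lintegral_swap (by fun_prop)]
  have h2 : ∀ z, ∫⁻ x, K z * g (x + t • z) = K z * ∫⁻ x, g x := by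
    intro z
    rw [lintegral_const_mul _ (by fun_prop), lint_shift g]
  simp_rw [h2]
  rw [lintegral_mul_const _ hK]

/-- the integrand -/
def gD (n : ℕ) (p : ℝ) (u : Eu n → ℝ) : Eu n → ℝ≥0∞ :=
  indicator (ball (0 : Eu n) 2) (fun x => ENNReal.ofReal (‖fderiv ℝ u x‖ ^ p))

lemma measurable_gD (n : ℕ) (p : ℝ) (u : Eu n → ℝ) : Measurable (gD n p u) := by
  unfold gD
  refine Measurable.indicator ?_ measurableSet_ball
  have := measurable_fderiv ℝ u
  fun_prop

lemma ftc_p {n : ℕ} {p : ℝ} (hp : 1 < p) {u : Eu n → ℝ} (hu : ContDiffOn ℝ 1 u (ball 0 2)) {x y : Eu n}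
    (hx : x ∈ ball (0 : Eu n) 2) (hy : y ∈ ball (0 : Eu n) 2) :
    ENNReal.ofReal (|u y - u x| ^ p) ≤ ∫⁻ t in Icc (0:ℝ) 1, ENNReal.ofReal (‖y - x‖ ^ p) * gD n p u (x + t • (y - x)) := by
  have hp0 : 0 < p := by linarith
  have hin : ∀ t ∈ Icc (0:ℝ) 1, x + t • (y - x) ∈ ball (0 : Eu n) 2 := fun t ht =>
    (convex_ball (0 : Eu n) 2).add_smul_sub_mem hx hy ht
  have hc : ContDiffOn ℝ 1 (fun t : ℝ => u (x + t • (y - x))) (Icc 0 1) := by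
    refine hu.comp (g := u) (f := fun t : ℝ => x + t • (y - x)) ?_ hin
    exact ContDiff.contDiffOn (by fun_prop)
  have h1 := enorm_sub_le_lintegral_deriv_of_contDiffOn_Icc hc zero_le_one
  simp only [one_smul, zero_smul, add_zero, add_sub_cancel] at h1
  have hd : ∀ t ∈ Icc (0:ℝ) 1, ‖deriv (fun t : ℝ => u (x + t • (y - x))) t‖ₑ ^ p ≤
      ENNReal.ofReal (‖y - x‖ ^ p) * gD n p u (x + t • (y - x)) := by
    intro t ht
    have hdu : DifferentiableAt ℝ u (x + t • (y - x)) :=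
      (hu.contDiffAt (isOpen_ball.mem_nhds (hin t ht))).differentiableAt one_ne_zero
    have hl : HasDerivAt (fun t : ℝ => x + t • (y - x)) (y - x) t := by
      simpa using ((hasDerivAt_id t).smul_const (y - x)).const_add x
    have : deriv (fun t : ℝ => u (x + t • (y - x))) t = fderiv ℝ u (x + t • (y - x)) (y - x) :=
      (hdu.hasFDerivAt.comp_hasDerivAt t hl).deriv
    rw [this, gD, indicator_of_mem (hin t ht), ← ENNReal.ofReal_mul (by positivity), ← ofReal_norm_eq_enorm,
      ENNReal.ofReal_rpow_of_nonneg (norm_nonneg _) hp0.le, ← Real.mul_rpow (norm_nonneg _) (norm_nonneg _)]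
    refine ENNReal.ofReal_le_ofReal (Real.rpow_le_rpow (norm_nonneg _) ?_ hp0.le)
    rw [mul_comm]
    exact ContinuousLinearMap.le_opNorm _ _
  have hm : Measurable (fun t : ℝ => ‖deriv (fun t : ℝ => u (x + t • (y - x))) t‖ₑ) := (measurable_deriv _).enorm
  have h2 := jensen_lint (volume.restrict (Icc (0:ℝ) 1)) hp hm.aemeasurable
  simp only [Measure.restrict_apply MeasurableSet.univ, univ_inter, Real.volume_Icc, sub_zero, ENNReal.ofReal_one, ENNReal.one_rpow, one_mul] at h2
  calc ENNReal.ofReal (|u y - u x| ^ p) = ‖u y - u x‖ₑ ^ p := by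
        rw [← ofReal_norm_eq_enorm, ENNReal.ofReal_rpow_of_nonneg (norm_nonneg _) hp0.le, Real.norm_eq_abs]
    _ ≤ _ := (ENNReal.rpow_le_rpow h1 hp0.le).trans h2
    _ ≤ _ := setLIntegral_mono' measurableSet_Icc hd

lemma K4 {n : ℕ} (hn : 0 < n) {s p : ℝ} (hsp : 0 < s * p) (hs : s * p < p) :
    ∃ C : ℝ, 0 < C ∧ ∫⁻ z, (ball (0 : Eu n) 4).indicator (fun z => ENNReal.ofReal (‖z‖ ^ p * kz n s p z)) z ≤ ENNReal.ofReal C := by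
  obtain ⟨C, hC, h⟩ := kernel_int (n := n) hn hsp hs
  refine ⟨4 ^ p * (C * 4 ^ (-(s * p))), by positivity, ?_⟩
  rw [ENNReal.ofReal_mul (by positivity)]
  refine le_trans ?_ (mul_le_mul' le_rfl (h 4 (by norm_num)))
  rw [← lintegral_const_mul' _ _ ENNReal.ofReal_ne_top]
  rw [lintegral_indicator measurableSet_ball]
  refine (setLIntegral_mono' measurableSet_ball fun z hz => ?_).trans (setLIntegral_le_lintegral _ _)
  rw [← ENNReal.ofReal_mul (by positivity)]
  rw [mem_ball_zero_iff] at hz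
  rw [min_eq_right (by linarith : ‖z‖ / 4 ≤ 1), Real.div_rpow (norm_nonneg _) (by norm_num)]
  refine ENNReal.ofReal_le_ofReal (le_of_eq ?_)
  unfold kz
  have : (4:ℝ) ^ p ≠ 0 := by positivity
  field_simp

lemma gag_le_grad_aux {n : ℕ} {s p : ℝ} (hp : 1 < p) {u : Eu n → ℝ} (hu : ContDiffOn ℝ 1 u (ball 0 2)) {K : Eu n → ℝ≥0∞}
    (hK : K = (ball (0 : Eu n) 4).indicator (fun z => ENNReal.ofReal (‖z‖ ^ p * kz n s p z))) :
    gagliardoE n s p (ball 0 2) u ≤ ∫⁻ x, ∫⁻ y, ∫⁻ t in Icc (0:ℝ) 1, K (y - x) * gD n p u (x + t • (y - x)) := by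
  rw [gag_eq]
  refine (setLIntegral_mono' measurableSet_ball fun x hx => ?_).trans (setLIntegral_le_lintegral _ _)
  refine (setLIntegral_mono' measurableSet_ball fun y hy => ?_).trans (setLIntegral_le_lintegral _ _)
  have h := ftc_p hp hu hx hy
  have h4 : y - x ∈ ball (0 : Eu n) 4 := by
    rw [mem_ball_zero_iff] at hx hy ⊢
    have := norm_sub_le y x
    linarith
  have hz : K (y - x) = ENNReal.ofReal (kz n s p (y - x)) * ENNReal.ofReal (‖y - x‖ ^ p) := by
    rw [hK, indicator_of_mem h4, ENNReal.ofReal_mul (by positivity), mul_comm]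
  simp_rw [hz, mul_assoc]
  rw [lintegral_const_mul' _ _ ENNReal.ofReal_ne_top, ENNReal.ofReal_mul (by positivity), mul_comm]
  exact mul_le_mul' le_rfl h

lemma gag_le_grad {n : ℕ} (hn : 0 < n) {s p : ℝ} (hp : 1 < p) (hs : 0 < s) (hs1 : s < 1) : ∃ C : ℝ, 0 < C ∧
    ∀ u : Eu n → ℝ, ContDiffOn ℝ 1 u (ball 0 2) → gagliardoE n s p (ball 0 2) u ≤
      ENNReal.ofReal C * ∫⁻ x in ball (0 : Eu n) 2, ENNReal.ofReal (‖fderiv ℝ u x‖ ^ p) := by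
  obtain ⟨C, hC, h⟩ := K4 (n := n) hn (s := s) (p := p) (by positivity) (by nlinarith)
  refine ⟨C, hC, fun u hu => ?_⟩
  refine (gag_le_grad_aux hp hu rfl).trans ?_
  obtain ⟨K, hK⟩ : ∃ K, K = (ball (0 : Eu n) 4).indicator (fun z => ENNReal.ofReal (‖z‖ ^ p * kz n s p z)) := ⟨_, rfl⟩
  rw [← hK] at h ⊢
  have hKm : Measurable K := by
    rw [hK]; exact Measurable.indicator (by fun_prop) measurableSet_ball
  have hgm := measurable_gD n p u
  have e1 : ∀ x, ∫⁻ y, ∫⁻ t in Icc (0:ℝ) 1, K (y - x) * gD n p u (x + t • (y - x)) =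
     ∫⁻ t in Icc (0:ℝ) 1, ∫⁻ y, K (y - x) * gD n p u (x + t • (y - x)) := fun x =>
    lintegral_lintegral_swap (by fun_prop)
  simp_rw [e1]
  rw [lintegral_lintegral_swap (Measurable.aemeasurable ?_)]
  · simp_rw [conv_t hKm hgm]
    simp only [lintegral_const, Measure.restrict_apply MeasurableSet.univ, univ_inter, Real.volume_Icc, sub_zero, ENNReal.ofReal_one, mul_one]
    refine mul_le_mul' h (le_of_eq ?_)
    rw [gD, lintegral_indicator measurableSet_ball]
  · refine Measurable.lintegral_prod_right' (f := fun q : (Eu n × ℝ) × Eu n => K (q.2 - q.1.1) * gD n p u (q.1.1 + q.1.2 • (q.2 - q.1.1))) (by fun_prop)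





lemma poinc_mean {n : ℕ} {s p : ℝ} (hp : 1 < p) (hs : 0 < s) : ∃ C : ℝ, 0 < C ∧
    ∀ u : Eu n → ℝ, Measurable u → IntegrableOn u (ball 0 1) → ∫ x in ball (0 : Eu n) 1, u x = 0 →
      Nr n p 1 u ≤ ENNReal.ofReal C * gagliardoE n s p (ball 0 1) u := by
  have hp0 : 0 < p := by linarith
  set V := volume (ball (0 : Eu n) 1) with hV
  have hVfin : V ≠ ⊤ := measure_ball_lt_top.ne
  have hVpos : V ≠ 0 := (measure_ball_pos _ _ one_pos).ne'
  refine ⟨V.toReal⁻¹ * 2 ^ ((n:ℝ) + s * p), mul_pos (inv_pos.2 (ENNReal.toReal_pos hVpos hVfin)) (by positivity), fun u hu hi h0 => ?_⟩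
  rw [ENNReal.ofReal_mul (by positivity), ENNReal.ofReal_inv_of_pos (ENNReal.toReal_pos hVpos hVfin), ENNReal.ofReal_toReal hVfin]
  rw [gag_eq, Nr, mul_assoc, ← lintegral_const_mul' _ _ ENNReal.ofReal_ne_top, ← lintegral_const_mul' _ _ (by simpa using hVpos)]
  refine setLIntegral_mono' measurableSet_ball fun x hx => ?_
  have e1 : V * ‖u x‖ₑ ≤ ∫⁻ y in ball (0 : Eu n) 1, ‖u x - u y‖ₑ := by
    have : ∫ y in ball (0 : Eu n) 1, (u x - u y) = V.toReal * u x := by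
      have hcc : Integrable (fun _ : Eu n => u x) (volume.restrict (ball 0 1)) := integrableOn_const hVfin
      rw [integral_sub hcc hi, h0, sub_zero, setIntegral_const, smul_eq_mul, measureReal_def]
    have h2 := enorm_integral_le_lintegral_enorm (μ := volume.restrict (ball (0 : Eu n) 1)) (fun y => u x - u y)
    rw [this, enorm_mul] at h2
    refine le_trans (le_of_eq ?_) h2
    congr 1
    rw [Real.enorm_of_nonneg ENNReal.toReal_nonneg, ENNReal.ofReal_toReal hVfin]
  have e2 := jensen_lint (volume.restrict (ball (0 : Eu n) 1)) hp (f := fun y => ‖u x - u y‖ₑ) (by fun_prop)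
  simp only [Measure.restrict_apply MeasurableSet.univ, univ_inter] at e2
  have e3 := (ENNReal.rpow_le_rpow e1 hp0.le).trans e2
  rw [← hV, ENNReal.mul_rpow_of_nonneg _ _ hp0.le] at e3
  have e4 : V ^ p = V ^ (p - 1) * V := by
    conv_lhs => rw [show p = (p - 1) + 1 by ring, ENNReal.rpow_add _ _ hVpos hVfin, ENNReal.rpow_one]
  rw [e4, mul_assoc, ENNReal.mul_le_mul_iff_right (by simp [hVpos, hVfin]) (ENNReal.rpow_ne_top_of_nonneg (by linarith) hVfin)] at e3
  have e5 : ENNReal.ofReal (|u x| ^ p) = ‖u x‖ₑ ^ p := by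
    rw [← ofReal_norm_eq_enorm, ENNReal.ofReal_rpow_of_nonneg (norm_nonneg _) hp0.le, Real.norm_eq_abs]
  rw [e5, ← ENNReal.div_eq_inv_mul, ENNReal.le_div_iff_mul_le (Or.inl hVpos) (Or.inl hVfin), mul_comm]
  refine e3.trans ?_
  rw [← lintegral_const_mul' _ _ ENNReal.ofReal_ne_top]
  refine setLIntegral_mono' measurableSet_ball fun y hy => ?_
  rw [← ofReal_norm_eq_enorm, ENNReal.ofReal_rpow_of_nonneg (norm_nonneg _) hp0.le, Real.norm_eq_abs, ← ENNReal.ofReal_mul (by positivity), abs_sub_comm]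
  apply ENNReal.ofReal_le_ofReal
  rcases eq_or_ne y x with h | h
  · subst h; simp [Real.zero_rpow hp0.ne']
  · have h3 : 0 < ‖y - x‖ := norm_pos_iff.2 (sub_ne_zero.2 h)
    have h4 : ‖y - x‖ ≤ 2 := by
      rw [mem_ball_zero_iff] at hx hy
      have := norm_sub_le y x
      linarith
    have h5 : 1 ≤ 2 ^ ((n:ℝ) + s * p) * kz n s p (y - x) := by
      unfold kz
      rw [Real.rpow_neg h3.le, ← div_eq_mul_inv, one_le_div (by positivity)]
      exact Real.rpow_le_rpow h3.le h4 (by positivity)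
    have h6 : 0 ≤ |u y - u x| ^ p := by positivity
    nlinarith

lemma op_le_sum {n : ℕ} (L : Eu n →L[ℝ] ℝ) : ‖L‖ ≤ ∑ i, |L (EuclideanSpace.single i 1)| := by
  refine L.opNorm_le_bound (by positivity) fun x => ?_
  have : L x = ∑ i, x i * L (EuclideanSpace.single i 1) := by
    conv_lhs => rw [← (EuclideanSpace.basisFun (Fin n) ℝ).sum_repr x, map_sum]
    simp
  rw [this, Finset.sum_mul]
  refine (Finset.abs_sum_le_sum_abs _ _).trans (Finset.sum_le_sum fun i _ => ?_)
  rw [abs_mul, mul_comm]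
  exact mul_le_mul_of_nonneg_left (PiLp.norm_apply_le x i) (abs_nonneg _)

lemma op_pow_le {n : ℕ} {p : ℝ} (hp : 1 < p) (L : Eu n →L[ℝ] ℝ) {ρ : ℝ} (hρ : 0 < ρ) :
   ‖L‖ ^ p ≤ (n:ℝ) ^ (p - 1) * ρ ^ (-p) * ∑ i, |L (ρ • EuclideanSpace.single i 1)| ^ p := by
  have h1 := Real.rpow_le_rpow (norm_nonneg _) (op_le_sum L) (by linarith : 0 ≤ p)
  have h2 := Real.rpow_sum_le_const_mul_sum_rpow_of_nonneg (s := Finset.univ) (f := fun i : Fin n => |L (EuclideanSpace.single i 1)|) hp.le (fun i _ => abs_nonneg _)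
  refine (h1.trans h2).trans (le_of_eq ?_)
  simp only [map_smul, smul_eq_mul, abs_mul, abs_of_pos hρ, Real.mul_rpow hρ.le (abs_nonneg _), ← Finset.mul_sum]
  rw [Finset.card_univ, Fintype.card_fin, mul_assoc, ← mul_assoc (ρ ^ (-p)), ← Real.rpow_add hρ]
  simp

lemma quot_tendsto {n : ℕ} {w : Eu n → ℝ} {x : Eu n} (hw : DifferentiableAt ℝ w x) (h : Eu n) :
    Filter.Tendsto (fun k : ℕ => 2 ^ k * tau ((2:ℝ)⁻¹ ^ k • h) w x) Filter.atTop (nhds (fderiv ℝ w x h)) := by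
  have := hw.hasFDerivAt.lim h (c := fun k : ℕ => (2:ℝ) ^ k) (l := Filter.atTop) (by
    simp only [norm_pow, Real.norm_ofNat]
    exact tendsto_pow_atTop_atTop_of_one_lt one_lt_two)
  simpa [tau, inv_pow] using this

lemma grad_est {n : ℕ} {p α : ℝ} (hp : 1 < p) (hα : 0 < α) : ∃ C : ℝ, 0 < C ∧ ∀ (r ρ : ℝ) (w : Eu n → ℝ) (T B : ℝ≥0∞),
    0 < ρ → Measurable w → (∀ x ∈ ball (0 : Eu n) r, DifferentiableAt ℝ w x) →
    (∀ i, Nr n p r (tau (ρ • EuclideanSpace.single i 1) w) ≤ T) →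
    (∀ i, ∀ k : ℕ, Nr n p r (tau ((2:ℝ)⁻¹ ^ (k + 1) • ρ • EuclideanSpace.single i 1) (tau ((2:ℝ)⁻¹ ^ (k + 1) • ρ • EuclideanSpace.single i 1) w))
       ≤ ENNReal.ofReal (((2:ℝ)⁻¹ ^ k) ^ ((1 + α) * p)) * B) →
    ∫⁻ x in ball (0 : Eu n) r, ENNReal.ofReal (‖fderiv ℝ w x‖ ^ p) ≤ ENNReal.ofReal (C * ρ ^ (-p)) * (T + B) := by
  obtain ⟨C, hC, h⟩ := dir_est (n := n) hp hα
  refine ⟨(n:ℝ) ^ (p - 1) * (n * C) + 1, by positivity, fun r ρ w T B hρ hw hd hT hB => ?_⟩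
  have hG : ∀ i : Fin n, Nr n p r (fun x => fderiv ℝ w x (ρ • EuclideanSpace.single i 1)) ≤ ENNReal.ofReal C * (T + B) := by
    intro i
    refine (h r w (fun x => fderiv ℝ w x (ρ • EuclideanSpace.single i 1)) _ B hw (measurable_fderiv_apply_const ℝ w _) (hB i)
      fun x hx => quot_tendsto (hd x hx) _).trans ?_
    exact mul_le_mul' le_rfl (add_le_add (hT i) le_rfl)
  have hc : 0 ≤ (n:ℝ) ^ (p - 1) * ρ ^ (-p) := by positivity
  calc _ ≤ ∫⁻ x in ball (0 : Eu n) r, ENNReal.ofReal ((n:ℝ) ^ (p - 1) * ρ ^ (-p)) *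
        ∑ i : Fin n, ENNReal.ofReal (|fderiv ℝ w x (ρ • EuclideanSpace.single i 1)| ^ p) := by
        refine lintegral_mono fun x => ?_
        rw [← ENNReal.ofReal_sum_of_nonneg (fun i _ => by positivity), ← ENNReal.ofReal_mul hc]
        exact ENNReal.ofReal_le_ofReal (op_pow_le hp _ hρ)
    _ = ENNReal.ofReal ((n:ℝ) ^ (p - 1) * ρ ^ (-p)) * ∑ i : Fin n, Nr n p r (fun x => fderiv ℝ w x (ρ • EuclideanSpace.single i 1)) := by
        rw [lintegral_const_mul' _ _ ENNReal.ofReal_ne_top, lintegral_finsetSum _ (fun i _ => ?_)]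
        · rfl
        · have := measurable_fderiv_apply_const ℝ w (ρ • EuclideanSpace.single i (1:ℝ))
          fun_prop
    _ ≤ ENNReal.ofReal ((n:ℝ) ^ (p - 1) * ρ ^ (-p)) * ∑ i : Fin n, ENNReal.ofReal C * (T + B) :=
        mul_le_mul' le_rfl (Finset.sum_le_sum fun i _ => hG i)
    _ = ENNReal.ofReal ((n:ℝ) ^ (p - 1) * (n * C) * ρ ^ (-p)) * (T + B) := by
        rw [Finset.sum_const, Finset.card_univ, Fintype.card_fin, nsmul_eq_mul, ← mul_assoc, ← mul_assoc, ← ENNReal.ofReal_natCast,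
          ← ENNReal.ofReal_mul hc, ← ENNReal.ofReal_mul (by positivity)]
        congr 2; ring
    _ ≤ _ := by
        refine mul_le_mul' (ENNReal.ofReal_le_ofReal ?_) le_rfl
        have : 0 < ρ ^ (-p) := by positivity
        nlinarith





lemma gag_sub_le {n : ℕ} {s p : ℝ} (hp : 0 ≤ p) {D : Set (Eu n)} {g g1 g2 : Eu n → ℝ} (h1 : Measurable g1)
    (hg : ∀ x, g x = g1 x - g2 x) :
    gagliardoE n s p D g ≤ ENNReal.ofReal (2 ^ p) * (gagliardoE n s p D g1 + gagliardoE n s p D g2) := by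
  rw [gag_eq, gag_eq, gag_eq, ← lintegral_add_left (Measurable.lintegral_prod_right' (f := fun q : Eu n × Eu n => ENNReal.ofReal (|g1 q.2 - g1 q.1| ^ p * kz n s p (q.2 - q.1))) (by fun_prop)),
    ← lintegral_const_mul' _ _ ENNReal.ofReal_ne_top]
  refine lintegral_mono fun x => ?_
  rw [← lintegral_add_left (by fun_prop), ← lintegral_const_mul' _ _ ENNReal.ofReal_ne_top]
  refine lintegral_mono fun y => ?_
  have hk := kz_nonneg (s := s) (p := p) (y - x)
  rw [← ENNReal.ofReal_add (by positivity) (by positivity), ← ENNReal.ofReal_mul (by positivity), ← add_mul, ← mul_assoc]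
  refine ENNReal.ofReal_le_ofReal (mul_le_mul_of_nonneg_right ?_ hk)
  have := abs_sub_rpow_le hp (g1 y - g1 x) (g2 y - g2 x)
  rw [hg, hg, show g1 y - g2 y - (g1 x - g2 x) = g1 y - g1 x - (g2 y - g2 x) by ring]
  exact this

lemma gag_mono {n : ℕ} {s p : ℝ} {D D' : Set (Eu n)} (h : D ⊆ D') (g : Eu n → ℝ) :
    gagliardoE n s p D g ≤ gagliardoE n s p D' g :=
  (lintegral_mono_set h).trans (lintegral_mono fun _ => lintegral_mono_set h)

lemma tau_w {n : ℕ} {u v w : Eu n → ℝ} (hw : ∀ x, w x = u x - v x) (h : Eu n) :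
    tau h (tau h w) = fun x => tau h (tau h u) x - tau h (tau h v) x := by
  funext x; simp only [tau, hw]; ring

lemma main_rho {n : ℕ} (hn : 0 < n) {p s α : ℝ} (hp : 1 < p) (hs : 0 < s) (hs1 : s < 1)
    (hsp : 1 < s * (p / (p - 1))) (hα : 0 < α) (hα2 : α < (s * (p / (p - 1)) - 1) * min 1 (p - 1)) :
    ∃ C : ℝ, 0 < C ∧ ∃ ρ0 : ℝ, 0 < ρ0 ∧ ∀ f u v w : Eu n → ℝ, Cmp n p s f u v → (∀ x, w x = u x - v x) →
      (∀ x ∈ ball (0 : Eu n) (1 / 2), DifferentiableAt ℝ w x) → ∀ ρ : ℝ, 0 < ρ → ρ ≤ ρ0 →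
      ∫⁻ x in ball (0 : Eu n) (1 / 2), ENNReal.ofReal (‖fderiv ℝ w x‖ ^ p) ≤
       ENNReal.ofReal (C * ρ ^ (s * p - p)) * gagliardoE n s p (ball 0 2) w
        + ENNReal.ofReal (C * ρ ^ (α * p)) * (Lam n p s f u + Lam n p s (fun _ => 0) v) := by
  have hp0 : 0 < p := by linarith
  obtain ⟨C1, hC1, H1⟩ := nikolskii (n := n) hp0 (mul_pos hs hp0)
  obtain ⟨C2, hC2, h0, hh0, H2⟩ := boot hn hp hs hs1 hsp hα hα2 (1 / 2) (by norm_num) (by norm_num)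
  obtain ⟨C3, hC3, H3⟩ := grad_est (n := n) hp hα
  refine ⟨C3 * C1 + C3 * (2 ^ p * C2), by positivity, min h0 (1 / 2), by positivity, fun f u v w hc hw hd ρ hρ hρ0 => ?_⟩
  have wm := hc.w_m hw
  obtain ⟨Y, hY⟩ : ∃ Y, Y = Lam n p s f u + Lam n p s (fun _ => 0) v := ⟨_, rfl⟩
  obtain ⟨X, hX⟩ : ∃ X, X = gagliardoE n s p (ball 0 2) w := ⟨_, rfl⟩
  rw [← hY, ← hX]
  have hρ1 : ρ ≤ h0 := hρ0.trans (min_le_left _ _)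
  have hρ2 : ρ ≤ 1 / 2 := hρ0.trans (min_le_right _ _)
  have he : ∀ i : Fin n, ‖ρ • (EuclideanSpace.single i 1 : Eu n)‖ = ρ := by
    intro i; rw [norm_smul, EuclideanSpace.norm_single]; simp [abs_of_pos hρ]
  have hT : ∀ i : Fin n, Nr n p (1 / 2) (tau (ρ • EuclideanSpace.single i 1) w) ≤ ENNReal.ofReal (C1 * ρ ^ (s * p)) * X := by
    intro i
    have := H1 (1 / 2) w wm (ρ • EuclideanSpace.single i 1) (norm_pos_iff.1 (by rw [he]; exact hρ))
    rw [he] at this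
    refine this.trans (mul_le_mul' le_rfl ?_)
    rw [hX]
    exact D2_le_gag wm (by linarith) (by linarith)
  have hB : ∀ i : Fin n, ∀ k : ℕ, Nr n p (1 / 2) (tau ((2:ℝ)⁻¹ ^ (k + 1) • ρ • EuclideanSpace.single i 1) (tau ((2:ℝ)⁻¹ ^ (k + 1) • ρ • EuclideanSpace.single i 1) w))
       ≤ ENNReal.ofReal (((2:ℝ)⁻¹ ^ k) ^ ((1 + α) * p)) * (ENNReal.ofReal (2 ^ p * C2 * ρ ^ ((1 + α) * p)) * Y) := by
    intro i k
    obtain ⟨h, hh⟩ : ∃ h : Eu n, h = (2:ℝ)⁻¹ ^ (k + 1) • ρ • EuclideanSpace.single i 1 := ⟨_, rfl⟩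
    rw [← hh]
    have hnorm : ‖h‖ = 2⁻¹ ^ (k + 1) * ρ := by
      rw [hh, norm_smul, he]; simp
    have hpos : 0 < ‖h‖ := by rw [hnorm]; positivity
    have hle : ‖h‖ ≤ 2⁻¹ ^ k * ρ := by
      rw [hnorm, pow_succ]
      have : (0:ℝ) < 2⁻¹ ^ k * ρ := by positivity
      nlinarith
    have hle2 : ‖h‖ ≤ ρ := by
      refine hle.trans ?_
      have : (2⁻¹:ℝ) ^ k ≤ 1 := pow_le_one₀ (by norm_num) (by norm_num)
      nlinarith
    have hu := H2 f u hc.su h (norm_pos_iff.1 hpos) (hle2.trans hρ1)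
    have hv := H2 _ v hc.sv h (norm_pos_iff.1 hpos) (hle2.trans hρ1)
    rw [tau_w hw]
    refine (Nr_sub_le hp0.le (measurable_tau _ (measurable_tau _ hc.su.mU))).trans ?_
    refine (mul_le_mul' le_rfl (add_le_add hu hv)).trans ?_
    rw [← mul_add, ← hY, ← mul_assoc, ← mul_assoc, ← ENNReal.ofReal_mul (by positivity), ← ENNReal.ofReal_mul (by positivity)]
    refine mul_le_mul' (ENNReal.ofReal_le_ofReal ?_) le_rfl
    have := Real.rpow_le_rpow hpos.le hle (by positivity : 0 ≤ (1 + α) * p)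
    rw [Real.mul_rpow (by positivity) hρ.le] at this
    calc _ = 2 ^ p * C2 * ‖h‖ ^ ((1 + α) * p) := by ring
      _ ≤ 2 ^ p * C2 * ((2⁻¹ ^ k) ^ ((1 + α) * p) * ρ ^ ((1 + α) * p)) := mul_le_mul_of_nonneg_left this (by positivity)
      _ = _ := by ring
  refine (H3 (1 / 2) ρ w _ _ hρ wm hd hT hB).trans ?_
  rw [mul_add, ← mul_assoc, ← mul_assoc, ← ENNReal.ofReal_mul (by positivity), ← ENNReal.ofReal_mul (by positivity)]
  have e1 : C3 * ρ ^ (-p) * (C1 * ρ ^ (s * p)) = C3 * C1 * ρ ^ (s * p - p) := by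
    rw [sub_eq_add_neg, Real.rpow_add hρ]; ring
  have e2 : C3 * ρ ^ (-p) * (2 ^ p * C2 * ρ ^ ((1 + α) * p)) = C3 * (2 ^ p * C2) * ρ ^ (α * p) := by
    rw [show (1 + α) * p = α * p + p by ring, Real.rpow_add hρ, Real.rpow_neg hρ.le]
    have : ρ ^ p ≠ 0 := by positivity
    field_simp
  rw [e1, e2]
  have q1 : 0 < C3 * C1 := by positivity
  have q2 : 0 < C3 * (2 ^ p * C2) := by positivity
  refine add_le_add (mul_le_mul' (ENNReal.ofReal_le_ofReal (mul_le_mul_of_nonneg_right (by linarith) (by positivity))) le_rfl)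
    (mul_le_mul' (ENNReal.ofReal_le_ofReal (mul_le_mul_of_nonneg_right (by linarith) (by positivity))) le_rfl)




/-- bounded by a multiple -/
def Bd (c : ℝ) (a S : ℝ≥0∞) : Prop := 0 ≤ c ∧ a ≤ ENNReal.ofReal c * S

lemma Bd.one {a S : ℝ≥0∞} (h : a ≤ S) : Bd 1 a S := ⟨zero_le_one, by simpa using h⟩

lemma Bd.add {c d : ℝ} {a b S : ℝ≥0∞} (h : Bd c a S) (k : Bd d b S) : Bd (c + d) (a + b) S :=
  ⟨add_nonneg h.1 k.1, by rw [ENNReal.ofReal_add h.1 k.1, add_mul]; exact add_le_add h.2 k.2⟩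

lemma Bd.mul {c d : ℝ} {a S : ℝ≥0∞} (hd : 0 ≤ d) (h : Bd c a S) : Bd (d * c) (ENNReal.ofReal d * a) S :=
  ⟨mul_nonneg hd h.1, by rw [ENNReal.ofReal_mul hd, mul_assoc]; exact mul_le_mul' le_rfl h.2⟩

lemma Bd.of_le {c : ℝ} {a b S : ℝ≥0∞} (h : Bd c b S) (k : a ≤ b) : Bd c a S := ⟨h.1, k.trans h.2⟩

lemma int_of_Nr {n : ℕ} {p : ℝ} (hp : 1 < p) {u : Eu n → ℝ} (hu : Measurable u) (h : Nr n p 1 u < ⊤) : IntegrableOn u (ball 0 1) := by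
  refine ⟨hu.aestronglyMeasurable, ?_⟩
  have hp0 : 0 < p := by linarith
  have e2 := jensen_lint (volume.restrict (ball (0 : Eu n) 1)) hp (f := fun y => ‖u y‖ₑ) (by fun_prop)
  have e : ∀ y, ‖u y‖ₑ ^ p = ENNReal.ofReal (|u y| ^ p) := by
    intro y
    rw [← ofReal_norm_eq_enorm, ENNReal.ofReal_rpow_of_nonneg (norm_nonneg _) hp0.le, Real.norm_eq_abs]
  simp only [Measure.restrict_apply MeasurableSet.univ, univ_inter, e] at e2
  have h3 := e2.trans_lt (ENNReal.mul_lt_top (ENNReal.rpow_lt_top_of_nonneg (by linarith) measure_ball_lt_top.ne) h)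
  rw [ENNReal.rpow_lt_top_iff_of_pos hp0] at h3
  exact h3

lemma TL_congr {n : ℕ} {s p : ℝ} {u v : Eu n → ℝ} (h : ∀ x, x ∉ ball (0 : Eu n) 1 → v x = u x) : TL n s p v = TL n s p u := by
  unfold TL
  refine setLIntegral_congr_fun measurableSet_ball.compl fun x hx => ?_
  simp only [h x hx]

lemma Nr_zero {n : ℕ} {q : ℝ} (hq : 0 < q) : Nr n q 1 (fun _ => 0) = 0 := by
  simp [Nr, Real.zero_rpow hq.ne']

lemma lam_bound {n : ℕ} (hn : 0 < n) {p s : ℝ} (hp : 1 < p) (hs : 0 < s) (hs1 : s < 1) :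
    ∃ C : ℝ, 0 < C ∧ ∀ f u v w : Eu n → ℝ, Cmp n p s f u v → (∀ x, w x = u x - v x) →
      ContDiffOn ℝ 1 u (ball 0 2) → ∫ x in ball (0 : Eu n) 1, u x = 0 →
      Lam n p s f u + Lam n p s (fun _ => 0) v ≤ ENNReal.ofReal C *
        ((∫⁻ x in ball (0 : Eu n) 2, ENNReal.ofReal (‖fderiv ℝ u x‖ ^ p)) + TL n s p u ^ (p / (p - 1)) + Nr n (p / (p - 1)) 1 f) := by
  have hp0 : 0 < p := by linarith
  have hp1 : 0 < p - 1 := by linarith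
  obtain ⟨C1, hC1, H1⟩ := gag_le_grad (n := n) hn hp hs hs1
  obtain ⟨C2, hC2, H2⟩ := poinc_mean (n := n) hp hs
  obtain ⟨C3, hC3, H3⟩ := poinc (n := n) hn hp hs
  obtain ⟨C4, hC4, l0, hl0, hl1, H4⟩ := comp_est (n := n) hn hp hs hs1
  obtain ⟨c5, h5⟩ : ∃ c, c = C4 * l0 ^ (-((1 - thetaP p) * (p / (p - 1)))) := ⟨_, rfl⟩
  obtain ⟨c6, h6⟩ : ∃ c, c = C4 * l0 ^ (thetaP p) := ⟨_, rfl⟩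
  have hc5 : 0 ≤ c5 := by rw [h5]; positivity
  have hc6 : 0 ≤ c6 := by rw [h6]; positivity
  obtain ⟨K, hK⟩ : ∃ K : ℝ, ∀ f u v w : Eu n → ℝ, Cmp n p s f u v → (∀ x, w x = u x - v x) →
      ContDiffOn ℝ 1 u (ball 0 2) → ∫ x in ball (0 : Eu n) 1, u x = 0 →
      Bd K (Lam n p s f u + Lam n p s (fun _ => 0) v) 
        ((∫⁻ x in ball (0 : Eu n) 2, ENNReal.ofReal (‖fderiv ℝ u x‖ ^ p)) + TL n s p u ^ (p / (p - 1)) + Nr n (p / (p - 1)) 1 f) := by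
    refine ⟨((C2 * (C1 * 1)) + (C1 * 1) + 1 + 1) + ((2 ^ p * ((C2 * (C1 * 1)) + (C3 * (c5 * 1 + c6 * (C1 * 1)))) + 2 ^ p * ((C1 * 1) + (c5 * 1 + c6 * (C1 * 1)))) + 1), fun f u v w hc hw hu h0 => ?_⟩
    obtain ⟨S, hS⟩ : ∃ S, S = (∫⁻ x in ball (0 : Eu n) 2, ENNReal.ofReal (‖fderiv ℝ u x‖ ^ p)) + TL n s p u ^ (p / (p - 1)) + Nr n (p / (p - 1)) 1 f := ⟨_, rfl⟩
    rw [← hS]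
    have bA : Bd 1 (∫⁻ x in ball (0 : Eu n) 2, ENNReal.ofReal (‖fderiv ℝ u x‖ ^ p)) S := Bd.one (by rw [hS, add_assoc]; exact le_self_add)
    have bT : Bd 1 (TL n s p u ^ (p / (p - 1))) S := Bd.one (by rw [hS]; exact le_add_self.trans le_self_add)
    have bF : Bd 1 (Nr n (p / (p - 1)) 1 f) S := Bd.one (by rw [hS]; exact le_add_self)
    have bG := (bA.mul hC1.le).of_le (H1 u hu)
    have bg := bG.of_le (gag_mono (ball_subset_ball one_le_two) u)
    have bN := (bg.mul hC2.le).of_le (H2 u hc.su.mU (int_of_Nr hp hc.su.mU hc.su.lp) h0)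
    have q := H4 f u v w hc hw l0 hl0 le_rfl
    rw [← h5, ← h6] at q
    have bX := ((bF.mul hc5).add (bG.mul hc6)).of_le q
    have bx := bX.of_le (gag_mono (ball_subset_ball one_le_two) w)
    have bW := (bX.mul hC3.le).of_le (H3 w (hc.w_out hw))
    have hv : ∀ x, v x = u x - w x := fun x => by rw [hw]; ring
    have bgv := ((bg.add bx).mul (by positivity : (0:ℝ) ≤ 2 ^ p)).of_le (gag_sub_le hp0.le hc.su.mU hv)
    have q2 := Nr_sub_le (r := 1) hp0.le (g2 := w) hc.su.mU
    rw [← funext hv] at q2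
    have bNv := ((bN.add bW).mul (by positivity : (0:ℝ) ≤ 2 ^ p)).of_le q2
    unfold Lam
    rw [TL_congr hc.out, Nr_zero (by positivity), add_zero]
    exact (((bN.add bg).add bT).add bF).add ((bNv.add bgv).add bT)
  refine ⟨|K| + 1, by positivity, fun f u v w hc hw hu h0 => (hK f u v w hc hw hu h0).2.trans ?_⟩
  refine mul_le_mul' (ENNReal.ofReal_le_ofReal ?_) le_rfl
  have := le_abs_self K
  linarith




lemma exp_ineq {p s α : ℝ} (hp : 1 < p) (hs : 0 < s) (hs1 : s < 1) (hsp : p - 1 < s * p) (hα : 0 < α) :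
    (1 - s) / α + (1 + (1 - s) / α) / thetaP p * ((1 - thetaP p) * (p / (p - 1))) ≤ (1 + α) / (α * (p - 1)) := by
  have hp1 : 0 < p - 1 := by linarith
  have hp0 : 0 < p := by linarith
  rw [le_div_iff₀ (by positivity)]
  rcases le_or_gt 2 p with h | h
  · have : thetaP p = 1 := min_eq_left (by linarith)
    rw [this]
    have e : ((1 - s) / α + (1 + (1 - s) / α) / 1 * ((1 - 1) * (p / (p - 1)))) * (α * (p - 1)) = (1 - s) * (p - 1) := by
      field_simp; ring
    rw [e]; nlinarith
  · have : thetaP p = p / 2 := min_eq_right (by linarith)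
    rw [this]
    have e : ((1 - s) / α + (1 + (1 - s) / α) / (p / 2) * ((1 - p / 2) * (p / (p - 1)))) * (α * (p - 1)) = (1 - s) + α * (2 - p) := by
      field_simp; ring
    rw [e]; nlinarith

lemma choose_par {p s α : ℝ} (hp : 1 < p) (hs : 0 < s) (hs1 : s < 1) (hsp : p - 1 < s * p) (hα : 0 < α)
    {K ρ0 l0 : ℝ} (hK : 0 < K) (hρ0 : 0 < ρ0) (hl0 : 0 < l0) : ∃ c : ℝ, 0 < c ∧ ∀ δ : ℝ, 0 < δ → δ ≤ 1 →
    ∃ ρ lam : ℝ, 0 < ρ ∧ ρ ≤ ρ0 ∧ 0 < lam ∧ lam ≤ l0 ∧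
      K * (ρ ^ (s * p - p) * lam ^ (thetaP p) + ρ ^ (α * p)) ≤ δ ∧
      K * (ρ ^ (s * p - p) * lam ^ (-((1 - thetaP p) * (p / (p - 1)))) + ρ ^ (α * p)) ≤ c * δ ^ (-((1 + α) / (α * (p - 1)))) := by
  have hp1 : 0 < p - 1 := by linarith
  have hp0 : 0 < p := by linarith
  have hθ := thetaP_pos hp
  have hE := exp_ineq hp hs hs1 hsp hα
  obtain ⟨θ, hθd⟩ : ∃ θ, θ = thetaP p := ⟨_, rfl⟩
  obtain ⟨κ, hκ⟩ : ∃ κ, κ = (1 - θ) * (p / (p - 1)) := ⟨_, rfl⟩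
  obtain ⟨Q, hQ⟩ : ∃ Q, Q = (1 + α) / (α * (p - 1)) := ⟨_, rfl⟩
  rw [← hθd] at hE hθ ⊢
  rw [← hκ, ← hQ] at hE
  rw [← hκ, ← hQ]
  have hQ0 : 0 ≤ Q := by rw [hQ]; positivity
  obtain ⟨a, ha⟩ : ∃ a, a = min ρ0 ((1 / (2 * K)) ^ (1 / (α * p))) := ⟨_, rfl⟩
  have ha0 : 0 < a := by rw [ha]; positivity
  have ha1 : K * a ^ (α * p) ≤ 1 / 2 := by
    have : a ^ (α * p) ≤ 1 / (2 * K) := by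
      have := Real.rpow_le_rpow ha0.le (ha.le.trans (min_le_right _ _)) (by positivity : 0 ≤ α * p)
      rwa [← Real.rpow_mul (by positivity), one_div_mul_cancel (by positivity), Real.rpow_one] at this
    rw [le_div_iff₀ (by positivity)] at this
    linarith
  obtain ⟨A, hA⟩ : ∃ A, A = a ^ (s * p - p) := ⟨_, rfl⟩
  have hA0 : 0 < A := by rw [hA]; positivity
  obtain ⟨b, hb⟩ : ∃ b, b = min l0 ((1 / (2 * K * A)) ^ (1 / θ)) := ⟨_, rfl⟩
  have hb0 : 0 < b := by rw [hb]; positivity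
  have hb1 : K * (A * b ^ θ) ≤ 1 / 2 := by
    have : b ^ θ ≤ 1 / (2 * K * A) := by
      have := Real.rpow_le_rpow hb0.le (hb.le.trans (min_le_right _ _)) hθ.le
      rwa [← Real.rpow_mul (by positivity), one_div_mul_cancel (by positivity), Real.rpow_one] at this
    rw [le_div_iff₀ (by positivity)] at this
    linarith
  obtain ⟨m, hm⟩ : ∃ m, m = 1 + (1 - s) / α := ⟨_, rfl⟩
  have hm0 : 0 < m := by
    rw [hm]; have : 0 < 1 - s := by linarith
    positivity
  rw [← hm] at hE
  refine ⟨K * (A * b ^ (-κ)) + 1, by positivity, fun δ hδ hδ1 => ⟨a * δ ^ (1 / (α * p)), b * δ ^ (m / θ), by positivity, ?_, by positivity, ?_, ?_, ?_⟩⟩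
  · have : δ ^ (1 / (α * p)) ≤ 1 := Real.rpow_le_one hδ.le hδ1 (by positivity)
    have h2 : a ≤ ρ0 := ha.le.trans (min_le_left _ _)
    nlinarith
  · have : δ ^ (m / θ) ≤ 1 := Real.rpow_le_one hδ.le hδ1 (by positivity)
    have h2 : b ≤ l0 := hb.le.trans (min_le_left _ _)
    nlinarith
  · rw [Real.mul_rpow ha0.le (by positivity), Real.mul_rpow ha0.le (by positivity), Real.mul_rpow hb0.le (by positivity),
      ← Real.rpow_mul hδ.le, ← Real.rpow_mul hδ.le, ← Real.rpow_mul hδ.le, ← hA]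
    have e1 : 1 / (α * p) * (α * p) = 1 := by field_simp
    have e2 : m / θ * θ = m := by field_simp
    rw [e1, e2, Real.rpow_one]
    have e3 : δ ^ (1 / (α * p) * (s * p - p)) * δ ^ m = δ := by
      rw [← Real.rpow_add hδ]
      have : 1 / (α * p) * (s * p - p) + m = 1 := by rw [hm]; field_simp; ring
      rw [this, Real.rpow_one]
    calc _ = K * (A * b ^ θ) * (δ ^ (1 / (α * p) * (s * p - p)) * δ ^ m) + K * a ^ (α * p) * δ := by ring
      _ = K * (A * b ^ θ) * δ + K * a ^ (α * p) * δ := by rw [e3]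
      _ ≤ 1 / 2 * δ + 1 / 2 * δ := by gcongr
      _ = δ := by ring
  · rw [Real.mul_rpow ha0.le (by positivity), Real.mul_rpow ha0.le (by positivity), Real.mul_rpow hb0.le (by positivity),
      ← Real.rpow_mul hδ.le, ← Real.rpow_mul hδ.le, ← Real.rpow_mul hδ.le, ← hA]
    have e1 : 1 / (α * p) * (α * p) = 1 := by field_simp
    rw [e1, Real.rpow_one]
    have e3 : δ ^ (1 / (α * p) * (s * p - p)) * δ ^ (m / θ * (-κ)) ≤ δ ^ (-Q) := by
      rw [← Real.rpow_add hδ]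
      refine Real.rpow_le_rpow_of_exponent_ge hδ hδ1 ?_
      have : 1 / (α * p) * (s * p - p) = - ((1 - s) / α) := by field_simp; ring
      rw [this]; linarith
    have e4 : 1 ≤ δ ^ (-Q) := Real.one_le_rpow_of_pos_of_le_one_of_nonpos hδ hδ1 (by linarith)
    calc _ = K * (A * b ^ (-κ)) * (δ ^ (1 / (α * p) * (s * p - p)) * δ ^ (m / θ * (-κ))) + K * a ^ (α * p) * δ := by ring
      _ ≤ K * (A * b ^ (-κ)) * δ ^ (-Q) + 1 / 2 * 1 := by gcongr
      _ ≤ _ := by nlinarith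

lemma norm_thm {n : ℕ} (hn : 0 < n) {p s α : ℝ} (hp : 1 < p) (hs : 0 < s) (hs1 : s < 1)
    (hsp : 1 < s * (p / (p - 1))) (hα : 0 < α) (hα2 : α < (s * (p / (p - 1)) - 1) * min 1 (p - 1)) :
    ∃ c : ℝ, 0 < c ∧ ∀ f u v : Eu n → ℝ, Cmp n p s f u v → 
      ContDiffOn ℝ 1 u (ball 0 2) → ContDiffOn ℝ 1 v (ball 0 1) → ∫ x in ball (0 : Eu n) 1, u x = 0 →
      ∀ δ : ℝ, 0 < δ → δ ≤ 1 →
      ∫⁻ x in ball (0 : Eu n) (1 / 2), ENNReal.ofReal (‖fderiv ℝ u x - fderiv ℝ v x‖ ^ p) ≤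
       ENNReal.ofReal δ * ((∫⁻ x in ball (0 : Eu n) 2, ENNReal.ofReal (‖fderiv ℝ u x‖ ^ p)) + TL n s p u ^ (p / (p - 1)))
        + ENNReal.ofReal (c * δ ^ (-((1 + α) / (α * (p - 1))))) * Nr n (p / (p - 1)) 1 f := by
  have hp0 : 0 < p := by linarith
  have hp1 : 0 < p - 1 := by linarith
  have hsp' : p - 1 < s * p := by
    rw [← mul_div_assoc, lt_div_iff₀ hp1] at hsp; linarith
  obtain ⟨C, hC, ρ0, hρ0, H1⟩ := main_rho hn hp hs hs1 hsp hα hα2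
  obtain ⟨L, hL, H2⟩ := lam_bound hn hp hs hs1
  obtain ⟨D, hD, l0, hl0, hl1, H3⟩ := comp_est (n := n) hn hp hs hs1
  obtain ⟨E, hE, H4⟩ := gag_le_grad (n := n) hn hp hs hs1
  obtain ⟨c, hc, H5⟩ := choose_par hp hs hs1 hsp' hα (K := C * D * E + C * D + C * L) (by positivity) hρ0 hl0
  refine ⟨c, hc, fun f u v hcm hu hv h0 δ hδ hδ1 => ?_⟩
  obtain ⟨ρ, lam, hρ, hρ1, hl, hll, q1, q2⟩ := H5 δ hδ hδ1
  obtain ⟨w, hw⟩ : ∃ w : Eu n → ℝ, w = fun x => u x - v x := ⟨_, rfl⟩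
  have hw' : ∀ x, w x = u x - v x := fun x => by rw [hw]
  have du : ∀ x ∈ ball (0 : Eu n) (1 / 2), DifferentiableAt ℝ u x := fun x hx =>
    (hu.contDiffAt (isOpen_ball.mem_nhds (ball_subset_ball (by norm_num) hx))).differentiableAt one_ne_zero
  have dv : ∀ x ∈ ball (0 : Eu n) (1 / 2), DifferentiableAt ℝ v x := fun x hx =>
    (hv.contDiffAt (isOpen_ball.mem_nhds (ball_subset_ball (by norm_num) hx))).differentiableAt one_ne_zero
  have e1 : ∫⁻ x in ball (0 : Eu n) (1 / 2), ENNReal.ofReal (‖fderiv ℝ u x - fderiv ℝ v x‖ ^ p) =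
      ∫⁻ x in ball (0 : Eu n) (1 / 2), ENNReal.ofReal (‖fderiv ℝ w x‖ ^ p) := by
    refine setLIntegral_congr_fun measurableSet_ball fun x hx => ?_
    have : fderiv ℝ w x = fderiv ℝ u x - fderiv ℝ v x := by
      rw [hw]; exact fderiv_fun_sub (du x hx) (dv x hx)
    simp only [this]
  rw [e1]
  have a1 := H1 f u v w hcm hw' (fun x hx => by rw [hw]; exact (du x hx).fun_sub (dv x hx)) ρ hρ hρ1
  have a2 := H2 f u v w hcm hw' hu h0
  have a3 := H3 f u v w hcm hw' lam hl hll
  have a4 := H4 u hu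
  obtain ⟨A1, hA1⟩ : ∃ A, A = ∫⁻ x in ball (0 : Eu n) 2, ENNReal.ofReal (‖fderiv ℝ u x‖ ^ p) := ⟨_, rfl⟩
  obtain ⟨T, hT⟩ : ∃ T, T = TL n s p u ^ (p / (p - 1)) := ⟨_, rfl⟩
  obtain ⟨F, hF⟩ : ∃ F, F = Nr n (p / (p - 1)) 1 f := ⟨_, rfl⟩
  rw [← hA1, ← hT, ← hF] at a2
  rw [← hF] at a3
  rw [← hA1] at a4
  rw [← hA1, ← hT, ← hF]
  have a5 := a3.trans (add_le_add le_rfl (mul_le_mul' le_rfl (a4.trans (mul_le_mul' le_rfl (le_self_add (b := T))))))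
  have a6 := a1.trans (add_le_add (mul_le_mul' le_rfl a5) (mul_le_mul' le_rfl a2))
  refine a6.trans ?_
  obtain ⟨S, hS⟩ : ∃ S, S = A1 + T := ⟨_, rfl⟩
  rw [← hS]
  obtain ⟨r1, hr1⟩ : ∃ r1, r1 = ρ ^ (s * p - p) := ⟨_, rfl⟩
  obtain ⟨r2, hr2⟩ : ∃ r2, r2 = ρ ^ (α * p) := ⟨_, rfl⟩
  obtain ⟨t1, ht1⟩ : ∃ r2, r2 = lam ^ (thetaP p) := ⟨_, rfl⟩
  obtain ⟨t2, ht2⟩ : ∃ r2, r2 = lam ^ (-((1 - thetaP p) * (p / (p - 1)))) := ⟨_, rfl⟩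
  rw [← hr1, ← hr2, ← ht1] at q1
  rw [← hr1, ← hr2, ← ht2] at q2
  rw [← hr1, ← hr2, ← ht1, ← ht2]
  have p1 : 0 < r1 := by rw [hr1]; positivity
  have p2 : 0 < r2 := by rw [hr2]; positivity
  have p3 : 0 < t1 := by rw [ht1]; positivity
  have p4 : 0 < t2 := by rw [ht2]; positivity
  have key : ENNReal.ofReal (C * r1) * (ENNReal.ofReal (D * t2) * F + ENNReal.ofReal (D * t1) * (ENNReal.ofReal E * S)) +
      ENNReal.ofReal (C * r2) * (ENNReal.ofReal L * (S + F)) =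
      ENNReal.ofReal (C * D * E * (r1 * t1) + C * L * r2) * S + ENNReal.ofReal (C * D * (r1 * t2) + C * L * r2) * F := by
    rw [ENNReal.ofReal_add (by positivity) (by positivity), ENNReal.ofReal_add (by positivity) (by positivity)]
    simp only [ENNReal.ofReal_mul hC.le, ENNReal.ofReal_mul hD.le, ENNReal.ofReal_mul p1.le, ENNReal.ofReal_mul (mul_pos hC hD).le, ENNReal.ofReal_mul (mul_pos hC hL).le, ENNReal.ofReal_mul (mul_pos (mul_pos hC hD) hE).le]
    ring
  rw [key]
  refine add_le_add (mul_le_mul' (ENNReal.ofReal_le_ofReal (le_trans ?_ q1)) le_rfl) (mul_le_mul' (ENNReal.ofReal_le_ofReal (le_trans ?_ q2)) le_rfl)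
  · have z1 : 0 < C * D * (r1 * t1) := by positivity
    have z2 : 0 < C * L * (r1 * t1) := by positivity
    have z3 : 0 < C * D * E * r2 := by positivity
    have z4 : 0 < C * D * r2 := by positivity
    nlinarith
  · have z1 : 0 < C * D * E * (r1 * t2) := by positivity
    have z2 : 0 < C * L * (r1 * t2) := by positivity
    have z3 : 0 < C * D * E * r2 := by positivity
    have z4 : 0 < C * D * r2 := by positivity
    nlinarith




/-- the affine map -/
def Sm {n : ℕ} (x₀ : Eu n) (R : ℝ) (x : Eu n) : Eu n := x₀ + R • x

@[fun_prop]
lemma measurable_Sm {n : ℕ} (x₀ : Eu n) (R : ℝ) : Measurable (Sm x₀ R) := by unfold Sm; fun_prop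

@[fun_prop]
lemma continuous_Sm {n : ℕ} (x₀ : Eu n) (R : ℝ) : Continuous (Sm x₀ R) := by unfold Sm; fun_prop

lemma emb_Sm {n : ℕ} (x₀ : Eu n) {R : ℝ} (hR : 0 < R) : MeasurableEmbedding (Sm x₀ R) := by
  have e1 : MeasurableEmbedding (fun z : Eu n => R • z) :=
    (Homeomorph.smulOfNeZero R hR.ne').measurableEmbedding
  have e2 : MeasurableEmbedding (fun z : Eu n => x₀ + z) := (Homeomorph.addLeft x₀).measurableEmbedding
  exact e2.comp e1

lemma map_Sm {n : ℕ} (x₀ : Eu n) {R : ℝ} (hR : 0 < R) :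
    Measure.map (Sm x₀ R) (volume : Measure (Eu n)) = ENNReal.ofReal (R ^ (-(n:ℝ))) • volume := by
  have h := Measure.map_addHaar_smul (volume : Measure (Eu n)) hR.ne'
  have e : Sm x₀ R = (fun z : Eu n => x₀ + z) ∘ (fun z : Eu n => R • z) := rfl
  rw [e, ← Measure.map_map (by fun_prop) (by fun_prop), h, Measure.map_smul, (measurePreserving_add_left volume x₀).map_eq]
  congr 2
  rw [finrank_euclideanSpace_fin, Real.rpow_neg hR.le, Real.rpow_natCast, abs_of_pos (by positivity)]

lemma lint_Sm {n : ℕ} (x₀ : Eu n) {R : ℝ} (hR : 0 < R) (G : Eu n → ℝ≥0∞) :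
    ∫⁻ x, G (Sm x₀ R x) = ENNReal.ofReal (R ^ (-(n:ℝ))) * ∫⁻ x, G x := by
  rw [← (emb_Sm x₀ hR).lintegral_map, map_Sm x₀ hR, lintegral_smul_measure, smul_eq_mul]

lemma int_Sm {n : ℕ} (x₀ : Eu n) {R : ℝ} (hR : 0 < R) (G : Eu n → ℝ) :
    ∫ x, G (Sm x₀ R x) = R ^ (-(n:ℝ)) * ∫ x, G x := by
  rw [← (emb_Sm x₀ hR).integral_map, map_Sm x₀ hR, integral_smul_measure, smul_eq_mul, ENNReal.toReal_ofReal (by positivity)]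

lemma slint_Sm {n : ℕ} (x₀ : Eu n) {R : ℝ} (hR : 0 < R) {D : Set (Eu n)} (hD : MeasurableSet D) (G : Eu n → ℝ≥0∞) :
    ∫⁻ x in Sm x₀ R ⁻¹' D, G (Sm x₀ R x) = ENNReal.ofReal (R ^ (-(n:ℝ))) * ∫⁻ x in D, G x := by
  rw [← lintegral_indicator (measurable_Sm x₀ R hD), ← lintegral_indicator hD, ← lint_Sm x₀ hR]
  rfl

lemma pre_ball {n : ℕ} (x₀ : Eu n) {R : ℝ} (hR : 0 < R) (r : ℝ) : Sm x₀ R ⁻¹' (ball x₀ (R * r)) = ball 0 r := by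
  ext x
  simp only [mem_preimage, mem_ball, Sm, dist_self_add_left, dist_zero_right, norm_smul, Real.norm_of_nonneg hR.le]
  exact mul_lt_mul_iff_right₀ hR

lemma dist_Sm {n : ℕ} (x₀ : Eu n) {R : ℝ} (hR : 0 < R) (x y : Eu n) : dist (Sm x₀ R x) (Sm x₀ R y) = R * dist x y := by
  simp only [Sm, dist_add_left, dist_smul₀, Real.norm_of_nonneg hR.le]

lemma gag_Sm {n : ℕ} {s p : ℝ} (x₀ : Eu n) {R : ℝ} (hR : 0 < R) {D : Set (Eu n)} (hD : MeasurableSet D) (g : Eu n → ℝ) (c : ℝ) :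
    gagliardoE n s p (Sm x₀ R ⁻¹' D) (fun x => g (Sm x₀ R x) - c) = ENNReal.ofReal (R ^ (s * p - n)) * gagliardoE n s p D g := by
  unfold gagliardoE
  have e1 : ∀ x y, ENNReal.ofReal (|g (Sm x₀ R x) - c - (g (Sm x₀ R y) - c)| ^ p / dist x y ^ ((n:ℝ) + s * p)) =
      ENNReal.ofReal (R ^ ((n:ℝ) + s * p)) * ENNReal.ofReal (|g (Sm x₀ R x) - g (Sm x₀ R y)| ^ p / dist (Sm x₀ R x) (Sm x₀ R y) ^ ((n:ℝ) + s * p)) := by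
    intro x y
    rw [dist_Sm x₀ hR, Real.mul_rpow hR.le dist_nonneg, ← ENNReal.ofReal_mul (by positivity), sub_sub_sub_cancel_right]
    congr 1
    have : R ^ ((n:ℝ) + s * p) ≠ 0 := by positivity
    field_simp
  simp_rw [e1]
  have e2 : ∀ x, ∫⁻ y in Sm x₀ R ⁻¹' D, ENNReal.ofReal (R ^ ((n:ℝ) + s * p)) * ENNReal.ofReal (|g (Sm x₀ R x) - g (Sm x₀ R y)| ^ p / dist (Sm x₀ R x) (Sm x₀ R y) ^ ((n:ℝ) + s * p))
     = ENNReal.ofReal (R ^ (s * p)) * ∫⁻ y in D, ENNReal.ofReal (|g (Sm x₀ R x) - g y| ^ p / dist (Sm x₀ R x) y ^ ((n:ℝ) + s * p)) := by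
    intro x
    rw [lintegral_const_mul' _ _ ENNReal.ofReal_ne_top, slint_Sm x₀ hR hD (fun y => ENNReal.ofReal (|g (Sm x₀ R x) - g y| ^ p / dist (Sm x₀ R x) y ^ ((n:ℝ) + s * p))),
      ← mul_assoc, ← ENNReal.ofReal_mul (by positivity), ← Real.rpow_add hR]
    congr 3; ring
  simp_rw [e2]
  rw [lintegral_const_mul' _ _ ENNReal.ofReal_ne_top, slint_Sm x₀ hR hD (fun x => ∫⁻ y in D, ENNReal.ofReal (|g x - g y| ^ p / dist x y ^ ((n:ℝ) + s * p))),
      ← mul_assoc, ← ENNReal.ofReal_mul (by positivity), ← Real.rpow_add hR]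
  congr 3

/-- inverse map -/
def Sv {n : ℕ} (x₀ : Eu n) (R : ℝ) (x : Eu n) : Eu n := R⁻¹ • (x - x₀)

@[fun_prop]
lemma measurable_Sv {n : ℕ} (x₀ : Eu n) (R : ℝ) : Measurable (Sv x₀ R) := by unfold Sv; fun_prop

lemma Sv_Sm {n : ℕ} (x₀ : Eu n) {R : ℝ} (hR : 0 < R) (x : Eu n) : Sv x₀ R (Sm x₀ R x) = x := by
  simp [Sv, Sm, smul_smul, hR.ne']

lemma norm_Sv {n : ℕ} (x₀ : Eu n) {R : ℝ} (hR : 0 < R) (x : Eu n) : R * ‖Sv x₀ R x‖ = dist x x₀ := by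
  rw [Sv, norm_smul, norm_inv, Real.norm_of_nonneg hR.le, dist_eq_norm]; field_simp

/-- Lipschitz functions have finite energy -/
lemma lip_bound {n : ℕ} (hn : 0 < n) {φ : Eu n → ℝ} {r L : ℝ} (hr : r < 1) (h0 : ∀ x, x ∉ ball (0 : Eu n) r → φ x = 0)
    (hL : ∀ x y, |φ x - φ y| ≤ L * ‖x - y‖) (x : Eu n) : |φ x| ≤ 2 * |L| := by
  have : Nonempty (Fin n) := ⟨⟨0, hn⟩⟩
  have hnt : Nontrivial (Eu n) := inferInstance
  by_cases hx : x ∈ ball (0 : Eu n) r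
  · obtain ⟨y, hy⟩ := exists_norm_eq (Eu n) (zero_le_one (α := ℝ))
    have := hL x y
    rw [h0 y (by rw [mem_ball_zero_iff, hy]; linarith), sub_zero] at this
    refine this.trans ?_
    rw [mem_ball_zero_iff] at hx
    have h2 := norm_sub_le x y
    rw [hy] at h2
    have h3 : ‖x - y‖ ≤ 2 := by linarith
    calc L * ‖x - y‖ ≤ |L| * 2 := mul_le_mul (le_abs_self _) h3 (norm_nonneg _) (abs_nonneg _)
      _ = _ := by ring
  · rw [h0 x hx]; simp

lemma lip_lp {n : ℕ} (hn : 0 < n) {p : ℝ} (hp : 1 < p) {φ : Eu n → ℝ} {r L : ℝ} (hr : r < 1) (h0 : ∀ x, x ∉ ball (0 : Eu n) r → φ x = 0)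
    (hL : ∀ x y, |φ x - φ y| ≤ L * ‖x - y‖) : ∫⁻ x, ENNReal.ofReal (|φ x| ^ p) < ⊤ := by
  have : ∫⁻ x, ENNReal.ofReal (|φ x| ^ p) ≤ ∫⁻ x in ball (0 : Eu n) 1, ENNReal.ofReal ((2 * |L|) ^ p) := by
    rw [← lintegral_indicator measurableSet_ball]
    refine lintegral_mono fun x => ?_
    by_cases hx : x ∈ ball (0 : Eu n) 1
    · rw [indicator_of_mem hx]
      exact ENNReal.ofReal_le_ofReal (Real.rpow_le_rpow (abs_nonneg _) (lip_bound hn hr h0 hL x) (by linarith))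
    · rw [h0 x (fun h => hx (ball_subset_ball hr.le h))]
      simp [Real.zero_rpow (by linarith : p ≠ 0)]
  refine this.trans_lt ?_
  rw [lintegral_const, Measure.restrict_apply MeasurableSet.univ, univ_inter]
  exact ENNReal.mul_lt_top ENNReal.ofReal_lt_top measure_ball_lt_top

lemma lip_gag {n : ℕ} (hn : 0 < n) {s p : ℝ} (hp : 1 < p) (hs : 0 < s) (hs1 : s < 1) {φ : Eu n → ℝ} (hφ : Measurable φ) {r L : ℝ} (hr : r < 1) (h0 : ∀ x, x ∉ ball (0 : Eu n) r → φ x = 0)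
    (hL : ∀ x y, |φ x - φ y| ≤ L * ‖x - y‖) : gagliardoE n s p univ φ < ⊤ := by
  have hp0 : 0 < p := by linarith
  obtain ⟨C, hC, h⟩ := bary (n := n) hn (s := s) (p := p) (by positivity) (by nlinarith)
  obtain ⟨H, hH⟩ : ∃ H : Eu n → Eu n → ℝ≥0∞, H = fun x y => (ball (0 : Eu n) 1).indicator (fun _ => 1) x * (ENNReal.ofReal ((4 * |L|) ^ p) * ENNReal.ofReal (min 1 (‖y - x‖ / 1) ^ p * kz n s p (y - x))) := ⟨_, rfl⟩
  have hHm : Measurable (Function.uncurry H) := by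
    rw [hH]; simp only [Function.uncurry_def]
    refine Measurable.mul ?_ (by fun_prop)
    exact (measurable_const.indicator measurableSet_ball).comp measurable_fst
  have hHi : ∫⁻ x, ∫⁻ y, H x y < ⊤ := by
    have e : ∀ x, ∫⁻ y, H x y ≤ (ball (0 : Eu n) 1).indicator (fun _ => 1) x * (ENNReal.ofReal ((4 * |L|) ^ p) * ENNReal.ofReal (C * 1 ^ (-(s * p)))) := by
      intro x
      rw [hH]
      rw [lintegral_const_mul _ (by fun_prop), lintegral_const_mul' _ _ ENNReal.ofReal_ne_top]
      exact mul_le_mul' le_rfl (mul_le_mul' le_rfl (h 1 one_pos x))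
    refine (lintegral_mono e).trans_lt ?_
    rw [lintegral_mul_const _ (measurable_const.indicator measurableSet_ball), lintegral_indicator measurableSet_ball]
    simp only [lintegral_const, Measure.restrict_apply MeasurableSet.univ, univ_inter, one_mul]
    exact ENNReal.mul_lt_top measure_ball_lt_top (ENNReal.mul_lt_top ENNReal.ofReal_lt_top ENNReal.ofReal_lt_top)
  have hd : ∀ x y, |φ y - φ x| ≤ 4 * |L| * min 1 (‖y - x‖ / 1) := by
    intro x y
    rw [mul_min_of_nonneg _ _ (by positivity)]
    refine le_min ?_ ?_
    · have h1 := lip_bound hn hr h0 hL x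
      have h2 := lip_bound hn hr h0 hL y
      have := abs_sub (φ y) (φ x)
      linarith
    · refine (hL y x).trans ?_
      rw [div_one]
      have := le_abs_self L
      have := abs_nonneg L
      exact mul_le_mul_of_nonneg_right (by linarith) (norm_nonneg _)
  have hle : ∀ x y, ENNReal.ofReal (|φ y - φ x| ^ p * kz n s p (y - x)) ≤ H x y + H y x := by
    intro x y
    have k1 : ENNReal.ofReal (|φ y - φ x| ^ p * kz n s p (y - x)) ≤ ENNReal.ofReal ((4 * |L|) ^ p) * ENNReal.ofReal (min 1 (‖y - x‖ / 1) ^ p * kz n s p (y - x)) := by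
      rw [← ENNReal.ofReal_mul (by positivity), ← mul_assoc, ← Real.mul_rpow (by positivity) (by positivity)]
      exact ENNReal.ofReal_le_ofReal (mul_le_mul_of_nonneg_right (Real.rpow_le_rpow (abs_nonneg _) (hd x y) hp0.le) (kz_nonneg _))
    by_cases hx : x ∈ ball (0 : Eu n) 1
    · refine le_trans ?_ le_self_add
      rw [hH]
      simp only [indicator_of_mem hx, one_mul]
      exact k1
    · by_cases hy : y ∈ ball (0 : Eu n) 1
      · refine le_trans ?_ le_add_self
        rw [hH]
        simp only [indicator_of_mem hy, one_mul]
        rw [← norm_neg (x - y), neg_sub, ← kz_neg (x - y), neg_sub]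
        exact k1
      · rw [h0 x (fun h => hx (ball_subset_ball hr.le h)), h0 y (fun h => hy (ball_subset_ball hr.le h))]
        simp [Real.zero_rpow hp0.ne']
  rw [gag_eq, Measure.restrict_univ]
  refine (lintegral_mono fun x => lintegral_mono fun y => hle x y).trans_lt ?_
  have hm2 : Measurable (fun q : Eu n × Eu n => H q.1 q.2) := hHm
  have m1 : ∀ x, Measurable (H x) := fun x => hm2.comp (measurable_const.prodMk measurable_id)
  simp_rw [lintegral_add_left (m1 _)]
  rw [lintegral_add_left (Measurable.lintegral_prod_right' hm2)]
  refine ENNReal.add_lt_top.2 ⟨hHi, ?_⟩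
  rw [lintegral_lintegral_swap (f := fun a b => H b a) (Measurable.aemeasurable (hm2.comp measurable_swap))]
  exact hHi




lemma lip_of_C1 {n : ℕ} {U : Eu n → ℝ} (hU : ContDiffOn ℝ 1 U (ball 0 1)) {r : ℝ} (hr : r < 1) :
    ∃ L : ℝ, 0 ≤ L ∧ ∀ x ∈ ball (0 : Eu n) r, ∀ y ∈ ball (0 : Eu n) r, |U x - U y| ≤ L * ‖x - y‖ := by
  have hsub : closedBall (0 : Eu n) r ⊆ ball 0 1 := closedBall_subset_ball hr
  have hc : ContinuousOn (fderiv ℝ U) (closedBall 0 r) := (hU.continuousOn_fderiv_of_isOpen isOpen_ball le_rfl).mono hsub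
  obtain ⟨L, hL⟩ := (isCompact_closedBall (0 : Eu n) r).exists_bound_of_continuousOn hc
  refine ⟨|L|, abs_nonneg _, fun x hx y hy => ?_⟩
  have := (convex_ball (0 : Eu n) r).norm_image_sub_le_of_norm_fderiv_le (𝕜 := ℝ) (f := U) (C := |L|) (fun z hz => ?_) (fun z hz => ?_) hy hx
  · simpa using this
  · exact (hU.contDiffAt (isOpen_ball.mem_nhds (hsub (ball_subset_closedBall hz)))).differentiableAt one_ne_zero
  · exact (hL z (ball_subset_closedBall hz)).trans (le_abs_self _)

lemma eq_transfer {n : ℕ} (hn : 0 < n) {p s : ℝ} (hp : 1 < p) (hs : 0 < s) (hs1 : s < 1) {D : Set (Eu n)} {F g g' : Eu n → ℝ}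
    (hsol : IsLocalWeakSolution n p s D F g) (hae : ∀ᵐ x, g' x = g x) (x₀ : Eu n) {R : ℝ} (hR : 0 < R) (hD : ball x₀ R ⊆ D)
    (c : ℝ) {φ : Eu n → ℝ} (hφ : Measurable φ) {r L : ℝ} (hr : r < 1) (h0 : ∀ x, x ∉ ball (0 : Eu n) r → φ x = 0)
    (hL : ∀ x y, |φ x - φ y| ≤ L * ‖x - y‖) {U : Eu n → ℝ} (hU : ∀ x, U x = g' (Sm x₀ R x) - c) :
    (∫ x, ∫ y, |U x - U y| ^ (p - 2) * (U x - U y) * (φ x - φ y) / dist x y ^ ((n : ℝ) + s * p)) =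
      ∫ x in ball (0 : Eu n) 1, R ^ (s * p) * F (Sm x₀ R x) * φ x := by
  obtain ⟨ψ, hψ⟩ : ∃ ψ : Eu n → ℝ, ψ = fun x => φ (Sv x₀ R x) := ⟨_, rfl⟩
  have ψS : ∀ x, ψ (Sm x₀ R x) = φ x := fun x => by rw [hψ]; simp only [Sv_Sm x₀ hR]
  have ψ0 : ∀ x, x ∉ closedBall x₀ (R * r) → ψ x = 0 := by
    intro x hx
    rw [hψ]
    refine h0 _ fun h => hx ?_
    rw [mem_ball_zero_iff] at h
    rw [mem_closedBall, ← norm_Sv x₀ hR]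
    exact mul_le_mul_of_nonneg_left h.le hR.le
  have hsub : closedBall x₀ (R * r) ⊆ D := (closedBall_subset_ball (by nlinarith)).trans hD
  have hψm : Measurable ψ := by rw [hψ]; fun_prop
  have hψp : ∫⁻ x, ENNReal.ofReal (|ψ x| ^ p) < ⊤ := by
    have h1 := lip_lp hn hp hr h0 hL
    have h2 := lint_Sm x₀ hR (fun x => ENNReal.ofReal (|ψ x| ^ p))
    simp only [ψS] at h2
    rw [h2] at h1
    exact (ENNReal.lt_top_of_mul_ne_top_right h1.ne (by simp; positivity))
  have hψg : gagliardoE n s p univ ψ < ⊤ := by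
    have h1 := lip_gag hn hp hs hs1 hφ hr h0 hL
    have h2 := gag_Sm (s := s) (p := p) x₀ hR MeasurableSet.univ ψ 0
    simp only [ψS, sub_zero, preimage_univ] at h2
    rw [h2] at h1
    exact (ENNReal.lt_top_of_mul_ne_top_right h1.ne (by simp; positivity))
  have E := hsol.2.2.2 ψ hψm ⟨_, isCompact_closedBall x₀ (R * r), hsub, Filter.Eventually.of_forall ψ0⟩ hψp hψg
  have hR1 : ∫ x in D, F x * ψ x = ∫ x, F x * ψ x :=
    setIntegral_eq_integral_of_forall_compl_eq_zero fun x hx => by rw [ψ0 x (fun h => hx (hsub h)), mul_zero]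
  have hR2 : ∫ x in ball (0 : Eu n) 1, R ^ (s * p) * F (Sm x₀ R x) * φ x = R ^ (s * p) * (R ^ (-(n:ℝ)) * ∫ x, F x * ψ x) := by
    rw [setIntegral_eq_integral_of_forall_compl_eq_zero (fun x hx => by rw [h0 x (fun h => hx (ball_subset_ball hr.le h)), mul_zero]),
      ← int_Sm x₀ hR (fun x => F x * ψ x), ← integral_const_mul]
    simp only [ψS, mul_assoc]
  obtain ⟨I, hI⟩ : ∃ I : Eu n → Eu n → ℝ, I = fun x y => |g' x - g' y| ^ (p - 2) * (g' x - g' y) * (ψ x - ψ y) / dist x y ^ ((n : ℝ) + s * p) := ⟨_, rfl⟩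
  have hL1 : (∫ x, ∫ y, |g x - g y| ^ (p - 2) * (g x - g y) * (ψ x - ψ y) / dist x y ^ ((n : ℝ) + s * p)) = ∫ x, ∫ y, I x y := by
    refine integral_congr_ae (hae.mono fun x hx => ?_)
    refine integral_congr_ae (hae.mono fun y hy => ?_)
    simp only [hI, hx, hy]
  have hI2 : ∀ x y, |U x - U y| ^ (p - 2) * (U x - U y) * (φ x - φ y) / dist x y ^ ((n : ℝ) + s * p) = R ^ ((n:ℝ) + s * p) * I (Sm x₀ R x) (Sm x₀ R y) := by
    intro x y
    rw [hI]
    simp only [ψS, hU, sub_sub_sub_cancel_right]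
    rw [dist_Sm x₀ hR, Real.mul_rpow hR.le dist_nonneg]
    have : R ^ ((n:ℝ) + s * p) ≠ 0 := by positivity
    field_simp
  have hL2 : (∫ x, ∫ y, |U x - U y| ^ (p - 2) * (U x - U y) * (φ x - φ y) / dist x y ^ ((n : ℝ) + s * p)) =
      R ^ ((n:ℝ) + s * p) * (R ^ (-(n:ℝ)) * (R ^ (-(n:ℝ)) * ∫ x, ∫ y, I x y)) := by
    simp_rw [hI2, integral_const_mul]
    congr 1
    have : ∀ x, ∫ y, I (Sm x₀ R x) (Sm x₀ R y) = R ^ (-(n:ℝ)) * ∫ y, I (Sm x₀ R x) y := fun x => int_Sm x₀ hR (fun y => I (Sm x₀ R x) y)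
    simp_rw [this, integral_const_mul]
    congr 1
    exact int_Sm x₀ hR (fun x => ∫ y, I x y)
  rw [hL2, hR2, ← hL1, E, hR1, ← mul_assoc, ← mul_assoc, ← mul_assoc, ← Real.rpow_add hR, ← Real.rpow_add hR, ← Real.rpow_add hR]
  congr 2; ring

lemma tl_fin {n : ℕ} (hn : 0 < n) {p s : ℝ} (hp : 1 < p) (hs : 0 < s) {g U : Eu n → ℝ} (hg : Measurable g)
    (ht : (∫⁻ x, ENNReal.ofReal (|g x| ^ (p - 1) / (1 + ‖x‖) ^ ((n : ℝ) + s * p))) < ⊤) (x₀ : Eu n) {R : ℝ} (hR : 0 < R) (c : ℝ)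
    (hU : ∀ x, U x = g (Sm x₀ R x) - c) : TL n s p U < ⊤ := by
  have hp0 : 0 < p := by linarith
  obtain ⟨C, hC, hk⟩ := kfar (n := n) hn (s := s) (p := p) (by positivity) one_pos
  obtain ⟨m, hm⟩ : ∃ m, m = (n:ℝ) + s * p := ⟨_, rfl⟩
  have hm0 : 0 ≤ m := by rw [hm]; positivity
  obtain ⟨K, hK⟩ : ∃ K, K = (1 + ‖x₀‖ + R) ^ m := ⟨_, rfl⟩
  have hK0 : 0 ≤ K := by rw [hK]; positivity
  have key : ∀ x ∈ (ball (0 : Eu n) 1)ᶜ, ENNReal.ofReal (|U x| ^ (p - 1) * kz n s p x) ≤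
     ENNReal.ofReal (2 ^ (p - 1) * K) * ENNReal.ofReal (|g (Sm x₀ R x)| ^ (p - 1) / (1 + ‖Sm x₀ R x‖) ^ m)
      + ENNReal.ofReal (2 ^ (p - 1) * |c| ^ (p - 1)) * ENNReal.ofReal (kz n s p x) := by
    intro x hx
    have hx1 : 1 ≤ ‖x‖ := by simpa using hx
    rw [← ENNReal.ofReal_mul (by positivity), ← ENNReal.ofReal_mul (by positivity), ← ENNReal.ofReal_add (by positivity) (mul_nonneg (by positivity) (kz_nonneg _))]
    apply ENNReal.ofReal_le_ofReal
    have h1 := abs_sub_rpow_le (by linarith : 0 ≤ p - 1) (g (Sm x₀ R x)) c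
    have h2 : kz n s p x ≤ K / (1 + ‖Sm x₀ R x‖) ^ m := by
      unfold kz
      rw [← hm, Real.rpow_neg (norm_nonneg _), hK, ← Real.div_rpow (by positivity) (by positivity), ← Real.inv_rpow (norm_nonneg _)]
      refine Real.rpow_le_rpow (by positivity) ?_ hm0
      rw [inv_eq_one_div, div_le_div_iff₀ (by linarith) (by positivity)]
      have : ‖Sm x₀ R x‖ ≤ ‖x₀‖ + R * ‖x‖ := by
        refine (norm_add_le _ _).trans ?_
        rw [norm_smul, Real.norm_of_nonneg hR.le]
      nlinarith [norm_nonneg x₀]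
    have hk0 := kz_nonneg (s := s) (p := p) x
    rw [hU]
    calc _ ≤ 2 ^ (p - 1) * (|g (Sm x₀ R x)| ^ (p - 1) + |c| ^ (p - 1)) * kz n s p x := mul_le_mul_of_nonneg_right h1 hk0
      _ = 2 ^ (p - 1) * |g (Sm x₀ R x)| ^ (p - 1) * kz n s p x + 2 ^ (p - 1) * |c| ^ (p - 1) * kz n s p x := by ring
      _ ≤ 2 ^ (p - 1) * |g (Sm x₀ R x)| ^ (p - 1) * (K / (1 + ‖Sm x₀ R x‖) ^ m) + 2 ^ (p - 1) * |c| ^ (p - 1) * kz n s p x :=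
        add_le_add (mul_le_mul_of_nonneg_left h2 (by positivity)) le_rfl
      _ = _ := by ring
  unfold TL
  refine (setLIntegral_mono' measurableSet_ball.compl key).trans_lt ?_
  rw [lintegral_add_left (by fun_prop), lintegral_const_mul' _ _ ENNReal.ofReal_ne_top, lintegral_const_mul' _ _ ENNReal.ofReal_ne_top]
  refine ENNReal.add_lt_top.2 ⟨ENNReal.mul_lt_top ENNReal.ofReal_lt_top ?_, ENNReal.mul_lt_top ENNReal.ofReal_lt_top (hk.trans_lt ENNReal.ofReal_lt_top)⟩
  refine (setLIntegral_le_lintegral _ _).trans_lt ?_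
  rw [lint_Sm x₀ hR (fun x => ENNReal.ofReal (|g x| ^ (p - 1) / (1 + ‖x‖) ^ m)), hm]
  exact ENNReal.mul_lt_top ENNReal.ofReal_lt_top ht

lemma ball_Sm {n : ℕ} (x₀ : Eu n) {R : ℝ} (hR : 0 < R) : Sm x₀ R ⁻¹' (ball x₀ R) = ball 0 1 := by
  have := pre_ball x₀ hR 1
  rwa [mul_one] at this

lemma sol_transfer {n : ℕ} (hn : 0 < n) {p s : ℝ} (hp : 1 < p) (hs : 0 < s) (hs1 : s < 1) {D : Set (Eu n)} {F g g' : Eu n → ℝ}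
    (hsol : IsLocalWeakSolution n p s D F g) (hF : Measurable F) (hg' : Measurable g') (hae : ∀ᵐ x, g' x = g x) (x₀ : Eu n) {R : ℝ} (hR : 0 < R) (hD : ball x₀ R ⊆ D)
    (hlp : ∫⁻ x in ball x₀ R, ENNReal.ofReal (|g' x| ^ p) < ⊤) (hgag : gagliardoE n s p (ball x₀ R) g' < ⊤)
    (hFp : ∫⁻ x in ball x₀ R, ENNReal.ofReal (|F x| ^ (p / (p - 1))) < ⊤) (hC : ContDiffOn ℝ 1 g' (ball x₀ R))
    (c : ℝ) : Sol n p s (fun x => R ^ (s * p) * F (Sm x₀ R x)) (fun x => g' (Sm x₀ R x) - c) where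
  mU := by fun_prop
  mf := by fun_prop
  lp := by
    have hp0 : 0 < p := by linarith
    refine (Nr_sub_le (g1 := fun x => g' (Sm x₀ R x)) (g2 := fun _ => c) hp0.le (by fun_prop)).trans_lt ?_
    refine ENNReal.mul_lt_top ENNReal.ofReal_lt_top (ENNReal.add_lt_top.2 ⟨?_, ?_⟩)
    · unfold Nr
      rw [← ball_Sm x₀ hR, slint_Sm x₀ hR measurableSet_ball (fun x => ENNReal.ofReal (|g' x| ^ p))]
      exact ENNReal.mul_lt_top ENNReal.ofReal_lt_top hlp
    · unfold Nr
      rw [lintegral_const, Measure.restrict_apply MeasurableSet.univ, univ_inter]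
      exact ENNReal.mul_lt_top ENNReal.ofReal_lt_top measure_ball_lt_top
  gag := by
    rw [← ball_Sm x₀ hR, gag_Sm x₀ hR measurableSet_ball]
    exact ENNReal.mul_lt_top ENNReal.ofReal_lt_top hgag
  tl := by
    refine tl_fin hn hp hs hg' ?_ x₀ hR c (fun x => rfl)
    refine lt_of_eq_of_lt (lintegral_congr_ae (hae.mono fun x hx => ?_)) hsol.2.2.1
    simp only [hx]
  F := by
    have hp1 : 0 < p - 1 := by linarith
    have hp0 : 0 < p := by linarith
    unfold Nr
    have : ∀ x, ENNReal.ofReal (|R ^ (s * p) * F (Sm x₀ R x)| ^ (p / (p - 1))) =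
        ENNReal.ofReal ((R ^ (s * p)) ^ (p / (p - 1))) * ENNReal.ofReal (|F (Sm x₀ R x)| ^ (p / (p - 1))) := by
      intro x
      rw [abs_mul, abs_of_nonneg (by positivity), Real.mul_rpow (by positivity) (abs_nonneg _), ENNReal.ofReal_mul (by positivity)]
    simp_rw [this]
    rw [lintegral_const_mul' _ _ ENNReal.ofReal_ne_top, ← ball_Sm x₀ hR, slint_Sm x₀ hR measurableSet_ball (fun x => ENNReal.ofReal (|F x| ^ (p / (p - 1))))]
    exact ENNReal.mul_lt_top ENNReal.ofReal_lt_top (ENNReal.mul_lt_top ENNReal.ofReal_lt_top hFp)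
  lip := by
    intro r hr
    refine lip_of_C1 ?_ hr
    refine ContDiffOn.sub ?_ contDiffOn_const
    refine hC.comp (g := g') (f := Sm x₀ R) ?_ ?_
    · exact ContDiff.contDiffOn (by unfold Sm; fun_prop)
    · intro x hx; rw [← ball_Sm x₀ hR] at hx; exact hx
  eq := by
    intro φ hφ r hr h0 hL
    obtain ⟨L, hL⟩ := hL
    exact eq_transfer hn hp hs hs1 hsol hae x₀ hR hD c hφ hr h0 hL (fun x => rfl)




lemma sint_Sm {n : ℕ} (x₀ : Eu n) {R : ℝ} (hR : 0 < R) {D : Set (Eu n)} (hD : MeasurableSet D) (G : Eu n → ℝ) :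
    ∫ x in Sm x₀ R ⁻¹' D, G (Sm x₀ R x) = R ^ (-(n:ℝ)) * ∫ x in D, G x := by
  rw [← integral_indicator (measurable_Sm x₀ R hD), ← integral_indicator hD, ← int_Sm x₀ hR]
  rfl

lemma grad_diff {n : ℕ} (u v : Eu n → ℝ) (x : Eu n) :
    ‖gradient u x - gradient v x‖ = ‖fderiv ℝ u x - fderiv ℝ v x‖ := by
  unfold gradient
  rw [← map_sub, LinearIsometryEquiv.norm_map]

lemma grad_norm {n : ℕ} (u : Eu n → ℝ) (x : Eu n) : ‖gradient u x‖ = ‖fderiv ℝ u x‖ := by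
  unfold gradient
  rw [LinearIsometryEquiv.norm_map]

lemma fderiv_Sm {n : ℕ} (x₀ : Eu n) (R : ℝ) {g : Eu n → ℝ} (c : ℝ) {x : Eu n} (hg : DifferentiableAt ℝ g (Sm x₀ R x)) :
    fderiv ℝ (fun x => g (Sm x₀ R x) - c) x = R • fderiv ℝ g (Sm x₀ R x) := by
  have h1 : HasFDerivAt (Sm x₀ R) (R • ContinuousLinearMap.id ℝ (Eu n)) x := by
    unfold Sm
    exact ((hasFDerivAt_id x).const_smul R).const_add x₀
  have h2 := (hg.hasFDerivAt.comp x h1).sub_const c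
  have h3 := h2.fderiv
  simp only [Function.comp_def] at h3
  rw [h3]
  ext y
  simp

lemma cd_Sm {n : ℕ} (x₀ : Eu n) {R : ℝ} {g : Eu n → ℝ} (c : ℝ) {D : Set (Eu n)} (hg : ContDiffOn ℝ 1 g D) :
    ContDiffOn ℝ 1 (fun x => g (Sm x₀ R x) - c) (Sm x₀ R ⁻¹' D) := by
  have h1 : ContDiff ℝ 1 (Sm x₀ R) := by unfold Sm; fun_prop
  exact (hg.comp h1.contDiffOn (fun x hx => hx)).sub contDiffOn_const

lemma gag_congr {n : ℕ} {s p : ℝ} {D : Set (Eu n)} (hD : MeasurableSet D) {g h : Eu n → ℝ} (e : ∀ x ∈ D, g x = h x) :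
    gagliardoE n s p D g = gagliardoE n s p D h := by
  unfold gagliardoE
  refine setLIntegral_congr_fun hD fun x hx => ?_
  refine setLIntegral_congr_fun hD fun y hy => ?_
  simp only [e x hx, e y hy]

/-- rescaled integrals of p-th powers with a factor -/
lemma sc_int {n : ℕ} (x₀ : Eu n) {R : ℝ} (hR : 0 < R) {D : Set (Eu n)} (hD : MeasurableSet D) {a b : ℝ} {H G : Eu n → ℝ} (hG : ∀ x, 0 ≤ G x)
    (e : ∀ x ∈ Sm x₀ R ⁻¹' D, H x = R ^ a * G (Sm x₀ R x)) (q : ℝ) (hb : b = a * q - n) :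
    ∫⁻ x in Sm x₀ R ⁻¹' D, ENNReal.ofReal (H x ^ q) = ENNReal.ofReal (R ^ b) * ∫⁻ x in D, ENNReal.ofReal (G x ^ q) := by
  rw [setLIntegral_congr_fun (measurable_Sm x₀ R hD) (g := fun x => ENNReal.ofReal (R ^ (a*q)) * ENNReal.ofReal (G (Sm x₀ R x) ^ q))
    (fun x hx => by
      simp only
      rw [e x hx, Real.mul_rpow (by positivity) (hG _), ← Real.rpow_mul hR.le, ENNReal.ofReal_mul (by positivity)])]
  rw [lintegral_const_mul' _ _ ENNReal.ofReal_ne_top, slint_Sm x₀ hR hD (fun y => ENNReal.ofReal (G y ^ q)), ← mul_assoc,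
    ← ENNReal.ofReal_mul (by positivity), ← Real.rpow_add hR, hb]
  rfl

lemma tl_Sm {n : ℕ} {s p : ℝ} (x₀ : Eu n) {R : ℝ} (hR : 0 < R) (g : Eu n → ℝ) :
    TL n s p (fun x => g (Sm x₀ R x)) = ENNReal.ofReal (R ^ (s * p)) *
      ∫⁻ x in (ball x₀ R)ᶜ, ENNReal.ofReal (|g x| ^ (p - 1) / dist x x₀ ^ ((n : ℝ) + s * p)) := by
  unfold TL
  have e1 : (ball (0 : Eu n) 1)ᶜ = Sm x₀ R ⁻¹' (ball x₀ R)ᶜ := by rw [preimage_compl, ball_Sm x₀ hR]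
  have e2 : ∀ x, ENNReal.ofReal (|g (Sm x₀ R x)| ^ (p - 1) * kz n s p x) = ENNReal.ofReal (R ^ ((n:ℝ) + s * p)) *
      ENNReal.ofReal (|g (Sm x₀ R x)| ^ (p - 1) / dist (Sm x₀ R x) x₀ ^ ((n : ℝ) + s * p)) := by
    intro x
    have : dist (Sm x₀ R x) x₀ = R * ‖x‖ := by
      simp only [Sm, dist_self_add_left, norm_smul, Real.norm_of_nonneg hR.le]
    rw [this, ← ENNReal.ofReal_mul (by positivity), Real.mul_rpow hR.le (norm_nonneg _)]
    congr 1
    unfold kz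
    rw [Real.rpow_neg (norm_nonneg _)]
    have : R ^ ((n:ℝ) + s * p) ≠ 0 := by positivity
    field_simp
  simp_rw [e2]
  rw [lintegral_const_mul' _ _ ENNReal.ofReal_ne_top, e1, slint_Sm x₀ hR measurableSet_ball.compl
    (fun y => ENNReal.ofReal (|g y| ^ (p - 1) / dist y x₀ ^ ((n : ℝ) + s * p))), ← mul_assoc,
    ← ENNReal.ofReal_mul (by positivity), ← Real.rpow_add hR]
  congr 3
  ring_nf




theorem comparison_gradient_level (n : ℕ) (p s α : ℝ) (hp : 1 < p)
    (hs₁ : 0 < s) (hs₂ : s < 1) (hsp : 1 < s * (p / (p - 1)))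
    (hα₁ : 0 < α) (hα₂ : α < (s * (p / (p - 1)) - 1) * min 1 (p - 1)) :
    ∃ c : ℝ, 0 < c ∧
      ∀ (Ω : Set (EuclideanSpace ℝ (Fin n))) (f u v : EuclideanSpace ℝ (Fin n) → ℝ)
        (x₀ : EuclideanSpace ℝ (Fin n)) (R : ℝ),
        IsOpen Ω → Bornology.IsBounded Ω →
        MemLploc n (p / (p - 1)) Ω f →
        0 < R → closedBall x₀ (2 * R) ⊆ Ω →
        IsLocalWeakSolution n p s Ω f u →
        ContDiffOn ℝ 1 u Ω →
        IsLocalWeakSolution n p s (ball x₀ R) (fun _ => 0) v →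
        ContDiffOn ℝ 1 v (ball x₀ R) →
        (∫⁻ x in ball x₀ R, ENNReal.ofReal (|v x| ^ p)) < ⊤ →
        gagliardoE n s p (ball x₀ R) v < ⊤ →
        (∀ᵐ x, x ∉ ball x₀ R → v x = u x) →
        ∀ δ : ℝ, 0 < δ → δ ≤ 1 →
          (∫⁻ x in ball x₀ (R / 2),
              ENNReal.ofReal (‖gradient u x - gradient v x‖ ^ p)) ≤
            ENNReal.ofReal δ *
                ((∫⁻ x in ball x₀ (2 * R), ENNReal.ofReal (‖gradient u x‖ ^ p)) +
                  ENNReal.ofReal (R ^ ((n : ℝ) - p)) *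
                    tailE n s p (fun x => u x - ⨍ y in ball x₀ R, u y) x₀ R ^ p) +
              ENNReal.ofReal
                  (c * δ ^ (-((1 + α) / (α * (p - 1)))) *
                    R ^ (p * (s * (p / (p - 1)) - 1))) *
                ∫⁻ x in ball x₀ R, ENNReal.ofReal (|f x| ^ (p / (p - 1))) := by
  rcases Nat.eq_zero_or_pos n with rfl | hn
  · refine ⟨1, one_pos, fun Ω f u v x₀ R _ _ _ _ _ _ _ _ _ _ _ _ δ _ _ => ?_⟩
    have h0 : ∀ x, gradient u x - gradient v x = 0 := fun x => Subsingleton.elim _ _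
    simp only [h0, norm_zero, Real.zero_rpow (by linarith : p ≠ 0), ENNReal.ofReal_zero, lintegral_zero]
    exact zero_le
  obtain ⟨c, hc, H⟩ := norm_thm hn hp hs₁ hs₂ hsp hα₁ hα₂
  refine ⟨c, hc, fun Ω f u v x₀ R hΩ _ hf hR hcl hu hu1 hv hv1 hvp hvg hvu δ hδ hδ1 => ?_⟩
  have hp0 : 0 < p := by linarith
  have hp1 : 0 < p - 1 := by linarith
  have hb2 : ball x₀ (R * 2) ⊆ closedBall x₀ (2 * R) := by rw [mul_comm]; exact ball_subset_closedBall
  have hb1 : ball x₀ R ⊆ closedBall x₀ (2 * R) := (ball_subset_ball (by linarith)).trans hb2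
  obtain ⟨hu_lp, hu_g⟩ := hu.2.1 _ hcl (isCompact_closedBall x₀ (2 * R))
  have hf_p := hf.2 _ hcl (isCompact_closedBall x₀ (2 * R))
  obtain ⟨c0, hc0⟩ : ∃ c0, c0 = ⨍ y in ball x₀ R, u y := ⟨_, rfl⟩
  obtain ⟨v', hv'⟩ : ∃ v' : Eu n → ℝ, v' = (open Classical in fun X => if X ∈ ball x₀ R then v X else u X) := ⟨_, rfl⟩
  have hv'in : ∀ x ∈ ball x₀ R, v' x = v x := fun x hx => by rw [hv']; simp only [if_pos hx]
  have hv'out : ∀ x, x ∉ ball x₀ R → v' x = u x := fun x hx => by rw [hv']; simp only [if_neg hx]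
  have hv'm : Measurable v' := by rw [hv']; exact Measurable.ite measurableSet_ball hv.1 hu.1
  have hv'ae : ∀ᵐ x, v' x = v x := by
    filter_upwards [hvu] with x hx
    by_cases h : x ∈ ball x₀ R
    · exact hv'in x h
    · rw [hv'out x h, hx h]
  have hv'C : ContDiffOn ℝ 1 v' (ball x₀ R) := hv1.congr hv'in
  have cmp : Cmp n p s (fun x => R ^ (s * p) * f (Sm x₀ R x)) (fun x => u (Sm x₀ R x) - c0) (fun x => v' (Sm x₀ R x) - c0) := by
    refine ⟨?_, ?_, ?_, ?_⟩
    · exact sol_transfer hn hp hs₁ hs₂ hu hf.1 hu.1 (Filter.Eventually.of_forall fun _ => rfl) x₀ hR (hb1.trans hcl)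
        ((lintegral_mono_set hb1).trans_lt hu_lp) ((gag_mono hb1 u).trans_lt hu_g) ((lintegral_mono_set hb1).trans_lt hf_p)
        (hu1.mono (hb1.trans hcl)) c0
    · have h := sol_transfer hn hp hs₁ hs₂ hv measurable_const hv'm hv'ae x₀ hR subset_rfl
        (by
          rw [setLIntegral_congr_fun measurableSet_ball (g := fun x => ENNReal.ofReal (|v x| ^ p)) fun x hx => by simp only [hv'in x hx]]
          exact hvp)
        (by rw [gag_congr measurableSet_ball hv'in]; exact hvg)
        (by
          simp only [abs_zero, Real.zero_rpow (div_pos hp0 hp1).ne', ENNReal.ofReal_zero, lintegral_zero]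
          exact ENNReal.zero_lt_top) hv'C c0
      simpa only [mul_zero] using h
    · intro x hx
      rw [← ball_Sm x₀ hR] at hx
      simp only [hv'out _ hx]
    · rw [← pre_ball x₀ hR 2, gag_Sm x₀ hR measurableSet_ball]
      exact ENNReal.mul_lt_top ENNReal.ofReal_lt_top ((gag_mono hb2 u).trans_lt hu_g)
  have hu2 : ContDiffOn ℝ 1 (fun x => u (Sm x₀ R x) - c0) (ball 0 2) := by
    rw [← pre_ball x₀ hR 2]
    exact cd_Sm x₀ c0 (hu1.mono (hb2.trans hcl))
  have hv2 : ContDiffOn ℝ 1 (fun x => v' (Sm x₀ R x) - c0) (ball 0 1) := by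
    rw [← ball_Sm x₀ hR]
    exact cd_Sm x₀ c0 hv'C
  have hmean : ∫ x in ball (0 : Eu n) 1, (fun x => u (Sm x₀ R x) - c0) x = 0 := by
    rw [← ball_Sm x₀ hR, sint_Sm x₀ hR measurableSet_ball (fun x => u x - c0), hc0]
    have : IsFiniteMeasure (volume.restrict (ball x₀ R)) := ⟨by rw [Measure.restrict_apply_univ]; exact measure_ball_lt_top⟩
    rw [integral_sub_average, mul_zero]
  have key := H _ _ _ cmp hu2 hv2 hmean δ hδ hδ1
  have du : ∀ x ∈ ball x₀ (R * 2), DifferentiableAt ℝ u x := fun x hx =>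
    (hu1.contDiffAt (hΩ.mem_nhds (hcl (hb2 hx)))).differentiableAt one_ne_zero
  have dv : ∀ x ∈ ball x₀ R, DifferentiableAt ℝ v' x ∧ fderiv ℝ v' x = fderiv ℝ v x := fun x hx =>
    ⟨(hv'C.contDiffAt (isOpen_ball.mem_nhds hx)).differentiableAt one_ne_zero,
      Filter.EventuallyEq.fderiv_eq (Filter.eventuallyEq_of_mem (isOpen_ball.mem_nhds hx) hv'in)⟩
  have s1 : ball x₀ (R * (1/2)) ⊆ ball x₀ R := ball_subset_ball (by linarith)
  have s2 : ball x₀ (R * (1/2)) ⊆ ball x₀ (R * 2) := ball_subset_ball (by linarith)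
  have E1 := sc_int x₀ hR (D := ball x₀ (R * (1/2))) measurableSet_ball (a := 1) (b := p - n)
    (H := fun x => ‖fderiv ℝ (fun x => u (Sm x₀ R x) - c0) x - fderiv ℝ (fun x => v' (Sm x₀ R x) - c0) x‖)
    (G := fun x => ‖gradient u x - gradient v x‖) (fun _ => norm_nonneg _)
    (fun x hx => by
      rw [fderiv_Sm x₀ R c0 (du _ (s2 hx)), fderiv_Sm x₀ R c0 (dv _ (s1 hx)).1, (dv _ (s1 hx)).2, ← smul_sub, norm_smul,
        Real.norm_of_nonneg hR.le, grad_diff, Real.rpow_one]) p (by ring)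
  have E2 := sc_int x₀ hR (D := ball x₀ (R * 2)) measurableSet_ball (a := 1) (b := p - n)
    (H := fun x => ‖fderiv ℝ (fun x => u (Sm x₀ R x) - c0) x‖)
    (G := fun x => ‖gradient u x‖) (fun _ => norm_nonneg _)
    (fun x hx => by
      rw [fderiv_Sm x₀ R c0 (du _ hx), norm_smul,
        Real.norm_of_nonneg hR.le, grad_norm, Real.rpow_one]) p (by ring)
  have E3 := sc_int x₀ hR (D := ball x₀ R) measurableSet_ball (a := s * p) (b := s * p * (p / (p - 1)) - n)
    (H := fun x => |R ^ (s * p) * f (Sm x₀ R x)|)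
    (G := fun x => |f x|) (fun _ => abs_nonneg _)
    (fun x hx => by
      rw [abs_mul, abs_of_nonneg (by positivity)]) (p / (p - 1)) (by ring)
  have E4 := tl_Sm (s := s) (p := p) x₀ hR (fun x => u x - c0)
  rw [pre_ball x₀ hR] at E1 E2
  rw [ball_Sm x₀ hR] at E3
  have E5 : tailE n s p (fun x => u x - c0) x₀ R ^ p = TL n s p (fun x => u (Sm x₀ R x) - c0) ^ (p / (p - 1)) := by
    rw [E4]; unfold tailE
    rw [← ENNReal.rpow_mul]
    congr 1
    ring
  unfold Nr at key
  simp only at E1 E2 E3 key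
  rw [E1, E2, E3, ← E5] at key
  rw [← hc0, show R / 2 = R * (1/2) by ring, show 2 * R = R * 2 by ring]
  have hm := mul_le_mul' (le_refl (ENNReal.ofReal (R ^ ((n:ℝ) - p)))) key
  have c1 : ENNReal.ofReal (R ^ ((n:ℝ) - p)) * ENNReal.ofReal (R ^ (p - (n:ℝ))) = 1 := by
    rw [← ENNReal.ofReal_mul (by positivity), ← Real.rpow_add hR]
    simp
  have c2 : ENNReal.ofReal (R ^ ((n:ℝ) - p)) * ENNReal.ofReal (R ^ (s * p * (p / (p - 1)) - (n:ℝ))) =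
      ENNReal.ofReal (R ^ (p * (s * (p / (p - 1)) - 1))) := by
    rw [← ENNReal.ofReal_mul (by positivity), ← Real.rpow_add hR]
    congr 2; ring
  rw [← mul_assoc, c1, one_mul] at hm
  refine hm.trans (le_of_eq ?_)
  rw [ENNReal.ofReal_mul (q := R ^ (p * (s * (p / (p - 1)) - 1))) (by positivity), ← c2]
  generalize ENNReal.ofReal (R ^ ((n:ℝ) - p)) = a at *
  generalize ENNReal.ofReal (R ^ (p - (n:ℝ))) = b at *
  rw [mul_add, mul_left_comm a (ENNReal.ofReal δ), mul_add a, ← mul_assoc a b, c1, one_mul]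
  congr 1
  ring
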